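/- Let (α,z) be in the data-processing region D with |1−α|/z ≠ 1, let ρ₁ and ρ₂ be quantum states of dimensions d₁ and d₂, let {S_d}_{d≥1} satisfy Assumption 1′, and suppose S_{d₁} contains a state whose support contains supp(ρ₁) and S_{d₂} contains a state whose support contains supp(ρ₂). Let σ_{0,1} be a minimizer of σ ↦ D_{α,z}(ρ₁‖σ) over S_{d₁}. If σ_{0,1} commutes with ρ₁, then min_{σ ∈ S_{d₁d₂}} D_{α,z}(ρ₁ ⊗ ρ₂‖σ) = min_{σ ∈ S_{d₁}} D_{α,z}(ρ₁‖σ) + min_{σ ∈ S_{d₂}} D_{α,z}(ρ₂‖σ). -/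

import Mathlib

open scoped BigOperators ComplexOrder Classical
open MeasureTheory Filter Set

noncomputable section

namespace QHT

variable {ι : Type*} [Fintype ι] [DecidableEq ι]

/-- Generalized matrix power `A ^ w` (complex exponent `w`) of a Hermitian matrix,
via functional calculus on the support: the eigenvalue `0` is mapped to `0`. -/
def mpow (A : Matrix ι ι ℂ) (w : ℂ) : Matrix ι ι ℂ :=
  if hA : A.IsHermitian then
    (hA.eigenvectorUnitary : Matrix ι ι ℂ) *
      Matrix.diagonal (fun i => if hA.eigenvalues i = 0 then 0 else (hA.eigenvalues i : ℂ) ^ w) *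
      star (hA.eigenvectorUnitary : Matrix ι ι ℂ)
  else 0

/-- Matrix logarithm of a Hermitian matrix, taken on its support
(`Real.log 0 = 0`, so the kernel is mapped to `0`). -/
def mlog (A : Matrix ι ι ℂ) : Matrix ι ι ℂ :=
  if hA : A.IsHermitian then
    (hA.eigenvectorUnitary : Matrix ι ι ℂ) *
      Matrix.diagonal (fun i => (Real.log (hA.eigenvalues i) : ℂ)) *
      star (hA.eigenvectorUnitary : Matrix ι ι ℂ)
  else 0

/-- The support of a matrix, i.e. its range as a linear map. -/
def msupp (A : Matrix ι ι ℂ) : Submodule ℂ (ι → ℂ) := LinearMap.range A.mulVecLin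

/-- A quantum state: a positive semidefinite matrix of trace one. -/
def IsState (A : Matrix ι ι ℂ) : Prop := A.PosSemidef ∧ A.trace = 1

/-- Real part of the trace. -/
def rtr (A : Matrix ι ι ℂ) : ℝ := A.trace.re

/-- The Umegaki relative entropy `D(ρ‖σ)`, with value `+∞` when `supp ρ ⊄ supp σ`. -/
def relEnt (ρ σ : Matrix ι ι ℂ) : EReal :=
  if msupp ρ ≤ msupp σ then ((rtr (ρ * (mlog ρ - mlog σ)) : ℝ) : EReal) else ⊤

/-- The polar of a set of matrices (intersected with the PSD cone). -/
def polar (S : Set (Matrix ι ι ℂ)) : Set (Matrix ι ι ℂ) :=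
  {X | X.PosSemidef ∧ ∀ Y ∈ S, rtr (X * Y) ≤ 1}

/-- Entrywise Bochner integral of a matrix-valued function over `ℝ`. -/
def mInt (f : ℝ → Matrix ι ι ℂ) : Matrix ι ι ℂ :=
  Matrix.of fun i j => ∫ t : ℝ, f t i j

/-- Entrywise Bochner integral of a matrix-valued function over a set `s ⊆ ℝ`. -/
def mIntOn (f : ℝ → Matrix ι ι ℂ) (s : Set ℝ) : Matrix ι ι ℂ :=
  Matrix.of fun i j => ∫ t in s, f t i j

/-- `sinc` function. -/
def sinc (s : ℝ) : ℝ := if s = 0 then 1 else Real.sin s / s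

/-- The probability density `β_θ` from the paper (`β₀` is the `θ → 0` limit). -/
def betaDist (θ t : ℝ) : ℝ :=
  if θ = 0 then Real.pi / (2 * (Real.cosh (Real.pi * t) + 1))
  else Real.sin (θ * Real.pi) / (2 * θ * (Real.cosh (Real.pi * t) + Real.cos (θ * Real.pi)))

/-- `Q_{α,z}(ρ‖σ) = Tr[(ρ^{α/2z} σ^{(1-α)/z} ρ^{α/2z})^z]`. -/
def Qaz (α z : ℝ) (ρ σ : Matrix ι ι ℂ) : ℝ :=
  rtr (mpow (mpow ρ ((α / (2 * z) : ℝ) : ℂ) * mpow σ (((1 - α) / z : ℝ) : ℂ) *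
      mpow ρ ((α / (2 * z) : ℝ) : ℂ)) ((z : ℝ) : ℂ))

/-- The `α`-`z` Rényi relative entropy. -/
def Daz (α z : ℝ) (ρ σ : Matrix ι ι ℂ) : EReal :=
  if (α < 1 ∧ (ρ * σ).trace ≠ 0) ∨ msupp ρ ≤ msupp σ then
    (((α - 1)⁻¹ * Real.log (Qaz α z ρ σ) : ℝ) : EReal)
  else ⊤

/-- `Q_α(ρ‖σ) = Tr[ρ^α σ^{1-α}]` (Petz). -/
def Qpetz (α : ℝ) (ρ σ : Matrix ι ι ℂ) : ℝ :=
  rtr (mpow ρ ((α : ℝ) : ℂ) * mpow σ (((1 - α) : ℝ) : ℂ))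

/-- The Petz Rényi divergence. -/
def Dpetz (α : ℝ) (ρ σ : Matrix ι ι ℂ) : EReal :=
  if (α < 1 ∧ (ρ * σ).trace ≠ 0) ∨ msupp ρ ≤ msupp σ then
    (((α - 1)⁻¹ * Real.log (Qpetz α ρ σ) : ℝ) : EReal)
  else ⊤

/-- `Q̃_α(ρ‖σ) = Tr[(σ^{(1-α)/2α} ρ σ^{(1-α)/2α})^α]` (sandwiched). -/
def Qsand (α : ℝ) (ρ σ : Matrix ι ι ℂ) : ℝ :=
  rtr (mpow (mpow σ (((1 - α) / (2 * α) : ℝ) : ℂ) * ρ * mpow σ (((1 - α) / (2 * α) : ℝ) : ℂ))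
    ((α : ℝ) : ℂ))

/-- The sandwiched Rényi divergence. -/
def Dsand (α : ℝ) (ρ σ : Matrix ι ι ℂ) : EReal :=
  if (α < 1 ∧ (ρ * σ).trace ≠ 0) ∨ msupp ρ ≤ msupp σ then
    (((α - 1)⁻¹ * Real.log (Qsand α ρ σ) : ℝ) : EReal)
  else ⊤

/-- `D̃_∞(ρ‖σ)`: the limit of `D̃_α(ρ‖σ)` as `α → +∞` (encoded as a `limsup`; the limit
exists by monotonicity in `α`). -/
def DsandInf (ρ σ : Matrix ι ι ℂ) : EReal :=
  Filter.limsup (fun α : ℝ => Dsand α ρ σ) Filter.atTop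

/-- `χ_{α,z}(ρ,σ) = ρ^{α/2z} (ρ^{α/2z} σ^{(1-α)/z} ρ^{α/2z})^{z-1} ρ^{α/2z}`. -/
def chi (α z : ℝ) (ρ σ : Matrix ι ι ℂ) : Matrix ι ι ℂ :=
  mpow ρ ((α / (2 * z) : ℝ) : ℂ) *
    mpow (mpow ρ ((α / (2 * z) : ℝ) : ℂ) * mpow σ (((1 - α) / z : ℝ) : ℂ) *
      mpow ρ ((α / (2 * z) : ℝ) : ℂ)) (((z - 1 : ℝ)) : ℂ) *
    mpow ρ ((α / (2 * z) : ℝ) : ℂ)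

/-- The data-processing region `𝒟` for `α`-`z` Rényi relative entropies. -/
def Dregion : Set (ℝ × ℝ) :=
  {p | (0 < p.1 ∧ p.1 < 1 ∧ max p.1 (1 - p.1) ≤ p.2) ∨
       (1 < p.1 ∧ max (p.1 / 2) (p.1 - 1) ≤ p.2 ∧ p.2 ≤ p.1) ∨
       (p.1 = 1 ∧ 0 < p.2)}

end QHT

namespace QHT

variable {ι : Type*} [Fintype ι] [DecidableEq ι]

/-! ### Tensor products and many copies -/

/-- Tensor product of a `d₁`- and a `d₂`-dimensional operator, as a `d₁d₂`-dimensional one. -/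
def dtens {a b : ℕ} (A : Matrix (Fin a) (Fin a) ℂ) (B : Matrix (Fin b) (Fin b) ℂ) :
    Matrix (Fin (a * b)) (Fin (a * b)) ℂ :=
  Matrix.of fun x y =>
    A (finProdFinEquiv.symm x).1 (finProdFinEquiv.symm y).1 *
      B (finProdFinEquiv.symm x).2 (finProdFinEquiv.symm y).2

/-- `ρ^{⊗n}` of a `d`-dimensional operator, as a `d^n`-dimensional operator. -/
def dpow {d : ℕ} (ρ : Matrix (Fin d) (Fin d) ℂ) (n : ℕ) :
    Matrix (Fin (d ^ n)) (Fin (d ^ n)) ℂ :=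
  Matrix.of fun x y => ∏ i, ρ (finFunctionFinEquiv.symm x i) (finFunctionFinEquiv.symm y i)

/-- The action of a permutation of the `k` tensor factors on an operator on `(ℂ^d)^{⊗k}`. -/
def permMat (d k : ℕ) (π : Equiv.Perm (Fin k)) (A : Matrix (Fin (d ^ k)) (Fin (d ^ k)) ℂ) :
    Matrix (Fin (d ^ k)) (Fin (d ^ k)) ℂ :=
  Matrix.of fun x y =>
    A (finFunctionFinEquiv ((finFunctionFinEquiv.symm x) ∘ π))
      (finFunctionFinEquiv ((finFunctionFinEquiv.symm y) ∘ π))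

/-- `ρ^{⊗n}` of a `d`-dimensional operator, as an operator on `H^{⊗n}` with `H = ℂ^d`,
indexed by tuples. -/
def tpow {d : ℕ} (ρ : Matrix (Fin d) (Fin d) ℂ) (n : ℕ) :
    Matrix (Fin n → Fin d) (Fin n → Fin d) ℂ :=
  Matrix.of fun x y => ∏ i, ρ (x i) (y i)

/-- Tensor product of an operator on `H^{⊗m}` and an operator on `H^{⊗n}`, as an
operator on `H^{⊗(m+n)}`. -/
def tensOp {d m n : ℕ} (A : Matrix (Fin m → Fin d) (Fin m → Fin d) ℂ)
    (B : Matrix (Fin n → Fin d) (Fin n → Fin d) ℂ) :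
    Matrix (Fin (m + n) → Fin d) (Fin (m + n) → Fin d) ℂ :=
  Matrix.of fun x y =>
    A (fun i => x (Fin.castAdd n i)) (fun i => y (Fin.castAdd n i)) *
      B (fun j => x (Fin.natAdd m j)) (fun j => y (Fin.natAdd m j))

/-- Permutation action on operators on `H^{⊗k}`. -/
def permOp {d k : ℕ} (π : Equiv.Perm (Fin k))
    (A : Matrix (Fin k → Fin d) (Fin k → Fin d) ℂ) :
    Matrix (Fin k → Fin d) (Fin k → Fin d) ℂ :=
  Matrix.of fun x y => A (x ∘ π) (y ∘ π)

/-! ### Hypothesis testing -/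

/-- A test: an operator `T` with `0 ≤ T ≤ I`. -/
def IsTest (T : Matrix ι ι ℂ) : Prop := T.PosSemidef ∧ (1 - T).PosSemidef

/-- Type I error `α_n(ρ|T) = Tr[(I - T) ρ^{⊗n}]`. -/
def typeI {d : ℕ} (ρ : Matrix (Fin d) (Fin d) ℂ) (n : ℕ)
    (T : Matrix (Fin n → Fin d) (Fin n → Fin d) ℂ) : ℝ :=
  rtr ((1 - T) * tpow ρ n)

/-- Type II error `β_n(S|T) = sup_{σ ∈ S} Tr[σ T]`. -/
def typeII {d n : ℕ} (S : Set (Matrix (Fin n → Fin d) (Fin n → Fin d) ℂ))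
    (T : Matrix (Fin n → Fin d) (Fin n → Fin d) ℂ) : ℝ :=
  sSup ((fun σ => rtr (σ * T)) '' S)

/-- `- log x`, valued in `EReal`, with `- log x = +∞` for `x ≤ 0`. -/
def negLog (x : ℝ) : EReal := if x ≤ 0 then ⊤ else ((- Real.log x : ℝ) : EReal)

/-- The exponential rate `-(1/n) log x`. -/
def rate (n : ℕ) (x : ℝ) : EReal := (((n : ℝ)⁻¹ : ℝ) : EReal) * negLog x

/-- The Stein exponent `s(ρ‖{S_n})`. -/
def steinExp {d : ℕ} (ρ : Matrix (Fin d) (Fin d) ℂ)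
    (S : (n : ℕ) → Set (Matrix (Fin n → Fin d) (Fin n → Fin d) ℂ)) : EReal :=
  sSup ((fun r : ℝ => (r : EReal)) ''
    {r : ℝ | 0 ≤ r ∧ ∃ T : (n : ℕ) → Matrix (Fin n → Fin d) (Fin n → Fin d) ℂ,
      (∀ n, IsTest (T n)) ∧
      (r : EReal) ≤ Filter.liminf (fun n => rate n (typeII (S n) (T n))) Filter.atTop ∧
      Filter.Tendsto (fun n => typeI ρ n (T n)) Filter.atTop (nhds 0)})

/-- The Chernoff exponent `c(ρ‖{S_n})`. -/
def chernoffExp {d : ℕ} (ρ : Matrix (Fin d) (Fin d) ℂ)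
    (S : (n : ℕ) → Set (Matrix (Fin n → Fin d) (Fin n → Fin d) ℂ)) : EReal :=
  Filter.liminf (fun n =>
    rate n (sInf ((fun T => typeI ρ n T + typeII (S n) T) '' {T | IsTest T}))) Filter.atTop

/-- The Hoeffding (direct) exponent `d_r(ρ‖{S_n})`. -/
def hoeffdingExp {d : ℕ} (r : ℝ) (ρ : Matrix (Fin d) (Fin d) ℂ)
    (S : (n : ℕ) → Set (Matrix (Fin n → Fin d) (Fin n → Fin d) ℂ)) : EReal :=
  ⨆ T : {T : (n : ℕ) → Matrix (Fin n → Fin d) (Fin n → Fin d) ℂ //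
      (∀ n, IsTest (T n)) ∧
      (r : EReal) ≤ Filter.liminf (fun n => rate n (typeII (S n) (T n))) Filter.atTop},
    Filter.liminf (fun n => rate n (typeI ρ n (T.1 n))) Filter.atTop

/-- The strong converse exponent `sc_r(ρ‖{S_n})`. -/
def scExp {d : ℕ} (r : ℝ) (ρ : Matrix (Fin d) (Fin d) ℂ)
    (S : (n : ℕ) → Set (Matrix (Fin n → Fin d) (Fin n → Fin d) ℂ)) : EReal :=
  ⨅ T : {T : (n : ℕ) → Matrix (Fin n → Fin d) (Fin n → Fin d) ℂ //
      (∀ n, IsTest (T n)) ∧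
      (r : EReal) ≤ Filter.liminf (fun n => rate n (typeII (S n) (T n))) Filter.atTop},
    Filter.limsup (fun n => rate n (1 - typeI ρ n (T.1 n))) Filter.atTop

/-- Assumption 1 of the paper for a family `{S_n}_{n ≥ 1}` of sets of operators
on `H^{⊗n}`, `H = ℂ^d`: each `S_n` is a convex compact set of positive semidefinite
operators, closed under tensor products, and with polar sets closed under tensor
products. -/
structure Assumption1 {d : ℕ}
    (S : (n : ℕ) → Set (Matrix (Fin n → Fin d) (Fin n → Fin d) ℂ)) : Prop where
  psd : ∀ n, 1 ≤ n → ∀ X ∈ S n, X.PosSemidef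
  convex : ∀ n, 1 ≤ n → Convex ℝ (S n)
  compact : ∀ n, 1 ≤ n → IsCompact (S n)
  tens : ∀ m n, 1 ≤ m → 1 ≤ n → ∀ A ∈ S m, ∀ B ∈ S n, tensOp A B ∈ S (m + n)
  polarTens : ∀ m n, 1 ≤ m → 1 ≤ n →
    ∀ A ∈ polar (S m), ∀ B ∈ polar (S n), tensOp A B ∈ polar (S (m + n))

/-- Assumption 1′ of the paper for a dimension-indexed family `{S_d}_{d ≥ 1}`. -/
structure Assumption1' (S : (d : ℕ) → Set (Matrix (Fin d) (Fin d) ℂ)) : Prop where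
  psd : ∀ d, 1 ≤ d → ∀ X ∈ S d, X.PosSemidef
  convex : ∀ d, 1 ≤ d → Convex ℝ (S d)
  compact : ∀ d, 1 ≤ d → IsCompact (S d)
  tens : ∀ d₁ d₂, 1 ≤ d₁ → 1 ≤ d₂ → ∀ A ∈ S d₁, ∀ B ∈ S d₂, dtens A B ∈ S (d₁ * d₂)
  polarTens : ∀ d₁ d₂, 1 ≤ d₁ → 1 ≤ d₂ →
    ∀ A ∈ polar (S d₁), ∀ B ∈ polar (S d₂), dtens A B ∈ polar (S (d₁ * d₂))

end QHT

namespace QHT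

section Auxiliary

open Matrix
open scoped MatrixOrder Kronecker
set_option linter.unusedSectionVars false

section FunctionalCalculus

variable {m n : Type*} [Fintype m] [Fintype n] [DecidableEq m] [DecidableEq n]

/-- The spectral functional calculus of a Hermitian matrix. -/
def hfun (f : ℝ → ℝ) (A : Matrix n n ℂ) : Matrix n n ℂ :=
  if hA : A.IsHermitian then
    (hA.eigenvectorUnitary : Matrix n n ℂ) *
      diagonal (fun i => ((f (hA.eigenvalues i) : ℝ) : ℂ)) *
      (hA.eigenvectorUnitary : Matrix n n ℂ)ᴴ
  else 0

theorem hfun_eq (f : ℝ → ℝ) {A : Matrix n n ℂ} (hA : A.IsHermitian) :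
    hfun f A = (hA.eigenvectorUnitary : Matrix n n ℂ) *
      diagonal (fun i => ((f (hA.eigenvalues i) : ℝ) : ℂ)) *
      (hA.eigenvectorUnitary : Matrix n n ℂ)ᴴ := by
  simp [hfun, hA]

theorem eigU_mul {A : Matrix n n ℂ} (hA : A.IsHermitian) :
    (hA.eigenvectorUnitary : Matrix n n ℂ) * (hA.eigenvectorUnitary : Matrix n n ℂ)ᴴ = 1 :=
  Unitary.coe_mul_star_self _

theorem eigU_mul' {A : Matrix n n ℂ} (hA : A.IsHermitian) :
    (hA.eigenvectorUnitary : Matrix n n ℂ)ᴴ * (hA.eigenvectorUnitary : Matrix n n ℂ) = 1 :=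
  Unitary.coe_star_mul_self _

theorem hfun_id {A : Matrix n n ℂ} (hA : A.IsHermitian) : hfun (fun x => x) A = A := by
  rw [hfun_eq _ hA]
  conv_rhs => rw [hA.spectral_theorem]
  rfl

theorem hfun_congr {f g : ℝ → ℝ} {A : Matrix n n ℂ}
    (h : ∀ (hA : A.IsHermitian) i, f (hA.eigenvalues i) = g (hA.eigenvalues i)) :
    hfun f A = hfun g A := by
  unfold hfun
  split_ifs with hA
  · simp [h hA]
  · rfl

theorem hfun_isHermitian (f : ℝ → ℝ) (A : Matrix n n ℂ) : (hfun f A).IsHermitian := by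
  unfold hfun
  split_ifs with hA
  · refine isHermitian_mul_mul_conjTranspose _ ?_
    rw [isHermitian_diagonal_iff]
    intro i
    simp [isSelfAdjoint_iff]
  · exact isHermitian_zero

theorem hfun_mul (f g : ℝ → ℝ) (A : Matrix n n ℂ) :
    hfun f A * hfun g A = hfun (fun x => f x * g x) A := by
  unfold hfun
  split_ifs with hA
  · have : diagonal (fun i => ((f (hA.eigenvalues i) * g (hA.eigenvalues i) : ℝ) : ℂ)) =
        diagonal (fun i => ((f (hA.eigenvalues i) : ℝ) : ℂ)) *
        diagonal (fun i => ((g (hA.eigenvalues i) : ℝ) : ℂ)) := by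
      simp [diagonal_mul_diagonal]
    rw [this]
    simp only [Matrix.mul_assoc]
    rw [← Matrix.mul_assoc (hA.eigenvectorUnitary : Matrix n n ℂ)ᴴ, eigU_mul' hA, Matrix.one_mul]
  · simp

theorem hfun_add (f g : ℝ → ℝ) (A : Matrix n n ℂ) :
    hfun f A + hfun g A = hfun (fun x => f x + g x) A := by
  unfold hfun
  split_ifs with hA
  · rw [← Matrix.add_mul, ← Matrix.mul_add]
    simp [diagonal_add]
  · simp

theorem hfun_smul (c : ℝ) (f : ℝ → ℝ) (A : Matrix n n ℂ) :
    c • hfun f A = hfun (fun x => c * f x) A := by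
  unfold hfun
  split_ifs with hA
  · rw [← Matrix.smul_mul, ← Matrix.mul_smul]
    congr 3
    ext i j
    by_cases h : i = j
    · subst h; simp
    · simp [h]
  · simp

theorem hfun_const (c : ℝ) {A : Matrix n n ℂ} (hA : A.IsHermitian) :
    hfun (fun _ => c) A = c • (1 : Matrix n n ℂ) := by
  have : hfun (fun _ => (1 : ℝ)) A = 1 := by
    rw [hfun_eq _ hA]
    simp [eigU_mul hA]
  rw [← this, hfun_smul]
  simp

theorem diagonal_intertwine {a : m → ℝ} {b : n → ℝ} {M : Matrix m n ℂ} (f : ℝ → ℝ)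
    (h : diagonal (fun i => (a i : ℂ)) * M = M * diagonal (fun i => (b i : ℂ))) :
    diagonal (fun i => ((f (a i) : ℝ) : ℂ)) * M = M * diagonal (fun i => ((f (b i) : ℝ) : ℂ)) := by
  ext i j
  have := congrFun (congrFun h i) j
  simp only [diagonal_mul, mul_diagonal] at this ⊢
  by_cases hM : M i j = 0
  · simp [hM]
  · rw [mul_comm] at this
    have h2 : (a i : ℂ) = b j := mul_left_cancel₀ hM this
    have h3 : a i = b j := by exact_mod_cast h2
    rw [h3, mul_comm]

/-- The functional calculus respects intertwiners. -/
theorem hfun_intertwine (f : ℝ → ℝ) {A : Matrix m m ℂ} {B : Matrix n n ℂ}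
    (hA : A.IsHermitian) (hB : B.IsHermitian) {V : Matrix m n ℂ} (h : A * V = V * B) :
    hfun f A * V = V * hfun f B := by
  set U := (hA.eigenvectorUnitary : Matrix m m ℂ) with hU
  set W := (hB.eigenvectorUnitary : Matrix n n ℂ) with hW
  have hUU : Uᴴ * U = 1 := eigU_mul' hA
  have hUU' : U * Uᴴ = 1 := eigU_mul hA
  have hWW : Wᴴ * W = 1 := eigU_mul' hB
  have hWW' : W * Wᴴ = 1 := eigU_mul hB
  have key := diagonal_intertwine (a := hA.eigenvalues) (b := hB.eigenvalues)
    (M := Uᴴ * V * W) f (by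
      have h1 : A = U * diagonal (fun i => (hA.eigenvalues i : ℂ)) * Uᴴ := by
        conv_lhs => rw [← hfun_id hA, hfun_eq _ hA]
      have h2 : B = W * diagonal (fun i => (hB.eigenvalues i : ℂ)) * Wᴴ := by
        conv_lhs => rw [← hfun_id hB, hfun_eq _ hB]
      have h3 : Uᴴ * (A * V) * W = Uᴴ * (V * B) * W := by rw [h]
      have h4 : Uᴴ * (A * V) * W =
          diagonal (fun i => (hA.eigenvalues i : ℂ)) * (Uᴴ * V * W) := by
        conv_lhs => rw [h1]
        simp only [← Matrix.mul_assoc, hUU, Matrix.one_mul]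
      have h5 : Uᴴ * (V * B) * W =
          (Uᴴ * V * W) * diagonal (fun i => (hB.eigenvalues i : ℂ)) := by
        conv_lhs => rw [h2]
        simp only [Matrix.mul_assoc, hWW, Matrix.mul_one]
      rw [← h4, h3, h5])
  rw [hfun_eq _ hA, hfun_eq _ hB, ← hU, ← hW]
  have e1 : U * diagonal (fun i => ((f (hA.eigenvalues i) : ℝ) : ℂ)) * Uᴴ * V =
      U * (diagonal (fun i => ((f (hA.eigenvalues i) : ℝ) : ℂ)) * (Uᴴ * V * W)) * Wᴴ := by
    simp only [Matrix.mul_assoc, hWW', Matrix.mul_one]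
  rw [e1, key]
  simp only [← Matrix.mul_assoc, hUU', Matrix.one_mul]

theorem hfun_diagonal (f : ℝ → ℝ) (d : n → ℝ) :
    hfun f (diagonal (fun i => (d i : ℂ))) = diagonal (fun i => ((f (d i) : ℝ) : ℂ)) := by
  have hD : (diagonal (fun i => (d i : ℂ))).IsHermitian := by
    rw [isHermitian_diagonal_iff]
    intro i
    simp [isSelfAdjoint_iff]
  set W := (hD.eigenvectorUnitary : Matrix n n ℂ) with hW
  have h2 : diagonal (fun i => (d i : ℂ)) =
      W * diagonal (fun i => (hD.eigenvalues i : ℂ)) * Wᴴ := by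
    conv_lhs => rw [← hfun_id hD, hfun_eq _ hD]
  have key := diagonal_intertwine (a := d) (b := hD.eigenvalues) (M := W) f (by
    conv_lhs => rw [h2]
    rw [Matrix.mul_assoc, eigU_mul' hD, Matrix.mul_one])
  rw [hfun_eq _ hD, ← hW, ← key, Matrix.mul_assoc, eigU_mul hD, Matrix.mul_one]

theorem isHermitian_conj_diagonal (U : Matrix m n ℂ) (d : n → ℝ) :
    (U * diagonal (fun i => (d i : ℂ)) * Uᴴ).IsHermitian := by
  refine isHermitian_mul_mul_conjTranspose _ ?_
  rw [isHermitian_diagonal_iff]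
  intro i
  simp [isSelfAdjoint_iff]

/-- The functional calculus can be computed in any diagonalization. -/
theorem hfun_conj_diagonal (f : ℝ → ℝ) (d : n → ℝ) {U : Matrix m n ℂ} (hU : Uᴴ * U = 1)
    (hU' : U * Uᴴ = 1) :
    hfun f (U * diagonal (fun i => (d i : ℂ)) * Uᴴ) =
      U * diagonal (fun i => ((f (d i) : ℝ) : ℂ)) * Uᴴ := by
  have h := hfun_intertwine f (isHermitian_conj_diagonal U d)
    (B := diagonal (fun i => (d i : ℂ))) (by
      rw [isHermitian_diagonal_iff]
      intro i
      simp [isSelfAdjoint_iff]) (V := U)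
    (by rw [Matrix.mul_assoc, hU, Matrix.mul_one])
  rw [hfun_diagonal] at h
  rw [← h, Matrix.mul_assoc (hfun _ _) U, hU', Matrix.mul_one]

theorem hfun_comp (f g : ℝ → ℝ) {A : Matrix n n ℂ} (hA : A.IsHermitian) :
    hfun f (hfun g A) = hfun (fun x => f (g x)) A := by
  rw [hfun_eq g hA, hfun_conj_diagonal f (fun i => g (hA.eigenvalues i)) (eigU_mul' hA)
    (eigU_mul hA), hfun_eq _ hA]

theorem hfun_commute (f g : ℝ → ℝ) {A B : Matrix n n ℂ} (hA : A.IsHermitian)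
    (hB : B.IsHermitian) (h : A * B = B * A) : hfun f A * hfun g B = hfun g B * hfun f A :=
  hfun_intertwine f hA hA (hfun_intertwine g hB hB h.symm).symm

theorem hfun_posSemidef {f : ℝ → ℝ} {A : Matrix n n ℂ}
    (h : ∀ (hA : A.IsHermitian) i, 0 ≤ f (hA.eigenvalues i)) : (hfun f A).PosSemidef := by
  unfold hfun
  split_ifs with hA
  · refine PosSemidef.mul_mul_conjTranspose_same ?_ _
    refine PosSemidef.diagonal fun i => ?_
    simpa using h hA i
  · exact PosSemidef.zero

theorem hfun_posDef {f : ℝ → ℝ} {A : Matrix n n ℂ} (hA : A.IsHermitian)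
    (h : ∀ i, 0 < f (hA.eigenvalues i)) : (hfun f A).PosDef := by
  rw [hfun_eq f hA]
  refine PosDef.mul_mul_conjTranspose_same ?_ ?_
  · refine PosDef.diagonal fun i => ?_
    simpa using h i
  · intro v w hvw
    have := congrArg (fun u => u ᵥ* (hA.eigenvectorUnitary : Matrix n n ℂ)ᴴ) hvw
    simpa [vecMul_vecMul, eigU_mul hA] using this

theorem hfun_le_hfun {f g : ℝ → ℝ} {A : Matrix n n ℂ}
    (h : ∀ (hA : A.IsHermitian) i, f (hA.eigenvalues i) ≤ g (hA.eigenvalues i)) :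
    hfun f A ≤ hfun g A := by
  rw [Matrix.le_iff]
  have : hfun g A - hfun f A = hfun (fun x => g x + (-1) * f x) A := by
    rw [← hfun_add, ← hfun_smul]; simp [sub_eq_add_neg]
  rw [this]
  exact hfun_posSemidef fun hA i => by linarith [h hA i]

theorem rtr_add (A B : Matrix n n ℂ) : rtr (A + B) = rtr A + rtr B := by simp [rtr]

theorem rtr_sub (A B : Matrix n n ℂ) : rtr (A - B) = rtr A - rtr B := by simp [rtr]

theorem rtr_smul (c : ℝ) (A : Matrix n n ℂ) : rtr (c • A) = c * rtr A := by simp [rtr]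

theorem rtr_mul_comm (A : Matrix m n ℂ) (B : Matrix n m ℂ) : rtr (A * B) = rtr (B * A) := by
  simp [rtr, Matrix.trace_mul_comm A B]

theorem rtr_sum {ι : Type*} (s : Finset ι) (A : ι → Matrix n n ℂ) :
    rtr (∑ i ∈ s, A i) = ∑ i ∈ s, rtr (A i) := by
  simp [rtr, Matrix.trace_sum]

theorem rtr_nonneg {A : Matrix n n ℂ} (hA : A.PosSemidef) : 0 ≤ rtr A :=
  (Complex.nonneg_iff.mp hA.trace_nonneg).1

theorem rtr_hfun (f : ℝ → ℝ) {A : Matrix n n ℂ} (hA : A.IsHermitian) :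
    rtr (hfun f A) = ∑ i, f (hA.eigenvalues i) := by
  rw [hfun_eq f hA, rtr_mul_comm, ← Matrix.mul_assoc, eigU_mul' hA, Matrix.one_mul]
  simp [rtr, Matrix.trace]

/-- Traces of products of two functional calculi are positive double sums over the spectra. -/
theorem exists_weights {A B : Matrix n n ℂ} (hA : A.IsHermitian) (hB : B.IsHermitian) :
    ∃ P : n → n → ℝ, (∀ i j, 0 ≤ P i j) ∧ ∀ f g : ℝ → ℝ, rtr (hfun f A * hfun g B) =
      ∑ i, ∑ j, P i j * (f (hA.eigenvalues i) * g (hB.eigenvalues j)) := by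
  set U := (hA.eigenvectorUnitary : Matrix n n ℂ) with hU
  set W := (hB.eigenvectorUnitary : Matrix n n ℂ) with hW
  refine ⟨fun i j => Complex.normSq ((Uᴴ * W) i j), fun i j => Complex.normSq_nonneg _,
    fun f g => ?_⟩
  rw [hfun_eq f hA, hfun_eq g hB, ← hU, ← hW]
  have : rtr (U * diagonal (fun i => ((f (hA.eigenvalues i) : ℝ) : ℂ)) * Uᴴ *
      (W * diagonal (fun i => ((g (hB.eigenvalues i) : ℝ) : ℂ)) * Wᴴ)) =
      rtr (diagonal (fun i => ((f (hA.eigenvalues i) : ℝ) : ℂ)) * (Uᴴ * W) *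
        (diagonal (fun i => ((g (hB.eigenvalues i) : ℝ) : ℂ)) * (Uᴴ * W)ᴴ)) := by
    rw [Matrix.mul_assoc, Matrix.mul_assoc, rtr_mul_comm]
    simp [Matrix.mul_assoc]
  rw [this, rtr, Matrix.trace]
  simp only [diag_apply, Matrix.mul_apply (M := _ * (Uᴴ * W)), Complex.re_sum]
  refine Finset.sum_congr rfl fun i _ => Finset.sum_congr rfl fun j _ => ?_
  rw [diagonal_mul, diagonal_mul, conjTranspose_apply]
  have : ∀ (a b : ℝ) (w : ℂ), ((a : ℂ) * w * ((b : ℂ) * star w)).re =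
      Complex.normSq w * (a * b) := by
    intro a b w
    have : (a : ℂ) * w * ((b : ℂ) * star w) = ((a * b : ℝ) : ℂ) * (w * (starRingEnd ℂ) w) := by
      push_cast; simp only [starRingEnd_apply]; ring
    rw [this, Complex.mul_conj, ← Complex.ofReal_mul, Complex.ofReal_re, mul_comm]
  exact this _ _ _

/-- Klein's inequality. -/
theorem klein {f g : ℝ → ℝ} {A B : Matrix n n ℂ} (hA : A.IsHermitian) (hB : B.IsHermitian)
    (h : ∀ i j, f (hB.eigenvalues j) + (hA.eigenvalues i - hB.eigenvalues j) *
      g (hB.eigenvalues j) ≤ f (hA.eigenvalues i)) :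
    rtr (hfun f B) + rtr ((A - B) * hfun g B) ≤ rtr (hfun f A) := by
  obtain ⟨P, hP, hPf⟩ := exists_weights hA hB
  have e1 : rtr (hfun f A) =
      ∑ i, ∑ j, P i j * (f (hA.eigenvalues i) * 1) := by
    rw [← hPf f (fun _ => 1), hfun_const 1 hB]; simp
  have e2 : rtr (hfun f B) = ∑ i, ∑ j, P i j * (1 * f (hB.eigenvalues j)) := by
    rw [← hPf (fun _ => 1) f, hfun_const 1 hA]; simp
  have e3 : rtr (A * hfun g B) =
      ∑ i, ∑ j, P i j * (hA.eigenvalues i * g (hB.eigenvalues j)) := by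
    rw [← hPf (fun x => x) g, hfun_id hA]
  have e4 : rtr (B * hfun g B) =
      ∑ i, ∑ j, P i j * (1 * (hB.eigenvalues j * g (hB.eigenvalues j))) := by
    rw [← hPf (fun _ => 1) (fun x => x * g x), hfun_const 1 hA, ← hfun_mul, hfun_id hB]; simp
  rw [Matrix.sub_mul, rtr_sub, e1, e2, e3, e4, ← Finset.sum_sub_distrib, ← Finset.sum_add_distrib]
  refine Finset.sum_le_sum fun i _ => ?_
  rw [← Finset.sum_sub_distrib, ← Finset.sum_add_distrib]
  refine Finset.sum_le_sum fun j _ => ?_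
  have := mul_le_mul_of_nonneg_left (h i j) (hP i j)
  linarith

/-- Klein's inequality, concave version. -/
theorem klein_concave {f g : ℝ → ℝ} {A B : Matrix n n ℂ} (hA : A.IsHermitian)
    (hB : B.IsHermitian)
    (h : ∀ i j, f (hA.eigenvalues i) ≤ f (hB.eigenvalues j) +
      (hA.eigenvalues i - hB.eigenvalues j) * g (hB.eigenvalues j)) :
    rtr (hfun f A) ≤ rtr (hfun f B) + rtr ((A - B) * hfun g B) := by
  have := klein (f := fun x => (-1) * f x) (g := fun x => (-1) * g x) hA hB
    (fun i j => by linarith [h i j])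
  simp only [← hfun_smul, Matrix.mul_smul, rtr_smul] at this
  linarith

/-- The quadratic form of a matrix. -/
def qf (A : Matrix n n ℂ) (v : n → ℂ) : ℝ := (star v ⬝ᵥ A *ᵥ v).re

theorem qf_add (A B : Matrix n n ℂ) (v : n → ℂ) : qf (A + B) v = qf A v + qf B v := by
  simp [qf, Matrix.add_mulVec]

theorem qf_sub (A B : Matrix n n ℂ) (v : n → ℂ) : qf (A - B) v = qf A v - qf B v := by
  simp [qf, Matrix.sub_mulVec]

theorem qf_smul (c : ℝ) (A : Matrix n n ℂ) (v : n → ℂ) : qf (c • A) v = c * qf A v := by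
  simp [qf, Matrix.smul_mulVec]

theorem qf_nonneg {A : Matrix n n ℂ} (hA : A.PosSemidef) (v : n → ℂ) : 0 ≤ qf A v :=
  hA.re_dotProduct_nonneg v

theorem qf_mono {A B : Matrix n n ℂ} (h : A ≤ B) (v : n → ℂ) : qf A v ≤ qf B v := by
  have := qf_nonneg (Matrix.le_iff.mp h) v
  rw [qf_sub] at this; linarith

theorem posSemidef_of_qf {A : Matrix n n ℂ} (hA : A.IsHermitian) (h : ∀ v, 0 ≤ qf A v) :
    A.PosSemidef := by
  refine PosSemidef.of_dotProduct_mulVec_nonneg hA fun v => ?_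
  rw [Complex.nonneg_iff]
  refine ⟨h v, ?_⟩
  have := hA.im_star_dotProduct_mulVec_self v
  simpa using this.symm

theorem isClosed_posSemidef : IsClosed {A : Matrix n n ℂ | A.PosSemidef} := by
  have : {A : Matrix n n ℂ | A.PosSemidef} =
      {A : Matrix n n ℂ | Aᴴ = A} ∩ ⋂ v : n → ℂ, {A | 0 ≤ qf A v} := by
    ext A
    simp only [Set.mem_ofPred_eq, mem_inter_iff, mem_iInter]
    exact ⟨fun h => ⟨h.1, qf_nonneg h⟩, fun h => posSemidef_of_qf h.1 h.2⟩
  rw [this]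
  refine IsClosed.inter (isClosed_eq (by fun_prop) (by fun_prop)) (isClosed_iInter fun v => ?_)
  refine isClosed_le (by fun_prop) ?_
  unfold qf
  fun_prop

theorem tendsto_hfun {ι : Type*} {l : Filter ι} {f : ι → ℝ → ℝ} {g : ℝ → ℝ} {A : Matrix n n ℂ}
    (h : ∀ (hA : A.IsHermitian) i, Tendsto (fun x => f x (hA.eigenvalues i)) l
      (nhds (g (hA.eigenvalues i)))) :
    Tendsto (fun x => hfun (f x) A) l (nhds (hfun g A)) := by
  by_cases hA : A.IsHermitian
  · simp only [hfun_eq _ hA]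
    refine Tendsto.mul (Tendsto.mul tendsto_const_nhds ?_) tendsto_const_nhds
    refine tendsto_pi_nhds.mpr fun i => tendsto_pi_nhds.mpr fun j => ?_
    by_cases hij : i = j
    · subst hij
      simp only [diagonal_apply_eq]
      exact (Complex.continuous_ofReal.tendsto _).comp (h hA i)
    · simp only [diagonal_apply_ne _ hij]
      exact tendsto_const_nhds
  · simp only [hfun, dif_neg hA]
    exact tendsto_const_nhds

end FunctionalCalculus

section Powers

variable {m n : Type*} [Fintype m] [Fintype n] [DecidableEq m] [DecidableEq n]

/-- Real powers of a Hermitian matrix. -/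
def pw (p : ℝ) (A : Matrix n n ℂ) : Matrix n n ℂ := hfun (fun x => x ^ p) A

theorem pw_isHermitian (p : ℝ) (A : Matrix n n ℂ) : (pw p A).IsHermitian := hfun_isHermitian _ _

theorem pw_posSemidef (p : ℝ) {A : Matrix n n ℂ} (hA : A.PosSemidef) : (pw p A).PosSemidef :=
  hfun_posSemidef fun _ i => Real.rpow_nonneg (hA.eigenvalues_nonneg i) p

theorem pw_posDef (p : ℝ) {A : Matrix n n ℂ} (hA : A.PosDef) : (pw p A).PosDef :=
  hfun_posDef hA.1 fun i => Real.rpow_pos_of_pos (hA.eigenvalues_pos i) p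

theorem pw_zero {A : Matrix n n ℂ} (hA : A.IsHermitian) : pw 0 A = 1 := by
  simp only [pw, Real.rpow_zero]
  rw [hfun_const 1 hA, one_smul]

theorem pw_one {A : Matrix n n ℂ} (hA : A.IsHermitian) : pw 1 A = A := by
  simp only [pw, Real.rpow_one]
  exact hfun_id hA

theorem pw_mul (p q : ℝ) {A : Matrix n n ℂ} (hA : A.PosDef) : pw p A * pw q A = pw (p + q) A := by
  rw [pw, pw, pw, hfun_mul]
  exact hfun_congr fun _ i => (Real.rpow_add (hA.eigenvalues_pos i) p q).symm

theorem pw_mul_neg (p : ℝ) {A : Matrix n n ℂ} (hA : A.PosDef) : pw p A * pw (-p) A = 1 := by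
  rw [pw_mul p _ hA, add_neg_cancel, pw_zero hA.1]

theorem pw_neg_mul (p : ℝ) {A : Matrix n n ℂ} (hA : A.PosDef) : pw (-p) A * pw p A = 1 := by
  rw [pw_mul _ _ hA, neg_add_cancel, pw_zero hA.1]

theorem pw_pw (p q : ℝ) {A : Matrix n n ℂ} (hA : A.PosSemidef) : pw p (pw q A) = pw (q * p) A := by
  rw [pw, pw, pw, hfun_comp _ _ hA.1]
  exact hfun_congr fun _ i => (Real.rpow_mul (hA.eigenvalues_nonneg i) q p).symm

theorem pw_commute (p q : ℝ) {A B : Matrix n n ℂ} (hA : A.IsHermitian)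
    (hB : B.IsHermitian) (h : A * B = B * A) : pw p A * pw q B = pw q B * pw p A :=
  hfun_commute _ _ hA hB h

theorem posDef_mul_of_commute {A B : Matrix n n ℂ} (hA : A.PosDef) (hB : B.PosDef)
    (h : A * B = B * A) : (A * B).PosDef := by
  have h1 := pw_commute (1 / 2) 1 hA.1 hB.1 h
  rw [pw_one hB.1] at h1
  have h2 : A = pw (1 / 2) A * pw (1 / 2) A := by
    rw [pw_mul _ _ hA]; norm_num [pw_one hA.1]
  have h3 : A * B = pw (1 / 2) A * B * (pw (1 / 2) A)ᴴ := by
    rw [(pw_isHermitian _ _).eq, Matrix.mul_assoc, ← h1, ← Matrix.mul_assoc, ← h2]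
  rw [h3]
  refine PosDef.mul_mul_conjTranspose_same hB ?_
  intro v w hvw
  have := congrArg (fun u => u ᵥ* pw (-(1 / 2)) A) hvw
  simpa [vecMul_vecMul, pw_mul_neg _ hA] using this

/-- The real inner product of complex vectors. -/
def ip (a b : n → ℂ) : ℝ := (star a ⬝ᵥ b).re

theorem qf_eq_ip (A : Matrix n n ℂ) (v : n → ℂ) : qf A v = ip v (A *ᵥ v) := rfl

theorem ip_mulVec (A : Matrix m n ℂ) (a : m → ℂ) (b : n → ℂ) :
    ip a (A *ᵥ b) = ip (Aᴴ *ᵥ a) b := by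
  rw [ip, ip, star_mulVec, conjTranspose_conjTranspose, dotProduct_mulVec]

theorem ip_self_nonneg (a : n → ℂ) : 0 ≤ ip a a := by
  simp only [ip, dotProduct, Complex.re_sum]
  refine Finset.sum_nonneg fun i _ => ?_
  simp only [Pi.star_apply, RCLike.star_def, Complex.mul_re, Complex.conj_re, Complex.conj_im]
  nlinarith [mul_self_nonneg (a i).re, mul_self_nonneg (a i).im]

theorem ip_comm (a b : n → ℂ) : ip a b = ip b a := by
  simp only [ip, dotProduct, Complex.re_sum]
  refine Finset.sum_congr rfl fun i _ => ?_
  simp only [Pi.star_apply, RCLike.star_def, Complex.mul_re, Complex.conj_re, Complex.conj_im]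
  ring

theorem ip_add_right (a b c : n → ℂ) : ip a (b + c) = ip a b + ip a c := by simp [ip]

theorem ip_sub_right (a b c : n → ℂ) : ip a (b - c) = ip a b - ip a c := by simp [ip]

theorem ip_smul_right (r : ℝ) (a b : n → ℂ) : ip a (r • b) = r * ip a b := by simp [ip]

theorem two_ip_le (a b : n → ℂ) : 2 * ip a b ≤ ip a a + ip b b := by
  have h := ip_self_nonneg (a - b)
  rw [ip_sub_right, ip_comm, ip_comm (a - b), ip_sub_right, ip_sub_right, ip_comm b a] at h
  linarith

theorem qf_mul_self {A : Matrix n n ℂ} (hA : A.IsHermitian) (v : n → ℂ) :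
    qf (A * A) v = ip (A *ᵥ v) (A *ᵥ v) := by
  rw [qf_eq_ip, ← mulVec_mulVec, ip_mulVec, hA.eq]

theorem two_ip_mul_le {x y : Matrix n n ℂ} (hx : x.IsHermitian) (hy : y.IsHermitian)
    (a b : n → ℂ) : 2 * ip a ((x * y) *ᵥ b) ≤ qf (x * x) a + qf (y * y) b := by
  rw [qf_mul_self hx, qf_mul_self hy, ← mulVec_mulVec, ip_mulVec, hx.eq]
  exact two_ip_le _ _

/-- A Hermitian off-diagonal block is bounded by the geometric mean of commuting diagonal
blocks. -/
theorem le_mul_of_pair {x y Z : Matrix n n ℂ} (hx : x.PosDef) (hy : y.PosDef)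
    (hxy : x * y = y * x) (hZ : Z.IsHermitian)
    (h : ∀ a b, 2 * ip a (Z *ᵥ b) ≤ qf (x * x) a + qf (y * y) b) : Z ≤ x * y := by
  have hH := posDef_mul_of_commute hx hy hxy
  have hD : (x * y - Z).IsHermitian := hH.1.sub hZ
  rw [Matrix.le_iff, hD.posSemidef_iff_eigenvalues_nonneg]
  intro j
  simp only [Pi.zero_apply]
  set v : n → ℂ := ⇑(hD.eigenvectorBasis j) with hv
  have hv0 : v ≠ 0 := by
    intro h0
    have h1 := hD.eigenvectorBasis.orthonormal.ne_zero j
    apply h1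
    ext i
    exact congrFun h0 i
  have hev : (x * y - Z) *ᵥ v = hD.eigenvalues j • v := hD.mulVec_eigenvectorBasis j
  set xi := pw (-1) x with hxi
  have hxix : xi * x = 1 := by
    have := pw_neg_mul 1 hx
    rwa [pw_one hx.1] at this
  have hxix' : x * xi = 1 := by
    have := pw_mul_neg 1 hx
    rwa [pw_one hx.1] at this
  have hcomm : xi * y = y * xi := by
    have := pw_commute (-1) 1 hx.1 hy.1 hxy
    rwa [pw_one hy.1] at this
  have hG : (xi * y).PosDef := posDef_mul_of_commute (pw_posDef _ hx) hy hcomm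
  have h1 := h ((xi * y) *ᵥ v) v
  have hZv : Z *ᵥ v = (x * y) *ᵥ v - hD.eigenvalues j • v := by
    rw [← hev, sub_mulVec]; abel
  have e1 : qf (x * x) ((xi * y) *ᵥ v) = qf (y * y) v := by
    rw [qf_mul_self hx.1, qf_mul_self hy.1, mulVec_mulVec, ← Matrix.mul_assoc, hxix',
      Matrix.one_mul]
  have e2 : ip ((xi * y) *ᵥ v) ((x * y) *ᵥ v) = qf (y * y) v := by
    rw [qf_mul_self hy.1, ← mulVec_mulVec, ← mulVec_mulVec, ip_mulVec, hx.1.eq, mulVec_mulVec,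
      hxix', one_mulVec]
  have e3 : ip ((xi * y) *ᵥ v) v = qf (xi * y) v := by rw [qf_eq_ip, ip_comm]
  rw [hZv, ip_sub_right, ip_smul_right, e1, e2, e3] at h1
  have hpos : 0 < qf (xi * y) v := by
    have := hG.re_dotProduct_pos hv0
    simpa [qf] using this
  by_contra hneg
  push Not at hneg
  nlinarith

end Powers

section Lieb

variable {m n : Type*} [Fintype m] [Fintype n] [DecidableEq m] [DecidableEq n]

/-- Two commuting positive definite matrices. -/
structure CommPair (A B : Matrix n n ℂ) : Prop where
  left : A.PosDef
  right : B.PosDef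
  comm : A * B = B * A

/-- The product of powers of two matrices. -/
def mm (p q : ℝ) (A B : Matrix n n ℂ) : Matrix n n ℂ := pw p A * pw q B

theorem CommPair.pw_comm {A B : Matrix n n ℂ} (h : CommPair A B) (p q : ℝ) :
    pw p A * pw q B = pw q B * pw p A := pw_commute p q h.left.1 h.right.1 h.comm

theorem CommPair.posDef {A B : Matrix n n ℂ} (h : CommPair A B) (p q : ℝ) :
    (mm p q A B).PosDef :=
  posDef_mul_of_commute (pw_posDef p h.left) (pw_posDef q h.right) (h.pw_comm p q)

theorem CommPair.mul {A B : Matrix n n ℂ} (h : CommPair A B) (p q p' q' : ℝ) :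
    mm p q A B * mm p' q' A B = mm (p + p') (q + q') A B := by
  unfold mm
  rw [← pw_mul _ _ h.left, ← pw_mul _ _ h.right, Matrix.mul_assoc, Matrix.mul_assoc,
    ← Matrix.mul_assoc (pw q B), ← h.pw_comm p' q]
  simp only [Matrix.mul_assoc]

theorem CommPair.mul_comm {A B : Matrix n n ℂ} (h : CommPair A B) (p q p' q' : ℝ) :
    mm p q A B * mm p' q' A B = mm p' q' A B * mm p q A B := by
  rw [h.mul, h.mul, add_comm p, add_comm q]

theorem posDef_mix {A₁ A₂ : Matrix n n ℂ} {t₁ t₂ : ℝ} (h₁ : A₁.PosDef) (h₂ : A₂.PosDef)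
    (ht₁ : 0 ≤ t₁) (ht₂ : 0 ≤ t₂) (ht : t₁ + t₂ = 1) : (t₁ • A₁ + t₂ • A₂).PosDef := by
  rcases ht₁.eq_or_lt with h | h
  · have : t₂ = 1 := by linarith
    simpa [← h, this] using h₂
  · exact (h₁.smul h).add_posSemidef (h₂.posSemidef.smul ht₂)

/-- The concavity inequality at exponents `(p, q)` for a pair of commuting pairs. -/
def MixLE (t₁ t₂ : ℝ) (A₁ A₂ B₁ B₂ : Matrix n n ℂ) (p q : ℝ) : Prop :=
  t₁ • mm p q A₁ B₁ + t₂ • mm p q A₂ B₂ ≤ mm p q (t₁ • A₁ + t₂ • A₂) (t₁ • B₁ + t₂ • B₂)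

variable {A₁ A₂ B₁ B₂ : Matrix n n ℂ} {t₁ t₂ : ℝ}

theorem MixLE.midpoint (h₁ : CommPair A₁ B₁) (h₂ : CommPair A₂ B₂)
    (h : CommPair (t₁ • A₁ + t₂ • A₂) (t₁ • B₁ + t₂ • B₂))
    (ht₁ : 0 ≤ t₁) (ht₂ : 0 ≤ t₂) {p q p' q' : ℝ}
    (hJ : MixLE t₁ t₂ A₁ A₂ B₁ B₂ (p + p) (q + q))
    (hJ' : MixLE t₁ t₂ A₁ A₂ B₁ B₂ (p' + p') (q' + q')) :
    MixLE t₁ t₂ A₁ A₂ B₁ B₂ (p + p') (q + q') := by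
  unfold MixLE at *
  rw [← h.mul]
  refine le_mul_of_pair (h.posDef _ _) (h.posDef _ _) (h.mul_comm _ _ _ _) ?_ fun a b => ?_
  · exact (((h₁.posDef _ _).posSemidef.smul ht₁).add ((h₂.posDef _ _).posSemidef.smul ht₂)).1
  · have e₁ := two_ip_mul_le (h₁.posDef p q).1 (h₁.posDef p' q').1 a b
    have e₂ := two_ip_mul_le (h₂.posDef p q).1 (h₂.posDef p' q').1 a b
    rw [h₁.mul, h₁.mul, h₁.mul] at e₁
    rw [h₂.mul, h₂.mul, h₂.mul] at e₂
    have f₁ := qf_mono hJ a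
    have f₂ := qf_mono hJ' b
    rw [qf_add, qf_smul, qf_smul] at f₁ f₂
    rw [h.mul, h.mul, add_mulVec, smul_mulVec, smul_mulVec, ip_add_right, ip_smul_right,
      ip_smul_right]
    have g₁ := mul_le_mul_of_nonneg_left e₁ ht₁
    have g₂ := mul_le_mul_of_nonneg_left e₂ ht₂
    linarith

theorem MixLE.dyadic (h₁ : CommPair A₁ B₁) (h₂ : CommPair A₂ B₂)
    (h : CommPair (t₁ • A₁ + t₂ • A₂) (t₁ • B₁ + t₂ • B₂))
    (ht₁ : 0 ≤ t₁) (ht₂ : 0 ≤ t₂) (ht : t₁ + t₂ = 1) (k : ℕ) :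
    ∀ i j : ℕ, i + j ≤ 2 ^ k →
      MixLE t₁ t₂ A₁ A₂ B₁ B₂ ((i : ℝ) / 2 ^ k) ((j : ℝ) / 2 ^ k) := by
  induction k with
  | zero =>
    intro i j hij
    have z := fun {X : Matrix n n ℂ} (hX : X.PosDef) => pw_zero hX.1
    have o := fun {X : Matrix n n ℂ} (hX : X.PosDef) => pw_one hX.1
    have : (i = 0 ∧ j = 0) ∨ (i = 1 ∧ j = 0) ∨ (i = 0 ∧ j = 1) := by omega
    unfold MixLE mm
    rcases this with ⟨rfl, rfl⟩ | ⟨rfl, rfl⟩ | ⟨rfl, rfl⟩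
    · simp only [Nat.cast_zero, zero_div, z h₁.left, z h₂.left, z h.left, z h₁.right, z h₂.right,
        z h.right, Matrix.mul_one]
      rw [← add_smul, ht, one_smul]
    · simp only [Nat.cast_zero, Nat.cast_one, pow_zero, div_one, z h₁.right, z h₂.right,
        z h.right, Matrix.mul_one, o h₁.left, o h₂.left, o h.left, le_refl]
    · simp only [Nat.cast_zero, Nat.cast_one, pow_zero, div_one, z h₁.left, z h₂.left,
        z h.left, Matrix.one_mul, o h₁.right, o h₂.right, o h.right, le_refl]
  | succ k ih =>
    intro i j hij
    rw [pow_succ] at hij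
    have a := ih (i / 2) ((j + 1) / 2) (by omega)
    have b := ih ((i + 1) / 2) (j / 2) (by omega)
    have hi : ((i / 2 : ℕ) : ℝ) + (((i + 1) / 2 : ℕ) : ℝ) = i := by
      exact_mod_cast (by omega : i / 2 + (i + 1) / 2 = i)
    have hj : (((j + 1) / 2 : ℕ) : ℝ) + ((j / 2 : ℕ) : ℝ) = j := by
      exact_mod_cast (by omega : (j + 1) / 2 + j / 2 = j)
    have key := MixLE.midpoint h₁ h₂ h ht₁ ht₂
      (p := ((i / 2 : ℕ) : ℝ) / 2 ^ (k + 1)) (q := (((j + 1) / 2 : ℕ) : ℝ) / 2 ^ (k + 1))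
      (p' := (((i + 1) / 2 : ℕ) : ℝ) / 2 ^ (k + 1)) (q' := ((j / 2 : ℕ) : ℝ) / 2 ^ (k + 1))
      (by convert a using 1 <;> rw [pow_succ] <;> field_simp <;> ring)
      (by convert b using 1 <;> rw [pow_succ] <;> field_simp <;> ring)
    rwa [← add_div, ← add_div, hi, hj] at key

theorem tendsto_pw {ι : Type*} {l : Filter ι} {f : ι → ℝ} {p : ℝ} (hf : Tendsto f l (nhds p))
    {A : Matrix n n ℂ} (hA : A.PosDef) : Tendsto (fun x => pw (f x) A) l (nhds (pw p A)) :=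
  tendsto_hfun fun _ i => Tendsto.rpow tendsto_const_nhds hf (Or.inl (hA.eigenvalues_pos i).ne')

theorem isClosed_le_matrix : IsClosed {x : Matrix n n ℂ × Matrix n n ℂ | x.1 ≤ x.2} := by
  have : {x : Matrix n n ℂ × Matrix n n ℂ | x.1 ≤ x.2} =
      (fun x => x.2 - x.1) ⁻¹' {A : Matrix n n ℂ | A.PosSemidef} := by
    ext x
    simp [Matrix.le_iff]
  rw [this]
  exact isClosed_posSemidef.preimage (by fun_prop)

theorem le_of_tendsto_matrix {ι : Type*} {l : Filter ι} [l.NeBot] {f g : ι → Matrix n n ℂ}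
    {A B : Matrix n n ℂ} (hf : Tendsto f l (nhds A)) (hg : Tendsto g l (nhds B))
    (h : ∀ᶠ x in l, f x ≤ g x) : A ≤ B :=
  isClosed_le_matrix.mem_of_tendsto (hf.prodMk_nhds hg) h

theorem tendsto_floor_dyadic {p : ℝ} (hp : 0 ≤ p) :
    Tendsto (fun k : ℕ => ((⌊p * 2 ^ k⌋₊ : ℕ) : ℝ) / 2 ^ k) atTop (nhds p) :=
  (tendsto_nat_floor_mul_div_atTop hp).comp (tendsto_pow_atTop_atTop_of_one_lt one_lt_two)

/-- Lieb's concavity theorem for commuting pairs. -/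
theorem mixLE (h₁ : CommPair A₁ B₁) (h₂ : CommPair A₂ B₂)
    (h : CommPair (t₁ • A₁ + t₂ • A₂) (t₁ • B₁ + t₂ • B₂))
    (ht₁ : 0 ≤ t₁) (ht₂ : 0 ≤ t₂) (ht : t₁ + t₂ = 1) {p q : ℝ} (hp : 0 ≤ p) (hq : 0 ≤ q)
    (hpq : p + q ≤ 1) : MixLE t₁ t₂ A₁ A₂ B₁ B₂ p q := by
  have T := tendsto_floor_dyadic hp
  have T' := tendsto_floor_dyadic hq
  have lim : ∀ {X Y : Matrix n n ℂ}, CommPair X Y → Tendsto (fun k : ℕ =>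
      mm (((⌊p * 2 ^ k⌋₊ : ℕ) : ℝ) / 2 ^ k) (((⌊q * 2 ^ k⌋₊ : ℕ) : ℝ) / 2 ^ k) X Y) atTop
      (nhds (mm p q X Y)) := fun hX => (tendsto_pw T hX.left).mul (tendsto_pw T' hX.right)
  refine le_of_tendsto_matrix (((lim h₁).const_smul t₁).add ((lim h₂).const_smul t₂)) (lim h)
    (Eventually.of_forall fun k => ?_)
  refine MixLE.dyadic h₁ h₂ h ht₁ ht₂ ht k _ _ ?_
  have e1 : ((⌊p * 2 ^ k⌋₊ : ℕ) : ℝ) ≤ p * 2 ^ k := Nat.floor_le (by positivity)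
  have e2 : ((⌊q * 2 ^ k⌋₊ : ℕ) : ℝ) ≤ q * 2 ^ k := Nat.floor_le (by positivity)
  have e3 : (p + q) * 2 ^ k ≤ 1 * 2 ^ k := by gcongr
  have : ((⌊p * 2 ^ k⌋₊ + ⌊q * 2 ^ k⌋₊ : ℕ) : ℝ) ≤ ((2 ^ k : ℕ) : ℝ) := by
    push_cast; linarith
  exact_mod_cast this

/-- Lieb's convexity theorem for commuting pairs and negative exponents. -/
theorem mixLE_neg (h₁ : CommPair A₁ B₁) (h₂ : CommPair A₂ B₂)
    (h : CommPair (t₁ • A₁ + t₂ • A₂) (t₁ • B₁ + t₂ • B₂))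
    (ht₁ : 0 ≤ t₁) (ht₂ : 0 ≤ t₂) (ht : t₁ + t₂ = 1) {p q : ℝ} (hp : 0 ≤ p) (hq : 0 ≤ q)
    (hpq : p + q ≤ 1) :
    mm (-p) (-q) (t₁ • A₁ + t₂ • A₂) (t₁ • B₁ + t₂ • B₂) ≤
      t₁ • mm (-p) (-q) A₁ B₁ + t₂ • mm (-p) (-q) A₂ B₂ := by
  have hJ := mixLE h₁ h₂ h ht₁ ht₂ ht hp hq hpq
  unfold MixLE at hJ
  rw [Matrix.le_iff]
  refine posSemidef_of_qf ?_ fun b => ?_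
  · exact (((h₁.posDef _ _).posSemidef.smul ht₁).add ((h₂.posDef _ _).posSemidef.smul ht₂)).1.sub
      (h.posDef _ _).1
  · have key : ∀ {X Y : Matrix n n ℂ}, CommPair X Y → ∀ a : n → ℂ,
        2 * ip a b ≤ qf (mm p q X Y) a + qf (mm (-p) (-q) X Y) b := by
      intro X Y hXY a
      have := two_ip_mul_le (hXY.posDef (p / 2) (q / 2)).1 (hXY.posDef (-p / 2) (-q / 2)).1 a b
      rw [hXY.mul, hXY.mul, hXY.mul] at this
      have z1 : p / 2 + -p / 2 = 0 := by ring
      have z2 : q / 2 + -q / 2 = 0 := by ring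
      rw [z1, z2, add_halves, add_halves, add_halves, add_halves, mm, pw_zero hXY.left.1,
        pw_zero hXY.right.1, Matrix.one_mul, one_mulVec] at this
      exact this
    set M := mm p q (t₁ • A₁ + t₂ • A₂) (t₁ • B₁ + t₂ • B₂)
    set N := mm (-p) (-q) (t₁ • A₁ + t₂ • A₂) (t₁ • B₁ + t₂ • B₂)
    have hMN : M * N = 1 := by
      rw [h.mul, add_neg_cancel, add_neg_cancel, mm, pw_zero h.left.1, pw_zero h.right.1,
        Matrix.one_mul]
    have k₁ := key h₁ (N *ᵥ b)
    have k₂ := key h₂ (N *ᵥ b)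
    have f₁ := qf_mono hJ (N *ᵥ b)
    have e1 : ip (N *ᵥ b) b = qf N b := by rw [qf_eq_ip, ip_comm]
    have e2 : qf M (N *ᵥ b) = qf N b := by
      rw [qf_eq_ip, mulVec_mulVec, hMN, one_mulVec, e1]
    rw [qf_add, qf_smul, qf_smul, e2] at f₁
    rw [e1] at k₁ k₂
    rw [qf_sub, qf_add, qf_smul, qf_smul]
    have g₁ := mul_le_mul_of_nonneg_left k₁ ht₁
    have g₂ := mul_le_mul_of_nonneg_left k₂ ht₂
    have : t₂ = 1 - t₁ := by linarith
    subst this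
    linarith

end Lieb

section Monotone

variable {m n : Type*} [Fintype m] [Fintype n] [DecidableEq m] [DecidableEq n]

theorem commPair_one {A : Matrix n n ℂ} (hA : A.PosDef) : CommPair A 1 :=
  ⟨hA, PosDef.one, by simp⟩

theorem pw_matrix_one (p : ℝ) : pw p (1 : Matrix n n ℂ) = 1 := by
  have := hfun_diagonal (n := n) (fun x => x ^ p) (fun _ => 1)
  simpa [pw] using this

theorem mm_one (p q : ℝ) (A : Matrix n n ℂ) : mm p q A 1 = pw p A := by
  simp [mm, pw_matrix_one]

theorem pw_concave {A₁ A₂ : Matrix n n ℂ} {t₁ t₂ : ℝ} (h₁ : A₁.PosDef) (h₂ : A₂.PosDef)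
    (ht₁ : 0 ≤ t₁) (ht₂ : 0 ≤ t₂) (ht : t₁ + t₂ = 1) {p : ℝ} (hp : 0 ≤ p) (hp1 : p ≤ 1) :
    t₁ • pw p A₁ + t₂ • pw p A₂ ≤ pw p (t₁ • A₁ + t₂ • A₂) := by
  have e : t₁ • (1 : Matrix n n ℂ) + t₂ • (1 : Matrix n n ℂ) = 1 := by
    rw [← add_smul, ht, one_smul]
  have := mixLE (p := p) (q := 0) (commPair_one h₁) (commPair_one h₂)
    (by rw [e]; exact commPair_one (posDef_mix h₁ h₂ ht₁ ht₂ ht)) ht₁ ht₂ ht hp le_rfl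
    (by simpa using hp1)
  unfold MixLE at this
  rwa [e, mm_one, mm_one, mm_one] at this

theorem pw_convex {A₁ A₂ : Matrix n n ℂ} {t₁ t₂ : ℝ} (h₁ : A₁.PosDef) (h₂ : A₂.PosDef)
    (ht₁ : 0 ≤ t₁) (ht₂ : 0 ≤ t₂) (ht : t₁ + t₂ = 1) {p : ℝ} (hp : p ≤ 0) (hp1 : -1 ≤ p) :
    pw p (t₁ • A₁ + t₂ • A₂) ≤ t₁ • pw p A₁ + t₂ • pw p A₂ := by
  have e : t₁ • (1 : Matrix n n ℂ) + t₂ • (1 : Matrix n n ℂ) = 1 := by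
    rw [← add_smul, ht, one_smul]
  have := mixLE_neg (p := -p) (q := 0) (commPair_one h₁) (commPair_one h₂)
    (by rw [e]; exact commPair_one (posDef_mix h₁ h₂ ht₁ ht₂ ht)) ht₁ ht₂ ht
    (by linarith) le_rfl (by linarith)
  rwa [e, mm_one, mm_one, mm_one, neg_neg] at this

/-- The Löwner–Heinz inequality. -/
theorem pw_mono {A B : Matrix n n ℂ} (hA : A.PosDef) (hAB : A ≤ B) {p : ℝ} (hp : 0 ≤ p)
    (hp1 : p ≤ 1) : pw p A ≤ pw p B := by
  have key : ∀ k : ℕ, (1 - 1 / ((k : ℝ) + 1)) • pw p A ≤ pw p B := by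
    intro k
    set s : ℝ := 1 / ((k : ℝ) + 1) with hs
    have hs0 : 0 < s := by positivity
    have hs1 : s ≤ 1 := by
      rw [hs, div_le_one (by positivity)]
      have : (0 : ℝ) ≤ k := Nat.cast_nonneg k
      linarith
    have hC : (A + s⁻¹ • (B - A)).PosDef :=
      hA.add_posSemidef ((Matrix.le_iff.mp hAB).smul (inv_nonneg.mpr hs0.le))
    have h := pw_concave hA hC (t₁ := 1 - s) (t₂ := s) (by linarith) hs0.le (by ring) hp hp1
    have e : (1 - s) • A + s • (A + s⁻¹ • (B - A)) = B := by
      rw [smul_add, smul_smul, mul_inv_cancel₀ hs0.ne', one_smul, sub_smul, one_smul]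
      abel
    rw [e] at h
    refine le_trans ?_ h
    rw [Matrix.le_iff, add_sub_cancel_left]
    exact (pw_posSemidef p hC.posSemidef).smul hs0.le
  have hlim : Tendsto (fun k : ℕ => (1 - 1 / ((k : ℝ) + 1)) • pw p A) atTop
      (nhds ((1 - 0 : ℝ) • pw p A)) :=
    (tendsto_const_nhds.sub tendsto_one_div_add_atTop_nhds_zero_nat).smul_const _
  rw [sub_zero, one_smul] at hlim
  exact le_of_tendsto_matrix hlim tendsto_const_nhds (Eventually.of_forall key)

theorem two_ip_le_pw {A : Matrix n n ℂ} (hA : A.PosDef) (p : ℝ) (a b : n → ℂ) :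
    2 * ip a b ≤ qf (pw p A) a + qf (pw (-p) A) b := by
  have := two_ip_mul_le (pw_isHermitian (p / 2) A) (pw_isHermitian (-(p / 2)) A) a b
  rw [pw_mul _ _ hA, pw_mul _ _ hA, pw_mul _ _ hA, add_neg_cancel, pw_zero hA.1, one_mulVec,
    add_halves, ← neg_add, add_halves] at this
  exact this

theorem pw_anti {A B : Matrix n n ℂ} (hA : A.PosDef) (hAB : A ≤ B) {p : ℝ} (hp : p ≤ 0)
    (hp1 : -1 ≤ p) : pw p B ≤ pw p A := by
  have hB : B.PosDef := by
    have := hA.add_posSemidef (Matrix.le_iff.mp hAB)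
    rwa [add_sub_cancel] at this
  have h := pw_mono hA hAB (p := -p) (by linarith) (by linarith)
  rw [Matrix.le_iff]
  refine posSemidef_of_qf ((pw_isHermitian _ _).sub (pw_isHermitian _ _)) fun b => ?_
  have k := two_ip_le_pw hA (-p) (pw p B *ᵥ b) b
  rw [neg_neg] at k
  have f := qf_mono h (pw p B *ᵥ b)
  have e1 : ip (pw p B *ᵥ b) b = qf (pw p B) b := by rw [qf_eq_ip, ip_comm]
  have e2 : qf (pw (-p) B) (pw p B *ᵥ b) = qf (pw p B) b := by
    rw [qf_eq_ip, mulVec_mulVec, pw_neg_mul _ hB, one_mulVec, e1]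
  rw [qf_sub]
  linarith

theorem hfun_one_kronecker (f : ℝ → ℝ) {A : Matrix n n ℂ} (hA : A.IsHermitian) :
    hfun f ((1 : Matrix m m ℂ) ⊗ₖ A) = (1 ⊗ₖ (hfun f A)) := by
  set U := (hA.eigenvectorUnitary : Matrix n n ℂ) with hU
  have e : ∀ g : ℝ → ℝ, ((1 : Matrix m m ℂ) ⊗ₖ (hfun g A)) =
      ((1 : Matrix m m ℂ) ⊗ₖ U) *
        diagonal (fun x : m × n => ((g (hA.eigenvalues x.2) : ℝ) : ℂ)) *
        ((1 : Matrix m m ℂ) ⊗ₖ U)ᴴ := by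
    intro g
    have : diagonal (fun x : m × n => ((g (hA.eigenvalues x.2) : ℝ) : ℂ)) =
        ((1 : Matrix m m ℂ) ⊗ₖ (diagonal (fun i => ((g (hA.eigenvalues i) : ℝ) : ℂ)))) := by
      rw [← diagonal_one, kroneckerMap_diagonal_diagonal _ (by simp) (by simp)]
      simp
    rw [this, conjTranspose_kronecker, ← mul_kronecker_mul, ← mul_kronecker_mul,
      conjTranspose_one, Matrix.one_mul, Matrix.one_mul, hfun_eq g hA]
  have h1 : ((1 : Matrix m m ℂ) ⊗ₖ A) = ((1 : Matrix m m ℂ) ⊗ₖ U) *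
        diagonal (fun x : m × n => ((hA.eigenvalues x.2 : ℝ) : ℂ)) *
        ((1 : Matrix m m ℂ) ⊗ₖ U)ᴴ := by
    have := e (fun x => x)
    rwa [hfun_id hA] at this
  rw [e f, h1]
  refine hfun_conj_diagonal f (fun x : m × n => hA.eigenvalues x.2) ?_ ?_
  · rw [conjTranspose_kronecker, ← mul_kronecker_mul, conjTranspose_one, Matrix.one_mul,
      eigU_mul' hA, one_kronecker_one]
  · rw [conjTranspose_kronecker, ← mul_kronecker_mul, conjTranspose_one, Matrix.one_mul,
      eigU_mul hA, one_kronecker_one]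

theorem hfun_transpose_kronecker_one (f : ℝ → ℝ) {A : Matrix n n ℂ} (hA : A.IsHermitian) :
    hfun f (Aᵀ ⊗ₖ (1 : Matrix m m ℂ)) = ((hfun f A)ᵀ ⊗ₖ 1) := by
  set U := ((hA.eigenvectorUnitary : Matrix n n ℂ)ᴴ)ᵀ with hU
  have hUh : Uᴴ = (hA.eigenvectorUnitary : Matrix n n ℂ)ᵀ := by
    ext i j
    simp [hU]
  have hU1 : Uᴴ * U = 1 := by
    rw [hUh, hU, ← transpose_mul,
      eigU_mul' hA, transpose_one]
  have hU2 : U * Uᴴ = 1 := by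
    rw [hUh, hU, ← transpose_mul,
      eigU_mul hA, transpose_one]
  have e : ∀ g : ℝ → ℝ, ((hfun g A)ᵀ ⊗ₖ (1 : Matrix m m ℂ)) =
      (U ⊗ₖ (1 : Matrix m m ℂ)) *
        diagonal (fun x : n × m => ((g (hA.eigenvalues x.1) : ℝ) : ℂ)) *
        ((U ⊗ₖ (1 : Matrix m m ℂ)))ᴴ := by
    intro g
    have : diagonal (fun x : n × m => ((g (hA.eigenvalues x.1) : ℝ) : ℂ)) =
        ((diagonal (fun i => ((g (hA.eigenvalues i) : ℝ) : ℂ))) ⊗ₖ (1 : Matrix m m ℂ)) := by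
      rw [← diagonal_one, kroneckerMap_diagonal_diagonal _ (by simp) (by simp)]
      simp
    rw [this, conjTranspose_kronecker, ← mul_kronecker_mul, ← mul_kronecker_mul,
      conjTranspose_one, Matrix.one_mul, Matrix.one_mul, hfun_eq g hA]
    rw [transpose_mul, transpose_mul, diagonal_transpose, hUh, hU, Matrix.mul_assoc]
  have h1 : (Aᵀ ⊗ₖ (1 : Matrix m m ℂ)) = (U ⊗ₖ (1 : Matrix m m ℂ)) *
        diagonal (fun x : n × m => ((hA.eigenvalues x.1 : ℝ) : ℂ)) *
        ((U ⊗ₖ (1 : Matrix m m ℂ)))ᴴ := by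
    have := e (fun x => x)
    rwa [hfun_id hA] at this
  rw [e f, h1]
  refine hfun_conj_diagonal f (fun x : n × m => hA.eigenvalues x.1) ?_ ?_
  · rw [conjTranspose_kronecker, ← mul_kronecker_mul, conjTranspose_one, Matrix.one_mul,
      hU1, one_kronecker_one]
  · rw [conjTranspose_kronecker, ← mul_kronecker_mul, conjTranspose_one, Matrix.one_mul,
      hU2, one_kronecker_one]

/-- Left and right multiplication by positive definite matrices, as a commuting pair. -/
theorem commPair_kronecker {A : Matrix m m ℂ} {W : Matrix n n ℂ} (hA : A.PosDef)
    (hW : W.PosDef) :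
    CommPair ((1 : Matrix n n ℂ) ⊗ₖ A) ((Wᵀ ⊗ₖ (1 : Matrix m m ℂ))) :=
  ⟨PosDef.one.kronecker hA, hW.transpose.kronecker PosDef.one, by
    rw [← mul_kronecker_mul, ← mul_kronecker_mul]; simp⟩

theorem qf_mm_vec {A : Matrix m m ℂ} {W : Matrix n n ℂ} (hA : A.PosDef)
    (hW : W.PosDef) (p q : ℝ) (K : Matrix m n ℂ) :
    qf (mm p q ((1 : Matrix n n ℂ) ⊗ₖ A) ((Wᵀ ⊗ₖ (1 : Matrix m m ℂ)))) (vec K) =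
      rtr (Kᴴ * pw p A * K * pw q W) := by
  rw [mm, pw, pw, hfun_one_kronecker _ hA.1, hfun_transpose_kronecker_one _ hW.1,
    ← mul_kronecker_mul, Matrix.one_mul, Matrix.mul_one, qf, kronecker_mulVec_vec,
    transpose_transpose, star_vec_dotProduct_vec, rtr, pw, pw]
  simp only [Matrix.mul_assoc]

theorem kronecker_mix {A₁ A₂ : Matrix m m ℂ} (t₁ t₂ : ℝ) :
    ((1 : Matrix n n ℂ) ⊗ₖ (t₁ • A₁ + t₂ • A₂)) =
      t₁ • ((1 : Matrix n n ℂ) ⊗ₖ A₁) + t₂ • ((1 : Matrix n n ℂ) ⊗ₖ A₂) := by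
  ext i j
  simp [kroneckerMap_apply]
  ring

theorem transpose_kronecker_mix {W₁ W₂ : Matrix n n ℂ} (t₁ t₂ : ℝ) :
    ((t₁ • W₁ + t₂ • W₂)ᵀ ⊗ₖ (1 : Matrix m m ℂ)) =
      t₁ • (W₁ᵀ ⊗ₖ (1 : Matrix m m ℂ)) + t₂ • (W₂ᵀ ⊗ₖ (1 : Matrix m m ℂ)) := by
  ext i j
  simp [kroneckerMap_apply]
  ring

/-- Lieb's concavity theorem. -/
theorem lieb_concave {A₁ A₂ : Matrix m m ℂ} {W₁ W₂ : Matrix n n ℂ} {t₁ t₂ : ℝ}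
    (hA₁ : A₁.PosDef) (hA₂ : A₂.PosDef) (hW₁ : W₁.PosDef) (hW₂ : W₂.PosDef)
    (ht₁ : 0 ≤ t₁) (ht₂ : 0 ≤ t₂) (ht : t₁ + t₂ = 1) {p q : ℝ} (hp : 0 ≤ p) (hq : 0 ≤ q)
    (hpq : p + q ≤ 1) (K : Matrix m n ℂ) :
    t₁ * rtr (Kᴴ * pw p A₁ * K * pw q W₁) + t₂ * rtr (Kᴴ * pw p A₂ * K * pw q W₂) ≤
      rtr (Kᴴ * pw p (t₁ • A₁ + t₂ • A₂) * K * pw q (t₁ • W₁ + t₂ • W₂)) := by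
  have hA := posDef_mix hA₁ hA₂ ht₁ ht₂ ht
  have hW := posDef_mix hW₁ hW₂ ht₁ ht₂ ht
  have h := commPair_kronecker hA hW
  rw [kronecker_mix, transpose_kronecker_mix] at h
  have := mixLE (commPair_kronecker hA₁ hW₁) (commPair_kronecker hA₂ hW₂) h ht₁ ht₂ ht hp hq hpq
  unfold MixLE at this
  rw [← kronecker_mix, ← transpose_kronecker_mix] at this
  have := qf_mono this (vec K)
  rwa [qf_add, qf_smul, qf_smul, qf_mm_vec hA₁ hW₁, qf_mm_vec hA₂ hW₂, qf_mm_vec hA hW] at this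

/-- Lieb's convexity theorem. -/
theorem lieb_convex {A₁ A₂ : Matrix m m ℂ} {W₁ W₂ : Matrix n n ℂ} {t₁ t₂ : ℝ}
    (hA₁ : A₁.PosDef) (hA₂ : A₂.PosDef) (hW₁ : W₁.PosDef) (hW₂ : W₂.PosDef)
    (ht₁ : 0 ≤ t₁) (ht₂ : 0 ≤ t₂) (ht : t₁ + t₂ = 1) {p q : ℝ} (hp : p ≤ 0) (hq : q ≤ 0)
    (hpq : -1 ≤ p + q) (K : Matrix m n ℂ) :
    rtr (Kᴴ * pw p (t₁ • A₁ + t₂ • A₂) * K * pw q (t₁ • W₁ + t₂ • W₂)) ≤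
    t₁ * rtr (Kᴴ * pw p A₁ * K * pw q W₁) + t₂ * rtr (Kᴴ * pw p A₂ * K * pw q W₂) := by
  have hA := posDef_mix hA₁ hA₂ ht₁ ht₂ ht
  have hW := posDef_mix hW₁ hW₂ ht₁ ht₂ ht
  have h := commPair_kronecker hA hW
  rw [kronecker_mix, transpose_kronecker_mix] at h
  have := mixLE_neg (commPair_kronecker hA₁ hW₁) (commPair_kronecker hA₂ hW₂) h ht₁ ht₂ ht
    (p := -p) (q := -q) (by linarith) (by linarith) (by linarith)
  rw [← kronecker_mix, ← transpose_kronecker_mix, neg_neg, neg_neg] at this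
  have := qf_mono this (vec K)
  rwa [qf_add, qf_smul, qf_smul, qf_mm_vec hA₁ hW₁, qf_mm_vec hA₂ hW₂, qf_mm_vec hA hW] at this

end Monotone

section Continuity

variable {m n : Type*} [Fintype m] [Fintype n] [DecidableEq m] [DecidableEq n]

theorem hfun_eq_cfc (f : ℝ → ℝ) {A : Matrix n n ℂ} (hA : A.IsHermitian) : hfun f A = cfc f A := by
  rw [hA.cfc_eq, hfun_eq f hA, IsHermitian.cfc, Unitary.conjStarAlgAut_apply]
  rfl

open scoped Matrix.Norms.L2Operator in
/-- The functional calculus by a continuous function is continuous in the matrix. -/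
theorem tendsto_hfun_of_continuous {ι : Type*} {l : Filter ι} {f : ℝ → ℝ} (hf : Continuous f)
    {A : ι → Matrix n n ℂ} {B : Matrix n n ℂ} (hA : ∀ᶠ x in l, (A x).IsHermitian)
    (hB : B.IsHermitian) (h : Tendsto A l (nhds B)) :
    Tendsto (fun x => hfun f (A x)) l (nhds (hfun f B)) := by
  rw [hfun_eq_cfc f hB]
  have h1 : ∀ᶠ x in l, cfc f (A x) = hfun f (A x) := by
    filter_upwards [hA] with x hx
    rw [hfun_eq_cfc f hx]
  refine Tendsto.congr' h1 ?_
  have hn : ∀ᶠ x in l, ‖A x‖ * ‖(1 : Matrix n n ℂ)‖ ≤ (‖B‖ + 1) * ‖(1 : Matrix n n ℂ)‖ := by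
    have h2 : Tendsto (fun x => ‖A x‖) l (nhds ‖B‖) := h.norm
    have : ∀ᶠ x in l, ‖A x‖ < ‖B‖ + 1 := h2.eventually_lt_const (by linarith)
    filter_upwards [this] with x hx
    gcongr
  refine Filter.Tendsto.cfc (isCompact_closedBall (0 : ℝ) ((‖B‖ + 1) * ‖(1 : Matrix n n ℂ)‖)) f h
    ?_ hA ?_ hB hf.continuousOn
  · filter_upwards [hn] with x hx
    refine (spectrum.subset_closedBall_norm_mul (A x)).trans
      (Metric.closedBall_subset_closedBall hx)
  · refine (spectrum.subset_closedBall_norm_mul B).trans (Metric.closedBall_subset_closedBall ?_)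
    gcongr
    linarith

theorem tendsto_pw_of_tendsto {ι : Type*} {l : Filter ι} {z : ℝ} (hz : 0 < z)
    {A : ι → Matrix n n ℂ} {B : Matrix n n ℂ} (hA : ∀ᶠ x in l, (A x).PosSemidef)
    (hB : B.PosSemidef) (h : Tendsto A l (nhds B)) :
    Tendsto (fun x => pw z (A x)) l (nhds (pw z B)) := by
  have e : ∀ {X : Matrix n n ℂ}, X.PosSemidef → hfun (fun x => |x| ^ z) X = pw z X := fun hX =>
    hfun_congr fun _ i => by rw [abs_of_nonneg (hX.eigenvalues_nonneg i)]
  rw [← e hB]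
  refine Tendsto.congr' ?_ (tendsto_hfun_of_continuous (f := fun x => |x| ^ z)
    (continuous_abs.rpow_const fun _ => Or.inr hz.le) (hA.mono fun _ hx => hx.1) hB.1 h)
  filter_upwards [hA] with x hx
  rw [e hx]

theorem continuous_rtr : Continuous (rtr : Matrix n n ℂ → ℝ) := by
  unfold rtr
  fun_prop

theorem tendsto_rtr_pw {ι : Type*} {l : Filter ι} {z : ℝ} (hz : 0 < z)
    {A : ι → Matrix n n ℂ} {B : Matrix n n ℂ} (hA : ∀ᶠ x in l, (A x).PosSemidef)
    (hB : B.PosSemidef) (h : Tendsto A l (nhds B)) :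
    Tendsto (fun x => rtr (pw z (A x))) l (nhds (rtr (pw z B))) :=
  (continuous_rtr.tendsto _).comp (tendsto_pw_of_tendsto hz hA hB h)

end Continuity

section TraceFunctions

variable {m n : Type*} [Fintype m] [Fintype n] [DecidableEq m] [DecidableEq n]

theorem rpow_tangent_le {z : ℝ} (hz : 1 ≤ z) {x y : ℝ} (hx : 0 ≤ x) (hy : 0 ≤ y) :
    y ^ z + (x - y) * (z * y ^ (z - 1)) ≤ x ^ z := by
  rcases hy.eq_or_lt with rfl | hy
  · rcases hz.eq_or_lt with rfl | hz
    · simp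
    · rw [Real.zero_rpow (by linarith), Real.zero_rpow (by linarith)]
      simpa using Real.rpow_nonneg hx z
  · have h := one_add_mul_self_le_rpow_one_add (s := x / y - 1)
      (by have := div_nonneg hx hy.le; linarith) hz
    have e : (1 + (x / y - 1)) ^ z = x ^ z / y ^ z := by
      rw [← Real.div_rpow hx hy.le]; ring_nf
    have hyz := Real.rpow_pos_of_pos hy z
    rw [e, le_div_iff₀ hyz] at h
    rw [Real.rpow_sub_one hy.ne']
    refine le_of_eq_of_le ?_ h
    field_simp

theorem le_rpow_tangent {z : ℝ} (hz : 0 ≤ z) (hz1 : z ≤ 1) {x y : ℝ} (hx : 0 ≤ x) (hy : 0 < y) :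
    x ^ z ≤ y ^ z + (x - y) * (z * y ^ (z - 1)) := by
  have h := rpow_one_add_le_one_add_mul_self (s := x / y - 1)
    (by have := div_nonneg hx hy.le; linarith) hz hz1
  have e : (1 + (x / y - 1)) ^ z = x ^ z / y ^ z := by
    rw [← Real.div_rpow hx hy.le]; ring_nf
  have hyz := Real.rpow_pos_of_pos hy z
  rw [e, div_le_iff₀ hyz] at h
  rw [Real.rpow_sub_one hy.ne']
  refine h.trans_eq ?_
  field_simp

theorem rtr_mul_nonneg {A B : Matrix n n ℂ} (hA : A.PosSemidef) (hB : B.PosSemidef) :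
    0 ≤ rtr (A * B) := by
  obtain ⟨P, hP, hPf⟩ := exists_weights hA.1 hB.1
  have := hPf (fun x => x) (fun x => x)
  rw [hfun_id hA.1, hfun_id hB.1] at this
  rw [this]
  exact Finset.sum_nonneg fun i _ => Finset.sum_nonneg fun j _ => mul_nonneg (hP i j)
    (mul_nonneg (hA.eigenvalues_nonneg i) (hB.eigenvalues_nonneg j))

theorem rtr_mul_mono {A B C : Matrix n n ℂ} (hAB : A ≤ B) (hC : C.PosSemidef) :
    rtr (A * C) ≤ rtr (B * C) := by
  have := rtr_mul_nonneg (Matrix.le_iff.mp hAB) hC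
  rw [Matrix.sub_mul, rtr_sub] at this
  linarith

theorem smul_pw_eq (c z : ℝ) (A : Matrix n n ℂ) : hfun (fun x => c * x ^ z) A = c • pw z A := by
  rw [pw, hfun_smul]

theorem klein_pw {z : ℝ} (hz : 1 ≤ z) {A B : Matrix n n ℂ} (hA : A.PosSemidef)
    (hB : B.PosSemidef) :
    rtr (pw z B) + z * rtr ((A - B) * pw (z - 1) B) ≤ rtr (pw z A) := by
  have := klein (f := fun x => x ^ z) (g := fun x => z * x ^ (z - 1)) hA.1 hB.1 fun i j =>
    rpow_tangent_le hz (hA.eigenvalues_nonneg i) (hB.eigenvalues_nonneg j)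
  rwa [smul_pw_eq, Matrix.mul_smul, rtr_smul] at this

theorem klein_pw_concave {z : ℝ} (hz : 0 ≤ z) (hz1 : z ≤ 1) {A B : Matrix n n ℂ}
    (hA : A.PosSemidef) (hB : B.PosDef) :
    rtr (pw z A) ≤ rtr (pw z B) + z * rtr ((A - B) * pw (z - 1) B) := by
  have := klein_concave (f := fun x => x ^ z) (g := fun x => z * x ^ (z - 1)) hA.1 hB.1
    fun i j => le_rpow_tangent hz hz1 (hA.eigenvalues_nonneg i) (hB.eigenvalues_pos j)
  rwa [smul_pw_eq, Matrix.mul_smul, rtr_smul] at this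

/-- The shift of a matrix by a multiple of the identity. -/
def shift (η : ℝ) (A : Matrix n n ℂ) : Matrix n n ℂ := A + η • (1 : Matrix n n ℂ)

theorem shift_posDef {η : ℝ} (hη : 0 < η) {A : Matrix n n ℂ} (hA : A.PosSemidef) :
    (shift η A).PosDef := by
  rw [shift, add_comm]
  exact (PosDef.one.smul hη).add_posSemidef hA

theorem le_shift {η : ℝ} (hη : 0 ≤ η) (A : Matrix n n ℂ) : A ≤ shift η A := by
  rw [Matrix.le_iff, shift, add_sub_cancel_left]
  exact PosSemidef.one.smul hη

theorem tendsto_shift (A : Matrix n n ℂ) :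
    Tendsto (fun η : ℝ => shift η A) (nhdsWithin 0 (Ioi 0)) (nhds A) := by
  have : Tendsto (fun η : ℝ => shift η A) (nhds 0) (nhds (shift 0 A)) := by
    unfold shift
    exact Continuous.tendsto (by fun_prop) 0
  rw [shift, zero_smul, add_zero] at this
  exact this.mono_left nhdsWithin_le_nhds

theorem tendsto_rtr_pw_shift {z : ℝ} (hz : 0 < z) {A : Matrix n n ℂ} (hA : A.PosSemidef) :
    Tendsto (fun η : ℝ => rtr (pw z (shift η A))) (nhdsWithin 0 (Ioi 0))
      (nhds (rtr (pw z A))) := by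
  refine tendsto_rtr_pw hz ?_ hA (tendsto_shift A)
  filter_upwards [self_mem_nhdsWithin] with η hη
  exact (shift_posDef hη hA).posSemidef

theorem rtr_pw_mono {z : ℝ} (hz : 0 < z) {A B : Matrix n n ℂ} (hA : A.PosSemidef)
    (hAB : A ≤ B) : rtr (pw z A) ≤ rtr (pw z B) := by
  have hB : B.PosSemidef := by
    have := hA.add (Matrix.le_iff.mp hAB)
    rwa [add_sub_cancel] at this
  rcases le_total 1 z with h | h
  · have k := klein_pw h hB hA
    have := rtr_mul_nonneg (Matrix.le_iff.mp hAB) (pw_posSemidef (z - 1) hA)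
    nlinarith
  · refine ge_of_tendsto (tendsto_rtr_pw_shift hz hB) ?_
    filter_upwards [self_mem_nhdsWithin] with η hη
    have hBη := shift_posDef hη hB
    have k := klein_pw_concave hz.le h hA hBη
    have := rtr_mul_mono (hAB.trans (le_shift (le_of_lt hη) B))
      (pw_posSemidef (z - 1) hBη.posSemidef)
    rw [Matrix.sub_mul, rtr_sub] at k
    nlinarith

theorem rtr_pw_convex {z : ℝ} (hz : 1 ≤ z) {A₁ A₂ : Matrix n n ℂ} {t₁ t₂ : ℝ}
    (h₁ : A₁.PosSemidef) (h₂ : A₂.PosSemidef) (ht₁ : 0 ≤ t₁) (ht₂ : 0 ≤ t₂) (ht : t₁ + t₂ = 1) :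
    rtr (pw z (t₁ • A₁ + t₂ • A₂)) ≤ t₁ * rtr (pw z A₁) + t₂ * rtr (pw z A₂) := by
  have hB := (h₁.smul ht₁).add (h₂.smul ht₂)
  have k₁ := mul_le_mul_of_nonneg_left (klein_pw hz h₁ hB) ht₁
  have k₂ := mul_le_mul_of_nonneg_left (klein_pw hz h₂ hB) ht₂
  simp only [Matrix.sub_mul, Matrix.add_mul, rtr_sub, rtr_add, Matrix.smul_mul, rtr_smul] at k₁ k₂
  have : t₂ = 1 - t₁ := by linarith
  subst this
  linarith

theorem rtr_pw_concave {z : ℝ} (hz : 0 < z) (hz1 : z ≤ 1) {A₁ A₂ : Matrix n n ℂ} {t₁ t₂ : ℝ}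
    (h₁ : A₁.PosSemidef) (h₂ : A₂.PosSemidef) (ht₁ : 0 ≤ t₁) (ht₂ : 0 ≤ t₂) (ht : t₁ + t₂ = 1) :
    t₁ * rtr (pw z A₁) + t₂ * rtr (pw z A₂) ≤ rtr (pw z (t₁ • A₁ + t₂ • A₂)) := by
  have hB := (h₁.smul ht₁).add (h₂.smul ht₂)
  refine ge_of_tendsto (tendsto_rtr_pw_shift hz hB) ?_
  filter_upwards [self_mem_nhdsWithin] with η hη
  have hBη := shift_posDef hη hB
  have k₁ := mul_le_mul_of_nonneg_left (klein_pw_concave hz.le hz1 h₁ hBη) ht₁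
  have k₂ := mul_le_mul_of_nonneg_left (klein_pw_concave hz.le hz1 h₂ hBη) ht₂
  have hm := rtr_mul_mono (le_shift (le_of_lt hη) (t₁ • A₁ + t₂ • A₂))
    (pw_posSemidef (z - 1) hBη.posSemidef)
  set P := pw (z - 1) (shift η (t₁ • A₁ + t₂ • A₂))
  simp only [Matrix.sub_mul, Matrix.add_mul, rtr_sub, rtr_add, Matrix.smul_mul, rtr_smul]
    at k₁ k₂ hm
  have : t₂ = 1 - t₁ := by linarith
  subst this
  nlinarith

/-- The trace functional underlying the `α`-`z` relative entropies. -/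
def traceFun (p z : ℝ) (K A : Matrix n n ℂ) : ℝ := rtr (pw z (K * pw p A * K))

theorem conj_posSemidef {K A : Matrix n n ℂ} (hK : K.IsHermitian) (hA : A.PosSemidef) :
    (K * A * K).PosSemidef := by
  have := hA.mul_mul_conjTranspose_same K
  rwa [hK.eq] at this

theorem conj_mono {K A B : Matrix n n ℂ} (hK : K.IsHermitian) (hAB : A ≤ B) :
    K * A * K ≤ K * B * K := by
  rw [Matrix.le_iff] at *
  have := conj_posSemidef hK hAB
  rwa [Matrix.mul_sub, Matrix.sub_mul] at this

theorem conj_mix (K A B : Matrix n n ℂ) (t₁ t₂ : ℝ) :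
    K * (t₁ • A + t₂ • B) * K = t₁ • (K * A * K) + t₂ • (K * B * K) := by
  simp [Matrix.mul_add, Matrix.add_mul]

/-- The exponents for which the trace functional is concave (`0 < p`) or convex (`p < 0`). -/
def Admissible (p z : ℝ) : Prop :=
  0 < z ∧ ((0 < p ∧ p ≤ 1 ∧ p * z ≤ 1) ∨ (p < 0 ∧ -1 ≤ p ∧ 1 - 2 * z ≤ p * z))

variable {p z : ℝ} {K A₁ A₂ : Matrix n n ℂ} {t₁ t₂ : ℝ}

theorem Admissible.traceFun_mono (h : Admissible p z) (hK : K.IsHermitian) (hA : A₁.PosDef)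
    (hAB : A₁ ≤ A₂) : p * traceFun p z K A₁ ≤ p * traceFun p z K A₂ := by
  have hB : A₂.PosDef := by
    have := hA.add_posSemidef (Matrix.le_iff.mp hAB)
    rwa [add_sub_cancel] at this
  obtain ⟨hz, ⟨hp, hp1, -⟩ | ⟨hp, hp1, -⟩⟩ := h
  · exact mul_le_mul_of_nonneg_left (rtr_pw_mono hz (conj_posSemidef hK
      (pw_posSemidef p hA.posSemidef)) (conj_mono hK (pw_mono hA hAB hp.le hp1))) hp.le
  · exact mul_le_mul_of_nonpos_left (rtr_pw_mono hz (conj_posSemidef hK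
      (pw_posSemidef p hB.posSemidef)) (conj_mono hK (pw_anti hA hAB hp.le hp1))) hp.le

theorem shift_power_value {η : ℝ} (hη : 0 < η) (hz : 0 < z) {Y : Matrix n n ℂ}
    (hY : Y.PosSemidef) :
    (1 - z) * rtr (pw z (shift η Y)) + z * rtr (Y * pw (1 - 1 / z) (pw z (shift η Y))) =
      rtr (pw z (shift η Y)) - z * (η * rtr (pw (z - 1) (shift η Y))) := by
  have hS := shift_posDef hη hY
  have e1 : pw (1 - 1 / z) (pw z (shift η Y)) = pw (z - 1) (shift η Y) := by
    rw [pw_pw _ _ hS.posSemidef]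
    congr 1
    field_simp
  have e2 : Y = shift η Y - η • (1 : Matrix n n ℂ) := by simp [shift]
  have e3 : shift η Y * pw (z - 1) (shift η Y) = pw z (shift η Y) := by
    have := pw_mul 1 (z - 1) hS
    rw [pw_one hS.1, add_sub_cancel] at this
    exact this
  rw [e1]
  have : rtr (Y * pw (z - 1) (shift η Y)) =
      rtr (pw z (shift η Y)) - η * rtr (pw (z - 1) (shift η Y)) := by
    conv_lhs => rw [e2]
    have e4 : shift η (shift η Y - η • (1 : Matrix n n ℂ)) = shift η Y := by rw [← e2]
    rw [e4, Matrix.sub_mul, rtr_sub, e3, Matrix.smul_mul, rtr_smul, Matrix.one_mul]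
  rw [this]
  ring

end TraceFunctions

section TraceConcavity

variable {n : Type*} [Fintype n] [DecidableEq n]
variable {p z : ℝ} {K A₁ A₂ : Matrix n n ℂ} {t₁ t₂ : ℝ}

theorem pw_root {W : Matrix n n ℂ} (hz : 0 < z) (hW : W.PosDef) :
    pw z (pw (1 / z) W) = W ∧ pw (z - 1) (pw (1 / z) W) = pw (1 - 1 / z) W ∧
      pw (1 / z) W * pw (1 - 1 / z) W = W := by
  refine ⟨?_, ?_, ?_⟩
  · rw [pw_pw _ _ hW.posSemidef, one_div_mul_cancel hz.ne', pw_one hW.1]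
  · rw [pw_pw _ _ hW.posSemidef]
    congr 1
    field_simp
  · rw [pw_mul _ _ hW, add_sub_cancel, pw_one hW.1]

theorem variational_le (hz : 1 ≤ z) {Y W : Matrix n n ℂ} (hY : Y.PosSemidef) (hW : W.PosDef) :
    (1 - z) * rtr W + z * rtr (Y * pw (1 - 1 / z) W) ≤ rtr (pw z Y) := by
  obtain ⟨e1, e2, e3⟩ := pw_root (z := z) (by linarith) hW
  have k := klein_pw hz hY (pw_posSemidef (1 / z) hW.posSemidef)
  rw [e1, e2, Matrix.sub_mul, e3, rtr_sub] at k
  linarith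

theorem le_variational (hz : 0 < z) (hz1 : z ≤ 1) {Y W : Matrix n n ℂ} (hY : Y.PosSemidef)
    (hW : W.PosDef) :
    rtr (pw z Y) ≤ (1 - z) * rtr W + z * rtr (Y * pw (1 - 1 / z) W) := by
  obtain ⟨e1, e2, e3⟩ := pw_root hz hW
  have k := klein_pw_concave hz.le hz1 hY (pw_posDef (1 / z) hW)
  rw [e1, e2, Matrix.sub_mul, e3, rtr_sub] at k
  linarith

theorem traceFun_concave_of_one_lt (hz : 1 < z) (hp : 0 < p) (hpz : p * z ≤ 1)
    (hK : K.IsHermitian) (h₁ : A₁.PosDef) (h₂ : A₂.PosDef)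
    (ht₁ : 0 ≤ t₁) (ht₂ : 0 ≤ t₂) (ht : t₁ + t₂ = 1) :
    t₁ * traceFun p z K A₁ + t₂ * traceFun p z K A₂ ≤ traceFun p z K (t₁ • A₁ + t₂ • A₂) := by
  have hz0 : 0 < z := by linarith
  have hA := posDef_mix h₁ h₂ ht₁ ht₂ ht
  have hY : ∀ {A : Matrix n n ℂ}, A.PosDef → (K * pw p A * K).PosSemidef := fun hA =>
    conj_posSemidef hK (pw_posSemidef p hA.posSemidef)
  have lim : ∀ {A : Matrix n n ℂ}, A.PosDef → Tendsto (fun η : ℝ =>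
      rtr (pw z (shift η (K * pw p A * K))) - z * (η * rtr (pw (z - 1) (shift η (K * pw p A * K)))))
      (nhdsWithin 0 (Ioi 0)) (nhds (traceFun p z K A - z * (0 * rtr (pw (z - 1) (K * pw p A * K)))))
    := fun hA => (tendsto_rtr_pw_shift hz0 (hY hA)).sub
      ((((tendsto_id.mono_left nhdsWithin_le_nhds).mul
        (tendsto_rtr_pw_shift (by linarith) (hY hA))).const_mul z))
  have L := ((lim h₁).const_mul t₁).add ((lim h₂).const_mul t₂)
  simp only [zero_mul, mul_zero, sub_zero] at L
  refine le_of_tendsto L ?_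
  filter_upwards [self_mem_nhdsWithin] with η hη
  have hW₁ := pw_posDef z (shift_posDef hη (hY h₁))
  have hW₂ := pw_posDef z (shift_posDef hη (hY h₂))
  have v := variational_le hz.le (hY hA) (posDef_mix hW₁ hW₂ ht₁ ht₂ ht)
  have hq : p + (1 - 1 / z) ≤ 1 := by
    have : p ≤ 1 / z := by rwa [le_div_iff₀ hz0]
    linarith
  have hq0 : 0 ≤ 1 - 1 / z := by
    have : 1 / z ≤ 1 := by rw [div_le_one hz0]; exact hz.le
    linarith
  have l := lieb_concave h₁ h₂ hW₁ hW₂ ht₁ ht₂ ht hp.le hq0 hq K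
  rw [hK.eq] at l
  rw [← shift_power_value hη hz0 (hY h₁), ← shift_power_value hη hz0 (hY h₂)]
  rw [rtr_add, rtr_smul, rtr_smul] at v
  refine le_trans ?_ v
  have := mul_le_mul_of_nonneg_left l hz0.le
  linarith

theorem traceFun_convex_of_lt_one (hz0 : 0 < z) (hz : z ≤ 1) (hp : p < 0)
    (hpz : 1 - 2 * z ≤ p * z)
    (hK : K.IsHermitian) (h₁ : A₁.PosDef) (h₂ : A₂.PosDef)
    (ht₁ : 0 ≤ t₁) (ht₂ : 0 ≤ t₂) (ht : t₁ + t₂ = 1) :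
    traceFun p z K (t₁ • A₁ + t₂ • A₂) ≤ t₁ * traceFun p z K A₁ + t₂ * traceFun p z K A₂ := by
  have hA := posDef_mix h₁ h₂ ht₁ ht₂ ht
  have hY : ∀ {A : Matrix n n ℂ}, A.PosDef → (K * pw p A * K).PosSemidef := fun hA =>
    conj_posSemidef hK (pw_posSemidef p hA.posSemidef)
  have lim : ∀ {A : Matrix n n ℂ}, A.PosDef → Tendsto (fun η : ℝ =>
      rtr (pw z (shift η (K * pw p A * K)))) (nhdsWithin 0 (Ioi 0)) (nhds (traceFun p z K A)) :=
    fun hA => tendsto_rtr_pw_shift hz0 (hY hA)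
  have L := ((lim h₁).const_mul t₁).add ((lim h₂).const_mul t₂)
  refine ge_of_tendsto L ?_
  filter_upwards [self_mem_nhdsWithin] with η hη
  have hW₁ := pw_posDef z (shift_posDef hη (hY h₁))
  have hW₂ := pw_posDef z (shift_posDef hη (hY h₂))
  have v := le_variational hz0 hz (hY hA) (posDef_mix hW₁ hW₂ ht₁ ht₂ ht)
  have hq : -1 ≤ p + (1 - 1 / z) := by
    have : 1 / z ≤ p + 2 := by rw [div_le_iff₀ hz0]; linarith
    linarith
  have hq0 : 1 - 1 / z ≤ 0 := by
    have : 1 ≤ 1 / z := by rwa [le_div_iff₀ hz0, one_mul]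
    linarith
  have l := lieb_convex h₁ h₂ hW₁ hW₂ ht₁ ht₂ ht hp.le hq0 hq K
  rw [hK.eq] at l
  have s₁ := shift_power_value hη hz0 (hY h₁)
  have s₂ := shift_power_value hη hz0 (hY h₂)
  rw [rtr_add, rtr_smul, rtr_smul] at v
  refine v.trans ?_
  have n : ∀ {A : Matrix n n ℂ}, A.PosDef →
      0 ≤ z * (η * rtr (pw (z - 1) (shift η (K * pw p A * K)))) := fun hA =>
    mul_nonneg hz0.le (mul_nonneg (le_of_lt hη)
      (rtr_nonneg (pw_posSemidef _ (shift_posDef hη (hY hA)).posSemidef)))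
  have n₁ := mul_nonneg ht₁ (n h₁)
  have n₂ := mul_nonneg ht₂ (n h₂)
  have := mul_le_mul_of_nonneg_left l hz0.le
  have s₁' := congrArg (fun x => t₁ * x) s₁
  have s₂' := congrArg (fun x => t₂ * x) s₂
  linarith

theorem Admissible.traceFun_concave (h : Admissible p z) (hK : K.IsHermitian) (h₁ : A₁.PosDef)
    (h₂ : A₂.PosDef) (ht₁ : 0 ≤ t₁) (ht₂ : 0 ≤ t₂) (ht : t₁ + t₂ = 1) :
    t₁ * (p * traceFun p z K A₁) + t₂ * (p * traceFun p z K A₂) ≤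
      p * traceFun p z K (t₁ • A₁ + t₂ • A₂) := by
  have hA := posDef_mix h₁ h₂ ht₁ ht₂ ht
  have hY : ∀ {A : Matrix n n ℂ}, A.PosDef → (K * pw p A * K).PosSemidef := fun hA =>
    conj_posSemidef hK (pw_posSemidef p hA.posSemidef)
  have e : ∀ a b : ℝ, t₁ * (p * a) + t₂ * (p * b) = p * (t₁ * a + t₂ * b) := fun a b => by ring
  rw [e]
  obtain ⟨hz, ⟨hp, hp1, hpz⟩ | ⟨hp, hp1, hpz⟩⟩ := h
  · refine mul_le_mul_of_nonneg_left ?_ hp.le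
    rcases lt_or_ge 1 z with hz1 | hz1
    · exact traceFun_concave_of_one_lt hz1 hp hpz hK h₁ h₂ ht₁ ht₂ ht
    · refine (rtr_pw_concave hz hz1 (hY h₁) (hY h₂) ht₁ ht₂ ht).trans ?_
      rw [← conj_mix]
      refine rtr_pw_mono hz ?_ (conj_mono hK (pw_concave h₁ h₂ ht₁ ht₂ ht hp.le hp1))
      exact conj_posSemidef hK (((pw_posSemidef p h₁.posSemidef).smul ht₁).add
        ((pw_posSemidef p h₂.posSemidef).smul ht₂))
  · refine mul_le_mul_of_nonpos_left ?_ hp.le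
    rcases le_total z 1 with hz1 | hz1
    · exact traceFun_convex_of_lt_one hz hz1 hp hpz hK h₁ h₂ ht₁ ht₂ ht
    · refine le_trans ?_ (rtr_pw_convex hz1 (hY h₁) (hY h₂) ht₁ ht₂ ht)
      rw [← conj_mix]
      exact rtr_pw_mono hz (hY hA) (conj_mono hK (pw_convex h₁ h₂ ht₁ ht₂ ht hp.le hp1))

end TraceConcavity

section Decomposition

variable {I m n : Type*} [Fintype I] [DecidableEq I] [Fintype m] [Fintype n] [DecidableEq m]
  [DecidableEq n]

/-- A family of isometries whose ranges form an orthogonal decomposition of the space. -/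
structure IsDecomp (V : I → Matrix m n ℂ) : Prop where
  orth : ∀ i j, (V i)ᴴ * V j = if i = j then 1 else 0
  complete : ∑ i, V i * (V i)ᴴ = 1

variable {V : I → Matrix m n ℂ} {p z : ℝ} {K A : Matrix m m ℂ}

theorem IsDecomp.orth_self (h : IsDecomp V) (i : I) : (V i)ᴴ * V i = 1 := by
  simpa using h.orth i i

theorem IsDecomp.ext (h : IsDecomp V) {M N : Matrix m m ℂ} (hMN : ∀ i, M * V i = N * V i) :
    M = N := by
  rw [← Matrix.mul_one M, ← Matrix.mul_one N, ← h.complete, Matrix.mul_sum, Matrix.mul_sum]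
  exact Finset.sum_congr rfl fun i _ => by rw [← Matrix.mul_assoc, hMN, Matrix.mul_assoc]

theorem IsDecomp.rtr_eq (h : IsDecomp V) (M : Matrix m m ℂ) :
    rtr M = ∑ i, rtr ((V i)ᴴ * M * V i) := by
  conv_lhs => rw [← Matrix.mul_one M, ← h.complete, Matrix.mul_sum, rtr_sum]
  refine Finset.sum_congr rfl fun i _ => ?_
  rw [← Matrix.mul_assoc, rtr_mul_comm, Matrix.mul_assoc]

theorem IsDecomp.rtr_eq_of_intertwine (h : IsDecomp V) {M : Matrix m m ℂ} {N : I → Matrix n n ℂ}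
    (hMN : ∀ i, M * V i = V i * N i) : rtr M = ∑ i, rtr (N i) := by
  rw [h.rtr_eq]
  refine Finset.sum_congr rfl fun i _ => ?_
  rw [Matrix.mul_assoc, hMN, ← Matrix.mul_assoc, h.orth_self, Matrix.one_mul]

theorem conj_isHermitian {K A : Matrix n n ℂ} (hK : K.IsHermitian) (hA : A.IsHermitian) :
    (K * A * K).IsHermitian := by
  have := isHermitian_mul_mul_conjTranspose K hA
  rwa [hK.eq] at this

theorem conj_pw_isHermitian {K : Matrix n n ℂ} (hK : K.IsHermitian) (p : ℝ) (A : Matrix n n ℂ) :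
    (K * pw p A * K).IsHermitian := conj_isHermitian hK (pw_isHermitian p A)

theorem IsDecomp.traceFun_eq (h : IsDecomp V) {K' A' : I → Matrix n n ℂ} (hK : K.IsHermitian)
    (hA : A.IsHermitian) (hK' : ∀ i, (K' i).IsHermitian) (hA' : ∀ i, (A' i).IsHermitian)
    (hKV : ∀ i, K * V i = V i * K' i) (hAV : ∀ i, A * V i = V i * A' i) :
    traceFun p z K A = ∑ i, traceFun p z (K' i) (A' i) := by
  refine h.rtr_eq_of_intertwine fun i => ?_
  refine hfun_intertwine _ (conj_pw_isHermitian hK p A) (conj_pw_isHermitian (hK' i) p (A' i)) ?_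
  have := hfun_intertwine (fun x => x ^ p) hA (hA' i) (hAV i)
  change pw p A * V i = V i * pw p (A' i) at this
  rw [Matrix.mul_assoc, hKV, Matrix.mul_assoc, ← Matrix.mul_assoc (pw p A), this]
  simp only [← Matrix.mul_assoc]
  rw [hKV]

theorem pw_smul {s : ℝ} (hs : 0 ≤ s) (p : ℝ) {A : Matrix n n ℂ} (hA : A.PosSemidef) :
    pw p (s • A) = s ^ p • pw p A := by
  have e : s • A = hfun (fun x => s * x) A := by rw [← hfun_smul, hfun_id hA.1]
  rw [e, pw, hfun_comp _ _ hA.1, pw, hfun_smul]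
  refine hfun_congr fun hA' i => ?_
  rw [Real.mul_rpow hs (hA.eigenvalues_nonneg i)]

theorem traceFun_nonneg {K A : Matrix n n ℂ} (hK : K.IsHermitian) (hA : A.PosSemidef) :
    0 ≤ traceFun p z K A :=
  rtr_nonneg (pw_posSemidef z (conj_posSemidef hK (pw_posSemidef p hA)))

theorem traceFun_smul {s : ℝ} (hs : 0 ≤ s) {K A : Matrix n n ℂ} (hK : K.IsHermitian)
    (hA : A.PosSemidef) : traceFun p z K (s • A) = s ^ (p * z) * traceFun p z K A := by
  rw [traceFun, pw_smul hs p hA, Matrix.mul_smul, Matrix.smul_mul, pw_smul (by positivity) z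
    (conj_posSemidef hK (pw_posSemidef p hA)), rtr_smul, ← Real.rpow_mul hs, traceFun]

theorem traceFun_smul_left {r : ℝ} (hr : 0 ≤ r) {K A : Matrix n n ℂ} (hK : K.IsHermitian)
    (hA : A.PosSemidef) : traceFun p z (r • K) A = r ^ (2 * z) * traceFun p z K A := by
  rw [traceFun, Matrix.mul_smul, Matrix.smul_mul, Matrix.smul_mul, smul_smul,
    pw_smul (by positivity) z (conj_posSemidef hK (pw_posSemidef p hA)), rtr_smul, traceFun,
    Real.rpow_mul hr]
  norm_num [sq]

theorem traceFun_unitary {U : Matrix m m ℂ} (hU : U.IsHermitian) (hUU : U * U = 1)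
    (hK : K.IsHermitian) (hKU : K * U = U * K) (hA : A.IsHermitian) :
    traceFun p z K (U * A * U) = traceFun p z K A := by
  have hd : IsDecomp (fun _ : Unit => U) :=
    ⟨fun i j => by simp [hU.eq, hUU], by simp [hU.eq, hUU]⟩
  rw [hd.traceFun_eq (K' := fun _ => K) (A' := fun _ => A) hK (conj_isHermitian hU hA)
    (fun _ => hK) (fun _ => hA) (fun _ => hKU) (fun _ => by
      rw [Matrix.mul_assoc, hUU, Matrix.mul_one])]
  simp

/-- The reflection fixing all blocks but the `k`-th, on which it acts as `-1`. -/
def blockFlip (V : I → Matrix m n ℂ) (k : I) : Matrix m m ℂ := 1 - (2 : ℝ) • (V k * (V k)ᴴ)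

theorem blockFlip_isHermitian (V : I → Matrix m n ℂ) (k : I) : (blockFlip V k).IsHermitian := by
  have : (V k * (V k)ᴴ).IsHermitian := isHermitian_mul_conjTranspose_self _
  simp [blockFlip, IsHermitian, this.eq]

theorem IsDecomp.blockFlip_mul (h : IsDecomp V) (k i : I) :
    blockFlip V k * V i = (if i = k then (-1 : ℝ) else 1) • V i := by
  rw [blockFlip, Matrix.sub_mul, Matrix.one_mul, Matrix.smul_mul, Matrix.mul_assoc, h.orth]
  by_cases hik : i = k
  · subst hik
    simp only [if_true, Matrix.mul_one]
    module
  · simp [hik, Ne.symm hik]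

theorem IsDecomp.mul_blockFlip (h : IsDecomp V) (k i : I) :
    (V i)ᴴ * blockFlip V k = (if i = k then (-1 : ℝ) else 1) • (V i)ᴴ := by
  have := congrArg conjTranspose (h.blockFlip_mul k i)
  rwa [conjTranspose_mul, (blockFlip_isHermitian V k).eq, conjTranspose_smul, star_trivial] at this

theorem IsDecomp.blockFlip_sq (h : IsDecomp V) (k : I) : blockFlip V k * blockFlip V k = 1 := by
  refine h.ext fun i => ?_
  rw [Matrix.mul_assoc, h.blockFlip_mul, Matrix.mul_smul, h.blockFlip_mul, smul_smul]
  split_ifs <;> simp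

theorem IsDecomp.blockFlip_comm (h : IsDecomp V) {K' : I → Matrix n n ℂ}
    (hKV : ∀ i, K * V i = V i * K' i) (k : I) : K * blockFlip V k = blockFlip V k * K := by
  refine h.ext fun i => ?_
  rw [Matrix.mul_assoc, h.blockFlip_mul, Matrix.mul_smul, Matrix.mul_assoc, hKV,
    ← Matrix.mul_assoc, h.blockFlip_mul, Matrix.smul_mul]

theorem IsDecomp.exists_partial_pinching (h : IsDecomp V) (hpz : Admissible p z)
    {K' : I → Matrix n n ℂ} (hK : K.IsHermitian) (hKV : ∀ i, K * V i = V i * K' i)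
    (hA : A.PosDef) (T : Finset I) :
    ∃ B : Matrix m m ℂ, B.PosDef ∧ p * traceFun p z K A ≤ p * traceFun p z K B ∧
      ∀ i j, (V i)ᴴ * B * V j = if i = j ∨ (i ∉ T ∧ j ∉ T) then (V i)ᴴ * A * V j else 0 := by
  induction T using Finset.induction_on with
  | empty => exact ⟨A, hA, le_rfl, by simp⟩
  | insert k T hk ih =>
    obtain ⟨B, hB, hle, hBV⟩ := ih
    set U := blockFlip V k with hU
    have hUh : U.IsHermitian := blockFlip_isHermitian V k
    have hUU : U * U = 1 := h.blockFlip_sq k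
    have hUB : (U * B * U).PosDef := by
      have := hB.mul_mul_conjTranspose_same (B := U) ?_
      · rwa [hUh.eq] at this
      · intro x y hxy
        have := congrArg (fun v => v ᵥ* U) hxy
        simpa [vecMul_vecMul, hUU] using this
    refine ⟨(1 / 2 : ℝ) • B + (1 / 2 : ℝ) • (U * B * U),
      posDef_mix hB hUB (by norm_num) (by norm_num) (by norm_num), ?_, fun i j => ?_⟩
    · have := hpz.traceFun_concave hK hB hUB (t₁ := 1 / 2) (t₂ := 1 / 2) (by norm_num)
        (by norm_num) (by norm_num)
      rw [traceFun_unitary hUh hUU hK (h.blockFlip_comm hKV k) hB.1] at this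
      linarith
    · have e : (V i)ᴴ * (U * B * U) * V j =
          ((if i = k then (-1 : ℝ) else 1) * (if j = k then (-1 : ℝ) else 1)) •
            ((V i)ᴴ * B * V j) := by
        have : (V i)ᴴ * (U * B * U) * V j = ((V i)ᴴ * U) * B * (U * V j) := by
          simp only [Matrix.mul_assoc]
        rw [this, h.mul_blockFlip, h.blockFlip_mul, Matrix.smul_mul, Matrix.smul_mul,
          Matrix.mul_smul, smul_smul]
      rw [Matrix.mul_add, Matrix.add_mul, Matrix.mul_smul, Matrix.smul_mul, Matrix.mul_smul,
        Matrix.smul_mul, e, hBV]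
      by_cases hik : i = k <;> by_cases hjk : j = k
      · subst hik; subst hjk
        simp only [if_true, true_or]
        module
      · subst hik
        simp only [hjk, Ne.symm hjk, if_true, if_false, Finset.mem_insert_self, not_true,
          false_and, or_self]
        module
      · subst hjk
        simp only [hik, if_true, if_false, Finset.mem_insert_self, not_true, and_false, or_self]
        module
      · simp only [hik, hjk, if_false, Finset.mem_insert, false_or]
        module

/-- Pinching increases the trace functional (up to the sign of `p`). -/
theorem IsDecomp.pinching (h : IsDecomp V) (hpz : Admissible p z)
    {K' : I → Matrix n n ℂ} (hK : K.IsHermitian) (hK' : ∀ i, (K' i).IsHermitian)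
    (hKV : ∀ i, K * V i = V i * K' i) (hA : A.PosDef) :
    p * traceFun p z K A ≤ p * ∑ i, traceFun p z (K' i) ((V i)ᴴ * A * V i) := by
  obtain ⟨B, hB, hle, hBV⟩ := h.exists_partial_pinching hpz hK hKV hA Finset.univ
  refine hle.trans_eq ?_
  rw [h.traceFun_eq hK hB.1 hK' (fun i => isHermitian_conjTranspose_mul_mul _ hA.1) hKV]
  intro j
  have : B * V j = ∑ i, V i * ((V i)ᴴ * B * V j) := by
    conv_lhs => rw [← Matrix.one_mul (B * V j), ← h.complete, Matrix.sum_mul]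
    exact Finset.sum_congr rfl fun i _ => by simp only [Matrix.mul_assoc]
  rw [this, Finset.sum_eq_single j]
  · rw [hBV]; simp
  · intro i _ hij
    rw [hBV]; simp [hij]
  · simp

end Decomposition

section Support

variable {k m n : Type*} [Fintype k] [DecidableEq k] [Fintype m] [Fintype n] [DecidableEq m]
  [DecidableEq n]
variable {A B X : Matrix n n ℂ}

theorem pw_mul_posSemidef {p q : ℝ} (hp : p ≠ 0) (hpq : p + q ≠ 0) (hA : A.PosSemidef) :
    pw p A * pw q A = pw (p + q) A := by
  rw [pw, pw, pw, hfun_mul]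
  refine hfun_congr fun _ i => ?_
  rcases (hA.eigenvalues_nonneg i).eq_or_lt with h | h
  · rw [← h, Real.zero_rpow hp, Real.zero_rpow hpq, zero_mul]
  · exact (Real.rpow_add h p q).symm

theorem pw_half_mul (p : ℝ) (hA : A.PosSemidef) :
    pw (p / 2) A * pw (p / 2) A = pw p A := by
  rcases eq_or_ne p 0 with rfl | hp
  · simp [pw_zero hA.1]
  · rw [pw_mul_posSemidef (by simpa using hp) (by simpa using hp) hA, add_halves]

theorem mul_eq_zero_of_conj (hA : A.PosSemidef) {M : Matrix n k ℂ} (h : Mᴴ * A * M = 0) :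
    A * M = 0 := by
  have e := pw_half_mul 1 hA
  rw [pw_one hA.1] at e
  have : pw (1 / 2) A * M = 0 := by
    rw [← conjTranspose_mul_self_eq_zero, conjTranspose_mul, (pw_isHermitian _ A).eq,
      Matrix.mul_assoc, ← Matrix.mul_assoc (pw (1 / 2) A), e, ← Matrix.mul_assoc, h]
  rw [← e, Matrix.mul_assoc, this, Matrix.mul_zero]

theorem hfun_zero_matrix (f : ℝ → ℝ) : hfun f (0 : Matrix n n ℂ) = f 0 • 1 := by
  have h := hfun_diagonal (n := n) f (fun _ => 0)
  simp only [Complex.ofReal_zero, diagonal_zero] at h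
  rw [h]
  ext i j
  simp [diagonal_apply, Matrix.one_apply]

theorem pw_mul_eq_zero {p : ℝ} (hp : p ≠ 0) (hA : A.IsHermitian) {M : Matrix n k ℂ}
    (h : A * M = 0) : pw p A * M = 0 := by
  have := hfun_intertwine (fun x => x ^ p) hA (isHermitian_zero (n := k)) (V := M)
    (by rw [h, Matrix.mul_zero])
  rw [hfun_zero_matrix, Real.zero_rpow hp, zero_smul, Matrix.mul_zero] at this
  exact this

/-- The orthogonal projection onto the kernel of a Hermitian matrix. -/
def kerProj (A : Matrix n n ℂ) : Matrix n n ℂ := hfun (fun x => if x = 0 then 1 else 0) A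

theorem kerProj_isHermitian (A : Matrix n n ℂ) : (kerProj A).IsHermitian := hfun_isHermitian _ _

theorem mul_kerProj (hA : A.IsHermitian) : A * kerProj A = 0 := by
  conv_lhs => rw [kerProj]; arg 1; rw [← hfun_id hA]
  rw [hfun_mul]
  have : hfun (fun x => x * if x = 0 then 1 else 0) A = hfun (fun _ => 0) A := by
    congr 1
    funext x
    split_ifs with h <;> simp [h]
  rw [this, hfun_const 0 hA, zero_smul]

theorem one_eq_kerProj_add (hA : A.IsHermitian) : 1 = kerProj A + hfun (fun x => x⁻¹) A * A := by
  conv_rhs => arg 2; arg 2; rw [← hfun_id hA]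
  rw [kerProj, hfun_mul, hfun_add, ← one_smul ℝ (1 : Matrix n n ℂ), ← hfun_const 1 hA]
  congr 1
  funext x
  by_cases h : x = 0 <;> simp [h]

/-- The support of `A` is contained in that of `B`. -/
def SuppLE (A B : Matrix n n ℂ) : Prop := A * kerProj B = 0

theorem SuppLE.eq (h : SuppLE A B) (hB : B.IsHermitian) : A = A * hfun (fun x => x⁻¹) B * B := by
  conv_lhs => rw [← Matrix.mul_one A, one_eq_kerProj_add hB, Matrix.mul_add, h, zero_add,
    ← Matrix.mul_assoc]

theorem SuppLE.mul_eq_zero (h : SuppLE A B) (hB : B.IsHermitian) {M : Matrix n k ℂ}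
    (hM : B * M = 0) : A * M = 0 := by
  rw [h.eq hB, Matrix.mul_assoc, hM, Matrix.mul_zero]

theorem SuppLE.trans (h : SuppLE A B) (hB : B.IsHermitian) (h' : SuppLE B X) : SuppLE A X :=
  h.mul_eq_zero hB h'

theorem suppLE_of_le (hA : A.PosSemidef) (hB : B.IsHermitian) (h : A ≤ B) : SuppLE A B := by
  refine mul_eq_zero_of_conj hA ?_
  have h2 := (Matrix.le_iff.mp h).conjTranspose_mul_mul_same (kerProj B)
  rw [Matrix.mul_sub, Matrix.sub_mul, Matrix.mul_assoc _ B, mul_kerProj hB, Matrix.mul_zero,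
    zero_sub] at h2
  have h1 := hA.conjTranspose_mul_mul_same (kerProj B)
  refine le_antisymm ?_ h1.nonneg
  rw [← neg_nonneg]
  exact h2.nonneg

theorem suppLE_smul {t : ℝ} (ht : t ≠ 0) : SuppLE (t • A) B ↔ SuppLE A B := by
  simp [SuppLE, ht]

theorem suppLE_iff_msupp (hA : A.IsHermitian) (hB : B.IsHermitian) :
    SuppLE A B ↔ msupp A ≤ msupp B := by
  constructor
  · intro h
    have e : A = B * (hfun (fun x => x⁻¹) B * A) := by
      have := congrArg conjTranspose (h.eq hB)
      rwa [conjTranspose_mul, conjTranspose_mul, hA.eq, hB.eq, (hfun_isHermitian _ B).eq] at this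
    rintro _ ⟨v, rfl⟩
    refine ⟨(hfun (fun x => x⁻¹) B * A) *ᵥ v, ?_⟩
    rw [mulVecLin_apply, mulVecLin_apply, mulVec_mulVec, ← e]
  · intro h
    have : kerProj B * A = 0 := by
      refine Matrix.ext_of_mulVec_single fun i => ?_
      obtain ⟨w, hw⟩ := h ⟨Pi.single i 1, rfl⟩
      rw [mulVecLin_apply, mulVecLin_apply] at hw
      rw [← mulVec_mulVec, ← hw, mulVec_mulVec]
      have := congrArg conjTranspose (mul_kerProj hB)
      rw [conjTranspose_mul, (kerProj_isHermitian B).eq, hB.eq, conjTranspose_zero] at this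
      rw [this, zero_mulVec, zero_mulVec]
    have := congrArg conjTranspose this
    rwa [conjTranspose_mul, (kerProj_isHermitian B).eq, hA.eq, conjTranspose_zero] at this

theorem le_rtr_smul_one (hA : A.PosSemidef) : A ≤ rtr A • (1 : Matrix n n ℂ) := by
  have e := rtr_hfun (fun x => x) hA.1
  rw [hfun_id hA.1] at e
  rw [← hfun_const (rtr A) hA.1]
  conv_lhs => rw [← hfun_id hA.1]
  refine hfun_le_hfun fun _ i => ?_
  rw [e]
  exact Finset.single_le_sum (f := fun i => hA.1.eigenvalues i)
    (fun j _ => hA.eigenvalues_nonneg j) (Finset.mem_univ i)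

theorem SuppLE.exists_smul_le (h : SuppLE A B) (hA : A.PosSemidef) (hB : B.PosSemidef) :
    ∃ t : ℝ, 0 < t ∧ t • A ≤ B := by
  set R := pw (-(1 / 2)) B
  set S := pw (1 / 2) B
  have hR : R.IsHermitian := pw_isHermitian _ _
  have hS : S.IsHermitian := pw_isHermitian _ _
  have hSR : R * S = hfun (fun x => x⁻¹) B * B := by
    conv_rhs => arg 2; rw [← hfun_id hB.1]
    rw [hfun_mul]
    change hfun _ B * hfun _ B = _
    rw [hfun_mul]
    refine hfun_congr fun _ i => ?_
    rcases (hB.eigenvalues_nonneg i).eq_or_lt with h | h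
    · rw [← h, Real.zero_rpow (by norm_num), zero_mul, mul_zero]
    · rw [← Real.rpow_add h, inv_mul_cancel₀ h.ne']
      norm_num
  have e1 : A * (R * S) = A := by
    rw [hSR, ← Matrix.mul_assoc]
    exact (h.eq hB.1).symm
  have e2 : (S * R) * A = A := by
    have := congrArg conjTranspose e1
    rwa [conjTranspose_mul, conjTranspose_mul, hA.1.eq, hS.eq, hR.eq] at this
  have hM : (R * A * R).PosSemidef := conj_posSemidef hR hA
  have e3 : S * (R * A * R) * S = A := by
    rw [show S * (R * A * R) * S = (S * R) * (A * (R * S)) by simp only [Matrix.mul_assoc], e1, e2]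
  have h1 := conj_mono hS (le_rtr_smul_one hM)
  have eS : S * S = B := by
    have := pw_half_mul 1 hB
    rwa [pw_one hB.1] at this
  rw [e3, Matrix.mul_smul, Matrix.smul_mul, Matrix.mul_one, eS] at h1
  have ht := rtr_nonneg hM
  refine ⟨(rtr (R * A * R) + 1)⁻¹, by positivity, ?_⟩
  rw [inv_smul_le_iff_of_pos (by positivity), add_smul, one_smul]
  exact h1.trans (le_add_of_nonneg_right hB.nonneg)

theorem rtr_eq_zero_iff (hA : A.PosSemidef) : rtr A = 0 ↔ A = 0 := by
  refine ⟨fun h => ?_, fun h => by simp [h, rtr]⟩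
  have := le_rtr_smul_one hA
  rw [h, zero_smul] at this
  exact le_antisymm this hA.nonneg

theorem trace_mul_eq_zero_iff (hA : A.PosSemidef) (hB : B.PosSemidef) :
    (A * B).trace = 0 ↔ B * A = 0 := by
  constructor
  · intro h
    set S := pw (1 / 2) A
    have eS : S * S = A := by
      have := pw_half_mul 1 hA
      rwa [pw_one hA.1] at this
    have hS : S.IsHermitian := pw_isHermitian _ _
    have h1 : rtr (S * B * S) = 0 := by
      rw [rtr_mul_comm, ← Matrix.mul_assoc, eS, rtr, h, Complex.zero_re]
    rw [rtr_eq_zero_iff (conj_posSemidef hS hB)] at h1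
    have h2 := mul_eq_zero_of_conj (M := S) hB (by rwa [hS.eq])
    rw [← eS, ← Matrix.mul_assoc, h2, Matrix.zero_mul]
  · intro h
    rw [Matrix.trace_mul_comm, h, Matrix.trace_zero]

theorem rtr_pw_pos_iff {z : ℝ} (hz : z ≠ 0) (hA : A.PosSemidef) : 0 < rtr (pw z A) ↔ A ≠ 0 := by
  rw [(rtr_nonneg (pw_posSemidef z hA)).lt_iff_ne', ne_eq, rtr_eq_zero_iff (pw_posSemidef z hA),
    not_iff_not]
  constructor
  · intro h
    have := pw_mul_posSemidef (q := 1 - z) hz (by norm_num) hA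
    rw [h, Matrix.zero_mul, add_sub_cancel, pw_one hA.1] at this
    exact this.symm
  · rintro rfl
    rw [pw, hfun_zero_matrix, Real.zero_rpow hz, zero_smul]

theorem pw_mul_eq_zero_iff {p : ℝ} (hp : p ≠ 0) (hA : A.PosSemidef) {M : Matrix n k ℂ} :
    pw p A * M = 0 ↔ A * M = 0 := by
  refine ⟨fun h => ?_, pw_mul_eq_zero hp hA.1⟩
  have := pw_mul_eq_zero (p := p⁻¹) (inv_ne_zero hp) (pw_isHermitian p A) h
  rwa [pw_pw _ _ hA, mul_inv_cancel₀ hp, pw_one hA.1] at this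

theorem traceFun_pos_iff {a p z : ℝ} (ha : a ≠ 0) (hp : p ≠ 0) (hz : z ≠ 0) (hA : A.PosSemidef)
    (hB : B.PosSemidef) : 0 < traceFun p z (pw a A) B ↔ (A * B).trace ≠ 0 := by
  have hK := pw_isHermitian a A
  rw [traceFun, rtr_pw_pos_iff hz (conj_posSemidef hK (pw_posSemidef p hB)), not_iff_not,
    Matrix.trace_mul_comm, trace_mul_eq_zero_iff hB hA]
  constructor
  · intro h
    have := mul_eq_zero_of_conj (M := pw a A) (pw_posSemidef p hB) (by rwa [hK.eq])
    rw [pw_mul_eq_zero_iff hp hB] at this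
    have := congrArg conjTranspose this
    rwa [conjTranspose_mul, hK.eq, hB.1.eq, conjTranspose_zero, pw_mul_eq_zero_iff ha hA] at this
  · intro h
    rw [Matrix.mul_assoc]
    have := pw_mul_eq_zero ha hA.1 h
    have := congrArg conjTranspose this
    rw [conjTranspose_mul, hK.eq, hB.1.eq, conjTranspose_zero] at this
    rw [pw_mul_eq_zero hp hB.1 this, Matrix.mul_zero]

theorem pw_shift (p η : ℝ) (hA : A.IsHermitian) :
    pw p (shift η A) = hfun (fun x => (x + η) ^ p) A := by
  have : shift η A = hfun (fun x => x + η) A := by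
    rw [shift, ← hfun_const η hA, ← hfun_add, hfun_id hA]
  rw [this, pw, hfun_comp _ _ hA]

theorem tendsto_conj_pw_shift {p : ℝ} (hp : p ≠ 0) {K : Matrix n n ℂ} (hA : A.PosSemidef)
    (h : 0 < p ∨ SuppLE K A) :
    Tendsto (fun η : ℝ => K * pw p (shift η A) * K) (nhdsWithin 0 (Ioi 0))
      (nhds (K * pw p A * K)) := by
  have key : Tendsto (fun η : ℝ => K * hfun (fun x => if x = 0 ∧ p < 0 then 0 else (x + η) ^ p) A)
      (nhdsWithin 0 (Ioi 0)) (nhds (K * pw p A)) := by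
    refine Tendsto.const_mul _ (tendsto_hfun fun _ i => ?_)
    have hc : Tendsto (fun η : ℝ => hA.1.eigenvalues i + η) (nhdsWithin 0 (Ioi 0))
        (nhds (hA.1.eigenvalues i)) := by
      have : Tendsto (fun η : ℝ => hA.1.eigenvalues i + η) (nhds 0)
        (nhds (hA.1.eigenvalues i + 0)) := Continuous.tendsto (by fun_prop) 0
      rw [add_zero] at this
      exact this.mono_left nhdsWithin_le_nhds
    by_cases hc' : hA.1.eigenvalues i = 0 ∧ p < 0
    · simp [hc', hp]
    · simp only [hc', if_false]
      refine hc.rpow_const ?_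
      rw [not_and_or, not_lt] at hc'
      exact hc'
  refine (key.mul_const K).congr' ?_
  filter_upwards with η
  congr 1
  rw [pw_shift p η hA.1]
  rcases lt_or_ge p 0 with hp0 | hp0
  · have hK := h.resolve_left hp0.not_gt
    have e : hfun (fun x => (x + η) ^ p) A = hfun (fun x => if x = 0 ∧ p < 0 then 0
        else (x + η) ^ p) A + kerProj A * hfun (fun x => (x + η) ^ p) A := by
      rw [kerProj, hfun_mul, hfun_add]
      congr 1
      funext x
      by_cases hx : x = 0 <;> simp [hx, hp0]
    conv_rhs => rw [e, Matrix.mul_add, ← Matrix.mul_assoc, hK, Matrix.zero_mul, add_zero]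
  · simp [hp0.not_gt]

theorem tendsto_traceFun_shift {p z : ℝ} (hp : p ≠ 0) (hz : 0 < z) {K : Matrix n n ℂ}
    (hK : K.IsHermitian) (hA : A.PosSemidef) (h : 0 < p ∨ SuppLE K A) :
    Tendsto (fun η : ℝ => traceFun p z K (shift η A)) (nhdsWithin 0 (Ioi 0))
      (nhds (traceFun p z K A)) := by
  refine tendsto_rtr_pw hz ?_ (conj_posSemidef hK (pw_posSemidef p hA))
    (tendsto_conj_pw_shift hp hA h)
  filter_upwards [self_mem_nhdsWithin] with η hη
  exact conj_posSemidef hK (pw_posSemidef p (shift_posDef hη hA).posSemidef)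

theorem suppLE_pw {a : ℝ} (ha : a ≠ 0) (hA : A.IsHermitian) (h : SuppLE A B) :
    SuppLE (pw a A) B := pw_mul_eq_zero ha hA h

end Support

section CommonEigenbasis

open Module.End in
theorem exists_common_eigenbasis {d : ℕ} {A B : Matrix (Fin d) (Fin d) ℂ} (hA : A.IsHermitian)
    (hB : B.IsHermitian) (hAB : A * B = B * A) :
    ∃ (U : Matrix (Fin d) (Fin d) ℂ) (a b : Fin d → ℝ), Uᴴ * U = 1 ∧
      A * U = U * diagonal (fun i => (a i : ℂ)) ∧ B * U = U * diagonal (fun i => (b i : ℂ)) := by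
  have hS := Matrix.isSymmetric_toEuclideanLin_iff.mpr hA
  have hT := Matrix.isSymmetric_toEuclideanLin_iff.mpr hB
  set S := A.toEuclideanLin with hSdef
  set T := B.toEuclideanLin with hTdef
  have hST : Commute S T := by
    change S * T = T * S
    ext x i
    simp only [hSdef, hTdef, Module.End.mul_apply, Matrix.toLpLin_apply, Matrix.mulVec_mulVec, hAB]
  let W : Eigenvalues T × Eigenvalues S → Submodule ℂ (EuclideanSpace ℂ (Fin d)) :=
    fun i => eigenspace S (i.2 : ℂ) ⊓ eigenspace T (i.1 : ℂ)
  have hW : OrthogonalFamily ℂ (fun i => W i) fun i => (W i).subtypeₗᵢ :=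
    (LinearMap.IsSymmetric.orthogonalFamily_eigenspace_inf_eigenspace hS hT).comp
      (f := fun i : Eigenvalues T × Eigenvalues S => ((i.1 : ℂ), (i.2 : ℂ)))
      (fun i j hij => by
        simp only [Prod.mk.injEq] at hij
        exact Prod.ext (Subtype.ext hij.1) (Subtype.ext hij.2))
  have hInt : DirectSum.IsInternal W := by
    rw [hW.isInternal_iff, Submodule.orthogonal_eq_bot_iff, eq_top_iff,
      ← LinearMap.IsSymmetric.iSup_iSup_eigenspace_inf_eigenspace_eq_top_of_commute hS hT hST]
    refine iSup_le fun x => iSup_le fun y => ?_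
    by_cases hx : eigenspace S x = ⊥
    · simp [hx]
    by_cases hy : eigenspace T y = ⊥
    · simp [hy]
    exact le_iSup W (⟨y, hy⟩, ⟨x, hx⟩)
  have hfin : Module.finrank ℂ (EuclideanSpace ℂ (Fin d)) = d := finrank_euclideanSpace_fin
  let e := hInt.subordinateOrthonormalBasis hfin hW
  let f := fun i => hInt.subordinateOrthonormalBasisIndex hfin i hW
  have he : ∀ i, e i ∈ W (f i) := fun i => hInt.subordinateOrthonormalBasis_subordinate hfin i hW
  have hre : ∀ {R : Matrix (Fin d) (Fin d) ℂ} (hR : R.toEuclideanLin.IsSymmetric)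
      (c : Eigenvalues R.toEuclideanLin), ((c : ℂ).re : ℂ) = c := fun hR c =>
    Complex.conj_eq_iff_re.mp (hR.conj_eigenvalue_eq_self c.2)
  refine ⟨Matrix.of fun x i => e i x, fun i => ((f i).2 : ℂ).re, fun i => ((f i).1 : ℂ).re,
    ?_, ?_, ?_⟩
  · ext i j
    have h := orthonormal_iff_ite.mp e.orthonormal i j
    rw [EuclideanSpace.inner_eq_star_dotProduct] at h
    simp only [Matrix.mul_apply, Matrix.conjTranspose_apply, Matrix.of_apply, Matrix.one_apply]
    rw [← h]
    simp [dotProduct, mul_comm]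
  · ext x i
    have h := congrArg (fun v : EuclideanSpace ℂ (Fin d) => v x) (mem_eigenspace_iff.mp (he i).1)
    rw [Matrix.mul_diagonal, show ((((f i).2 : ℂ).re : ℝ) : ℂ) = ((f i).2 : ℂ) from hre hS _]
    simpa [hSdef, Matrix.toLpLin_apply, Matrix.mulVec, dotProduct, Matrix.mul_apply, mul_comm]
      using h
  · ext x i
    have h := congrArg (fun v : EuclideanSpace ℂ (Fin d) => v x) (mem_eigenspace_iff.mp (he i).2)
    rw [Matrix.mul_diagonal, show ((((f i).1 : ℂ).re : ℝ) : ℂ) = ((f i).1 : ℂ) from hre hT _]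
    simpa [hTdef, Matrix.toLpLin_apply, Matrix.mulVec, dotProduct, Matrix.mul_apply, mul_comm]
      using h

end CommonEigenbasis

section TensorProduct

variable {a b : ℕ}

theorem dtens_eq_submatrix (A : Matrix (Fin a) (Fin a) ℂ) (B : Matrix (Fin b) (Fin b) ℂ) :
    dtens A B = (A ⊗ₖ B).submatrix finProdFinEquiv.symm finProdFinEquiv.symm := by
  ext x y
  simp [dtens, kroneckerMap_apply]

theorem dtens_mul (A C : Matrix (Fin a) (Fin a) ℂ) (B D : Matrix (Fin b) (Fin b) ℂ) :
    dtens (A * C) (B * D) = dtens A B * dtens C D := by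
  simp only [dtens_eq_submatrix, mul_kronecker_mul, submatrix_mul_equiv]

theorem dtens_posSemidef {A : Matrix (Fin a) (Fin a) ℂ} {B : Matrix (Fin b) (Fin b) ℂ}
    (hA : A.PosSemidef) (hB : B.PosSemidef) : (dtens A B).PosSemidef := by
  rw [dtens_eq_submatrix]
  exact (hA.kronecker hB).submatrix _

theorem dtens_trace (A : Matrix (Fin a) (Fin a) ℂ) (B : Matrix (Fin b) (Fin b) ℂ) :
    (dtens A B).trace = A.trace * B.trace := by
  rw [← trace_kronecker, dtens_eq_submatrix, trace, trace]
  exact Equiv.sum_comp finProdFinEquiv.symm fun x => (A ⊗ₖ B) x x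

theorem dtens_isState {A : Matrix (Fin a) (Fin a) ℂ} {B : Matrix (Fin b) (Fin b) ℂ}
    (hA : IsState A) (hB : IsState B) : IsState (dtens A B) :=
  ⟨dtens_posSemidef hA.1 hB.1, by rw [dtens_trace, hA.2, hB.2, one_mul]⟩

theorem msupp_le_iff {n : Type*} [Fintype n] [DecidableEq n] {A B : Matrix n n ℂ} :
    msupp A ≤ msupp B ↔ ∃ M, A = B * M := by
  constructor
  · intro h
    have hx : ∀ j, ∃ v, B *ᵥ v = A *ᵥ Pi.single j 1 := fun j => by
      simpa [msupp] using h ⟨Pi.single j 1, rfl⟩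
    choose v hv using hx
    refine ⟨Matrix.of fun i j => v j i, ?_⟩
    ext i j
    have := congrFun (hv j) i
    rw [mulVec_single_one] at this
    exact this.symm
  · rintro ⟨M, rfl⟩ _ ⟨v, rfl⟩
    exact ⟨M *ᵥ v, by simp⟩

theorem msupp_dtens_le {A C : Matrix (Fin a) (Fin a) ℂ} {B D : Matrix (Fin b) (Fin b) ℂ}
    (h₁ : msupp A ≤ msupp C) (h₂ : msupp B ≤ msupp D) :
    msupp (dtens A B) ≤ msupp (dtens C D) := by
  obtain ⟨M, rfl⟩ := msupp_le_iff.mp h₁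
  obtain ⟨N, rfl⟩ := msupp_le_iff.mp h₂
  exact msupp_le_iff.mpr ⟨dtens M N, dtens_mul _ _ _ _⟩

/-- The isometry `v ↦ uᵢ ⊗ v`, where `uᵢ` is the `i`-th column of `U`. -/
def tensCol (b : ℕ) (U : Matrix (Fin a) (Fin a) ℂ) (i : Fin a) : Matrix (Fin (a * b)) (Fin b) ℂ :=
  Matrix.of fun x k => U (finProdFinEquiv.symm x).1 i *
    (1 : Matrix (Fin b) (Fin b) ℂ) (finProdFinEquiv.symm x).2 k

theorem sum_fin_mul (f : Fin a → Fin b → ℂ) :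
    ∑ x : Fin (a * b), f (finProdFinEquiv.symm x).1 (finProdFinEquiv.symm x).2 =
      ∑ x, ∑ y, f x y := by
  rw [Equiv.sum_comp finProdFinEquiv.symm fun x => f x.1 x.2, Fintype.sum_prod_type]

theorem tensCol_conjTranspose_mul (U : Matrix (Fin a) (Fin a) ℂ) (i j : Fin a) :
    (tensCol b U i)ᴴ * tensCol b U j = (Uᴴ * U) i j • 1 := by
  ext k l
  simp only [Matrix.mul_apply, conjTranspose_apply, tensCol, Matrix.of_apply, Matrix.smul_apply]
  rw [sum_fin_mul (b := b) fun x y => star (U x i * (1 : Matrix (Fin b) (Fin b) ℂ) y k) *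
    (U x j * (1 : Matrix (Fin b) (Fin b) ℂ) y l)]
  rw [smul_eq_mul, Finset.sum_mul]
  refine Finset.sum_congr rfl fun x _ => ?_
  by_cases hkl : k = l <;> simp [Matrix.one_apply, hkl, Ne.symm, apply_ite]

theorem sum_tensCol_mul (U : Matrix (Fin a) (Fin a) ℂ) (c : Fin a → ℂ)
    (X : Matrix (Fin b) (Fin b) ℂ) :
    ∑ i, c i • (tensCol b U i * X * (tensCol b U i)ᴴ) = dtens (U * diagonal c * Uᴴ) X := by
  ext x y
  simp only [Matrix.sum_apply, Matrix.smul_apply, dtens, Matrix.of_apply]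
  have : ∀ i, (tensCol b U i * X * (tensCol b U i)ᴴ) x y =
      U (finProdFinEquiv.symm x).1 i * star (U (finProdFinEquiv.symm y).1 i) *
        X (finProdFinEquiv.symm x).2 (finProdFinEquiv.symm y).2 := by
    intro i
    simp [Matrix.mul_apply, tensCol, Matrix.one_apply, apply_ite]
    ring
  simp only [this]
  rw [Matrix.mul_apply, Finset.sum_mul]
  refine Finset.sum_congr rfl fun i _ => ?_
  rw [Matrix.mul_diagonal, conjTranspose_apply, smul_eq_mul]
  ring

theorem tensCol_isDecomp {U : Matrix (Fin a) (Fin a) ℂ} (hU : Uᴴ * U = 1) :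
    IsDecomp (tensCol b U) where
  orth i j := by
    rw [tensCol_conjTranspose_mul, hU, Matrix.one_apply]
    split_ifs <;> simp
  complete := by
    have h := sum_tensCol_mul (b := b) U (fun _ => 1) 1
    simp only [one_smul, Matrix.mul_one, diagonal_one, mul_eq_one_comm.mp hU] at h
    rw [h, dtens_eq_submatrix, one_kronecker_one, submatrix_one_equiv]

theorem dtens_mul_tensCol {U A : Matrix (Fin a) (Fin a) ℂ} {c : Fin a → ℝ}
    (h : A * U = U * diagonal (fun i => (c i : ℂ))) (B : Matrix (Fin b) (Fin b) ℂ) (i : Fin a) :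
    dtens A B * tensCol b U i = tensCol b U i * (c i • B) := by
  ext x k
  have h' := congrFun (congrFun h (finProdFinEquiv.symm x).1) i
  rw [Matrix.mul_diagonal, Matrix.mul_apply] at h'
  simp only [Matrix.mul_apply, tensCol, Matrix.of_apply, dtens]
  rw [sum_fin_mul (b := b) fun s t => A (finProdFinEquiv.symm x).1 s *
    B (finProdFinEquiv.symm x).2 t * (U s i * (1 : Matrix (Fin b) (Fin b) ℂ) t k)]
  simp only [Matrix.one_apply, mul_ite, mul_one, mul_zero, Finset.sum_ite_eq', Finset.mem_univ,
    if_true, ite_mul, zero_mul, Finset.sum_ite_eq, Matrix.smul_apply]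
  calc _ = (∑ s, A (finProdFinEquiv.symm x).1 s * U s i) * B (finProdFinEquiv.symm x).2 k := by
        rw [Finset.sum_mul]
        exact Finset.sum_congr rfl fun s _ => by ring
    _ = _ := by rw [h', Complex.real_smul]; ring

end TensorProduct

section AlphaZ

variable {n : Type*} [Fintype n] [DecidableEq n]

theorem mpow_eq_pw {w : ℝ} (hw : w ≠ 0) {A : Matrix n n ℂ} (hA : A.PosSemidef) :
    mpow A (w : ℂ) = pw w A := by
  rw [mpow, dif_pos hA.1, pw, hfun_eq _ hA.1]
  congr 3
  funext i
  split_ifs with h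
  · simp [h, hw]
  · rw [Complex.ofReal_cpow (hA.eigenvalues_nonneg i)]

theorem Qaz_eq_traceFun {α z : ℝ} (hα : 0 < α) (hα1 : α ≠ 1) (hz : 0 < z) {ρ σ : Matrix n n ℂ}
    (hρ : ρ.PosSemidef) (hσ : σ.PosSemidef) :
    Qaz α z ρ σ = traceFun ((1 - α) / z) z (pw (α / (2 * z)) ρ) σ := by
  have h1 : α / (2 * z) ≠ 0 := by positivity
  have h2 : (1 - α) / z ≠ 0 := div_ne_zero (sub_ne_zero.mpr hα1.symm) hz.ne'
  rw [Qaz, mpow_eq_pw h1 hρ, mpow_eq_pw h2 hσ, mpow_eq_pw hz.ne'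
    (conj_posSemidef (pw_isHermitian _ _) (pw_posSemidef _ hσ)), traceFun]

end AlphaZ

section ScalarExpansion

theorem rpow_ge_sub_sq {z u : ℝ} (hz0 : 0 < z) (hz1 : z ≤ 1) (hu : 0 ≤ u) :
    1 + z * (u - 1) - (u - 1) ^ 2 ≤ u ^ z := by
  rcases hu.eq_or_lt with rfl | hu
  · rw [Real.zero_rpow hz0.ne']; nlinarith
  have h := le_rpow_tangent hz0.le hz1 zero_le_one hu
  rw [Real.one_rpow] at h
  have e : u ^ z = u * u ^ (z - 1) := by
    rw [Real.rpow_sub_one hu.ne']; field_simp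
  have hp : 0 < u ^ (z - 1) := Real.rpow_pos_of_pos hu _
  set q := u ^ (z - 1)
  rw [e] at h ⊢
  have h1 : 1 ≤ q * (1 + (1 - z) * (u - 1)) := by linarith
  have h2 : 0 < 1 + (1 - z) * (u - 1) := by nlinarith
  have h3 : 1 - (1 - z) * (u - 1) ≤ q := by
    by_contra! hc
    nlinarith [sq_nonneg ((1 - z) * (u - 1)), mul_lt_mul_of_pos_right hc h2]
  nlinarith [sq_nonneg (u - 1)]

theorem exists_abs_rpow_sub_tangent_le_one {z M : ℝ} (hz : 0 < z) :
    ∃ C, 0 ≤ C ∧ ∀ u, 0 ≤ u → u ≤ M → |u ^ z - 1 - z * (u - 1)| ≤ C * (u - 1) ^ 2 := by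
  rcases le_total z 1 with hz1 | hz1
  · refine ⟨1, zero_le_one, fun u hu _ => abs_le.mpr ⟨?_, ?_⟩⟩
    · linarith [rpow_ge_sub_sq hz hz1 hu]
    · have := le_rpow_tangent hz.le hz1 hu zero_lt_one
      simp only [Real.one_rpow, mul_one] at this
      nlinarith [sq_nonneg (u - 1)]
  suffices ∃ C, 0 ≤ C ∧ ∀ u, 0 ≤ u → u ≤ M →
      (u - 1) * (u ^ (z - 1) - 1) ≤ C * (u - 1) ^ 2 by
    obtain ⟨C, hC, h⟩ := this
    refine ⟨z * C, by positivity, fun u hu huM => abs_le.mpr ⟨?_, ?_⟩⟩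
    · have := rpow_tangent_le hz1 hu zero_le_one
      simp only [Real.one_rpow, mul_one] at this
      nlinarith [mul_nonneg (mul_nonneg hz.le hC) (sq_nonneg (u - 1))]
    · have := rpow_tangent_le hz1 zero_le_one hu
      rw [Real.one_rpow] at this
      nlinarith [mul_le_mul_of_nonneg_left (h u hu huM) hz.le]
  set w := z - 1 with hw
  have hw0 : 0 ≤ w := by linarith
  rcases le_total w 1 with hw1 | hw1
  · refine ⟨1, zero_le_one, fun u hu _ => ?_⟩
    rcases le_total u 1 with hu1 | hu1
    · have h : u ≤ u ^ w := by
        rcases hu.eq_or_lt with rfl | hu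
        · exact Real.rpow_nonneg le_rfl _
        · simpa using Real.rpow_le_rpow_of_exponent_ge hu hu1 hw1
      nlinarith
    · have h : u ^ w ≤ u := by simpa using Real.rpow_le_rpow_of_exponent_le hu1 hw1
      nlinarith
  · refine ⟨w * (1 + |M| ^ (w - 1)), by positivity, fun u hu huM => ?_⟩
    have hM : 0 ≤ |M| ^ (w - 1) := by positivity
    rcases le_total u 1 with hu1 | hu1
    · have := rpow_tangent_le hw1 hu zero_le_one
      simp only [Real.one_rpow, mul_one] at this
      nlinarith [mul_nonneg (mul_nonneg hw0 hM) (sq_nonneg (u - 1))]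
    · have := rpow_tangent_le hw1 zero_le_one hu
      rw [Real.one_rpow] at this
      have h : u ^ (w - 1) ≤ |M| ^ (w - 1) :=
        Real.rpow_le_rpow hu (huM.trans (le_abs_self M)) (by linarith)
      have h2 : u ^ w - 1 ≤ (u - 1) * (w * |M| ^ (w - 1)) := by
        have := mul_le_mul_of_nonneg_left (mul_le_mul_of_nonneg_left h hw0)
          (sub_nonneg.mpr hu1)
        linarith
      nlinarith [mul_le_mul_of_nonneg_left h2 (sub_nonneg.mpr hu1),
        mul_nonneg hw0 (sq_nonneg (u - 1))]

theorem rpow_scale {a : ℝ} (ha : 0 < a) (z : ℝ) {y : ℝ} (hy : 0 ≤ y) :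
    y ^ z = a ^ z * (y / a) ^ z := by
  rw [← Real.mul_rpow ha.le (by positivity), mul_div_cancel₀ _ ha.ne']

theorem exists_abs_rpow_sub_tangent_le {z a M : ℝ} (hz : 0 < z) (ha : 0 < a) :
    ∃ C, 0 ≤ C ∧ ∀ y, 0 ≤ y → y ≤ M →
      |y ^ z - a ^ z - z * a ^ (z - 1) * (y - a)| ≤ C * (y - a) ^ 2 := by
  obtain ⟨C, hC, h⟩ := exists_abs_rpow_sub_tangent_le_one (M := M / a) hz
  refine ⟨a ^ z * C / a ^ 2, by positivity, fun y hy hyM => ?_⟩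
  have h1 := h (y / a) (by positivity) (by gcongr)
  have hz' : 0 < a ^ z := by positivity
  rw [rpow_scale ha z hy, Real.rpow_sub_one ha.ne']
  have e1 : a ^ z * (y / a) ^ z - a ^ z - z * (a ^ z / a) * (y - a) =
      a ^ z * ((y / a) ^ z - 1 - z * (y / a - 1)) := by field_simp
  have e2 : a ^ z * C / a ^ 2 * (y - a) ^ 2 = a ^ z * (C * (y / a - 1) ^ 2) := by field_simp
  rw [e1, e2, abs_mul, abs_of_pos hz']
  gcongr

theorem rpow_ge_second_order {p s x : ℝ} (hp0 : 0 < p) (hp1 : p ≤ 1) (hs : 0 < s) (hx : 0 ≤ x) :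
    s ^ p + p * s ^ (p - 1) * (x - s) - s ^ p / s ^ 2 * (x - s) ^ 2 ≤ x ^ p := by
  have h := rpow_ge_sub_sq hp0 hp1 (show 0 ≤ x / s by positivity)
  rw [rpow_scale hs p hx, Real.rpow_sub_one hs.ne']
  have e : s ^ p + p * (s ^ p / s) * (x - s) - s ^ p / s ^ 2 * (x - s) ^ 2 =
      s ^ p * (1 + p * (x / s - 1) - (x / s - 1) ^ 2) := by field_simp
  rw [e]
  gcongr

theorem rpow_neg_le_one {p u : ℝ} (hp0 : p < 0) (hp1 : -1 ≤ p) (hu : 0 ≤ u) :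
    u ^ p ≤ 1 + p * (u - 1) + (u - 1) ^ 2 * u ^ p := by
  rcases hu.eq_or_lt with rfl | hu
  · rw [Real.zero_rpow hp0.ne]; nlinarith
  have e : u ^ (p + 1) = u * u ^ p := by rw [Real.rpow_add_one hu.ne', mul_comm]
  have hq : 0 < u ^ p := by positivity
  suffices u ^ (p + 1) * (2 - u) ≤ 1 + p * (u - 1) by rw [e] at this; nlinarith
  rcases le_total u 2 with h2 | h2
  · have := le_rpow_tangent (z := p + 1) (by linarith) (by linarith) hu.le zero_lt_one
    simp only [Real.one_rpow, mul_one] at this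
    nlinarith [mul_le_mul_of_nonneg_right this (sub_nonneg.mpr h2), sq_nonneg (u - 1)]
  · have : 1 ≤ u ^ (p + 1) := Real.one_le_rpow (by linarith) (by linarith)
    nlinarith

theorem rpow_neg_le_second_order {p s x : ℝ} (hp0 : p < 0) (hp1 : -1 ≤ p) (hs : 0 < s)
    (hx : 0 ≤ x) :
    x ^ p ≤ s ^ p + p * s ^ (p - 1) * (x - s) + (1 / s ^ 2) * ((x - s) * x ^ p * (x - s)) := by
  have h := rpow_neg_le_one hp0 hp1 (show 0 ≤ x / s by positivity)
  rw [Real.rpow_sub_one hs.ne']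
  have e : s ^ p + p * (s ^ p / s) * (x - s) + (1 / s ^ 2) * ((x - s) * x ^ p * (x - s)) =
      s ^ p * (1 + p * (x / s - 1) + (x / s - 1) ^ 2 * (x / s) ^ p) := by
    rw [rpow_scale hs p hx]; field_simp
  rw [e]
  conv_lhs => rw [rpow_scale hs p hx]
  gcongr

theorem mul_rpow_le_tangent {p s x : ℝ} (hp : -1 ≤ p) (hp1 : p ≤ 1) (hs : 0 < s)
    (hx : 0 < x ∨ 0 < p ∧ 0 ≤ x) :
    p * x ^ p ≤ p * s ^ p + p ^ 2 * s ^ (p - 1) * (x - s) := by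
  rcases le_total 0 p with hp0 | hp0
  · have := le_rpow_tangent hp0 hp1 (hx.elim le_of_lt And.right) hs
    nlinarith
  · have hx : 0 < x := hx.resolve_right fun h => h.1.not_ge hp0
    have hu : 0 < x / s := by positivity
    have h := le_rpow_tangent (z := -p) (by linarith) (by linarith) hu.le zero_lt_one
    simp only [Real.one_rpow, mul_one, Real.rpow_neg hu.le] at h
    have hq : 0 < (x / s) ^ p := by positivity
    have h1 : 1 + p * (x / s - 1) ≤ (x / s) ^ p := by
      have := inv_mul_cancel₀ hq.ne'
      set q := (x / s) ^ p
      nlinarith [sq_nonneg (q - 1), mul_le_mul_of_nonneg_right h hq.le]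
    have e : p * s ^ p + p ^ 2 * s ^ (p - 1) * (x - s) =
        p * (s ^ p * (1 + p * (x / s - 1))) := by
      rw [Real.rpow_sub_one hs.ne']; field_simp
    rw [e, rpow_scale hs p hx.le]
    exact mul_le_mul_of_nonpos_left (mul_le_mul_of_nonneg_left h1 (by positivity)) hp0

theorem abs_one_sub_rpow_sub_one_le {p ε : ℝ} (hp : -1 ≤ p) (hp1 : p ≤ 1) (hε : 0 ≤ ε)
    (hε2 : ε ≤ 1 / 2) : |(1 - ε) ^ p - 1| ≤ 2 * ε := by
  have h0 : 0 < 1 - ε := by linarith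
  have h1 : (1 - ε) ≤ (1 - ε) ^ p := by
    simpa using Real.rpow_le_rpow_of_exponent_ge h0 (by linarith) hp1
  have h2 : (1 - ε) ^ p ≤ (1 - ε)⁻¹ := by
    rw [← Real.rpow_neg_one]
    exact Real.rpow_le_rpow_of_exponent_ge h0 (by linarith) hp
  have h3 : (1 - ε)⁻¹ ≤ 1 + 2 * ε := by
    rw [inv_le_iff_one_le_mul₀ h0]; nlinarith
  exact abs_le.mpr ⟨by linarith, by linarith⟩

end ScalarExpansion

section FirstOrder

variable {n : Type*} [Fintype n] [DecidableEq n] {A B K σ τ : Matrix n n ℂ} {u : n → ℂ}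
  {p s ε : ℝ}

theorem nonneg_matrix {A : Matrix n n ℂ} (hA : A.PosSemidef) : 0 ≤ A := by
  rwa [Matrix.le_iff, sub_zero]

theorem conj_pw_mono (hp0 : 0 < p) (hp1 : p ≤ 1) (hK : K.IsHermitian) (hA : A.PosSemidef)
    (hB : B.PosSemidef) (hAB : A ≤ B) : K * pw p A * K ≤ K * pw p B * K := by
  refine le_of_tendsto_matrix (tendsto_conj_pw_shift hp0.ne' hA (Or.inl hp0))
    (tendsto_conj_pw_shift hp0.ne' hB (Or.inl hp0)) ?_
  filter_upwards [self_mem_nhdsWithin] with η hη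
  exact conj_mono hK (pw_mono (shift_posDef hη hA) (add_le_add_left hAB _) hp0.le hp1)

theorem conj_pw_anti (hp0 : p < 0) (hp1 : -1 ≤ p) (hK : K.IsHermitian) (hA : A.PosSemidef)
    (hB : B.PosSemidef) (hAB : A ≤ B) (hKA : SuppLE K A) :
    K * pw p B * K ≤ K * pw p A * K := by
  have hKB := hKA.trans hA.1 (suppLE_of_le hA hB.1 hAB)
  refine le_of_tendsto_matrix (tendsto_conj_pw_shift hp0.ne hB (Or.inr hKB))
    (tendsto_conj_pw_shift hp0.ne hA (Or.inr hKA)) ?_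
  filter_upwards [self_mem_nhdsWithin] with η hη
  exact conj_mono hK (pw_anti (shift_posDef hη hA) (add_le_add_left hAB _) hp0.le hp1)

theorem qf_conj (hK : K.IsHermitian) (A : Matrix n n ℂ) (v : n → ℂ) :
    qf (K * A * K) v = qf A (K *ᵥ v) := by
  rw [qf_eq_ip, qf_eq_ip, ← mulVec_mulVec, ← mulVec_mulVec, ip_mulVec, hK.eq]

theorem qf_one (v : n → ℂ) : qf 1 v = ip v v := by rw [qf_eq_ip, one_mulVec]

theorem qf_smul_vec (A : Matrix n n ℂ) (c : ℝ) (v : n → ℂ) : qf A (c • v) = c ^ 2 * qf A v := by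
  rw [qf_eq_ip, mulVec_smul, ip_smul_right, ip_comm, ip_smul_right, ip_comm, ← qf_eq_ip]
  ring

theorem hfun_sub_const (hA : A.IsHermitian) (c : ℝ) :
    hfun (fun x => x - c) A = A - c • (1 : Matrix n n ℂ) := by
  have : (fun x : ℝ => x - c) = fun x => (fun y : ℝ => y) x + (fun _ => -c) x := by
    funext x; ring
  rw [this, ← hfun_add, hfun_id hA, hfun_const _ hA, neg_smul, sub_eq_add_neg]

theorem qf_affine (hA : A.IsHermitian) (hu : ip u u = 1) (a b c : ℝ) :
    qf (hfun (fun x => a + b * (x - c)) A) u = a + b * (qf A u - c) := by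
  rw [← hfun_add (fun _ => a) (fun x => b * (x - c)), hfun_const _ hA, ← hfun_smul,
    hfun_sub_const hA, qf_add, qf_smul, qf_smul, qf_sub, qf_smul, qf_one, hu]
  ring

theorem qf_sub_sq (hA : A.IsHermitian) (c : ℝ) (v : n → ℂ) :
    qf (hfun (fun x => (x - c) ^ 2) A) v =
      ip ((A - c • (1 : Matrix n n ℂ)) *ᵥ v) ((A - c • (1 : Matrix n n ℂ)) *ᵥ v) := by
  have : (fun x : ℝ => (x - c) ^ 2) = fun x => (x - c) * (x - c) := by funext x; ring
  rw [this, ← hfun_mul, hfun_sub_const hA, qf_mul_self]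
  rw [← hfun_sub_const hA]
  exact hfun_isHermitian _ _

theorem qf_hfun_le_of_kerProj (hA : A.PosSemidef) (hu : kerProj A *ᵥ u = 0) {f g : ℝ → ℝ}
    (h : ∀ x, 0 < x → f x ≤ g x) : qf (hfun f A) u ≤ qf (hfun g A) u := by
  have e : qf (hfun f A) u = qf (hfun (fun x => if x = 0 then g 0 else f x) A) u := by
    have : (fun x => if x = 0 then g 0 else f x) =
        fun x => f x + (g 0 - f 0) * (if x = 0 then 1 else 0) := by
      funext x
      by_cases hx : x = 0 <;> simp [hx]
    rw [this, ← hfun_add f (fun x => (g 0 - f 0) * (if x = 0 then 1 else 0)), ← hfun_smul, qf_add,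
      qf_smul, ← kerProj, qf_eq_ip (kerProj A), hu]
    simp [ip]
  rw [e]
  refine qf_mono (hfun_le_hfun fun hA' i => ?_) u
  have := hA.eigenvalues_nonneg i
  split_ifs with h0
  · rw [h0]
  · exact h _ (this.lt_of_ne' h0)

/-- The segment from `σ` to `τ`. -/
def segm (ε : ℝ) (σ τ : Matrix n n ℂ) : Matrix n n ℂ := (1 - ε) • σ + ε • τ

theorem segm_posSemidef (hσ : σ.PosSemidef) (hτ : τ.PosSemidef) (hε0 : 0 ≤ ε) (hε1 : ε ≤ 1) :
    (segm ε σ τ).PosSemidef :=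
  (hσ.smul (sub_nonneg.mpr hε1)).add (hτ.smul hε0)

theorem smul_le_segm (hτ : τ.PosSemidef) (hε0 : 0 ≤ ε) : (1 - ε) • σ ≤ segm ε σ τ :=
  le_add_of_nonneg_right (nonneg_matrix (hτ.smul hε0))

theorem segm_sub_mulVec (hsu : σ *ᵥ u = s • u) :
    (segm ε σ τ - s • (1 : Matrix n n ℂ)) *ᵥ u = ε • ((τ - σ) *ᵥ u) := by
  simp only [segm, sub_mulVec, add_mulVec, smul_mulVec, hsu, one_mulVec, sub_smul, smul_sub,
    one_smul]
  abel

theorem qf_segm_sub (hu : ip u u = 1) (hsu : σ *ᵥ u = s • u) :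
    qf (segm ε σ τ) u - s = ε * (qf τ u - s) := by
  have h : qf σ u = s := by rw [qf_eq_ip, hsu, ip_smul_right, hu, mul_one]
  rw [segm, qf_add, qf_smul, qf_smul, h]
  ring

theorem qf_pw_segm_ge_of_pos (hp0 : 0 < p) (hp1 : p ≤ 1) (hσ : σ.PosSemidef) (hτ : τ.PosSemidef)
    (hu : ip u u = 1) (hsu : σ *ᵥ u = s • u) (hs : 0 < s) (hε0 : 0 ≤ ε) (hε1 : ε ≤ 1) :
    s ^ p + p * s ^ (p - 1) * (ε * (qf τ u - s)) -
      s ^ p / s ^ 2 * ip ((τ - σ) *ᵥ u) ((τ - σ) *ᵥ u) * ε ^ 2 ≤ qf (pw p (segm ε σ τ)) u := by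
  have hX := segm_posSemidef hσ hτ hε0 hε1
  have h : qf (hfun (fun x => (s ^ p + p * s ^ (p - 1) * (x - s)) +
      (-(s ^ p / s ^ 2)) * (x - s) ^ 2) (segm ε σ τ)) u ≤ qf (pw p (segm ε σ τ)) u := by
    refine qf_mono (hfun_le_hfun fun hA i => ?_) u
    have := rpow_ge_second_order hp0 hp1 hs (hX.eigenvalues_nonneg i)
    linarith
  rw [← hfun_add (fun x => s ^ p + p * s ^ (p - 1) * (x - s)), qf_add, qf_affine hX.1 hu,
    ← hfun_smul, qf_smul, qf_sub_sq hX.1, qf_segm_sub hu hsu, segm_sub_mulVec hsu,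
    ip_smul_right, ip_comm, ip_smul_right] at h
  linarith

theorem suppLE_sub_add (hσ : σ.PosSemidef) (hτ : τ.PosSemidef) {c : ℝ} (hc : 0 < c) :
    SuppLE (τ - σ) (c • (σ + τ)) := by
  have hH : (c • (σ + τ)).PosSemidef := (hσ.add hτ).smul hc.le
  have h1 : SuppLE σ (c • (σ + τ)) := by
    rw [← suppLE_smul hc.ne', smul_add]
    exact suppLE_of_le (hσ.smul hc.le) (smul_add c σ τ ▸ hH.1)
      (le_add_of_nonneg_right (nonneg_matrix (hτ.smul hc.le)))
  have h2 : SuppLE τ (c • (σ + τ)) := by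
    rw [← suppLE_smul hc.ne', smul_add]
    exact suppLE_of_le (hτ.smul hc.le) (smul_add c σ τ ▸ hH.1)
      (le_add_of_nonneg_left (nonneg_matrix (hσ.smul hc.le)))
  rw [SuppLE, Matrix.sub_mul, h1, h2, sub_zero]

theorem qf_pw_segm_le_of_neg (hp0 : p < 0) (hp1 : -1 ≤ p) (hσ : σ.PosSemidef) (hτ : τ.PosSemidef)
    (hu : ip u u = 1) (hsu : σ *ᵥ u = s • u) (hs : 0 < s) (hε0 : 0 < ε) (hε1 : ε ≤ 1 / 2) :
    qf (pw p (segm ε σ τ)) u ≤ s ^ p + p * s ^ (p - 1) * (ε * (qf τ u - s)) +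
      1 / s ^ 2 * (ε ^ 2 * ((ε / 2) ^ p * qf (pw p (σ + τ)) ((τ - σ) *ᵥ u))) := by
  have hX := segm_posSemidef hσ hτ hε0.le (hε1.trans (by norm_num))
  have h : qf (pw p (segm ε σ τ)) u ≤ qf (hfun (fun x => (s ^ p + p * s ^ (p - 1) * (x - s)) +
      1 / s ^ 2 * ((x - s) * x ^ p * (x - s))) (segm ε σ τ)) u := by
    refine qf_mono (hfun_le_hfun fun hA i => ?_) u
    exact rpow_neg_le_second_order hp0 hp1 hs (hX.eigenvalues_nonneg i)
  have hB : (segm ε σ τ - s • (1 : Matrix n n ℂ)).IsHermitian := by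
    rw [← hfun_sub_const hX.1]
    exact hfun_isHermitian _ _
  rw [← hfun_add (fun x => s ^ p + p * s ^ (p - 1) * (x - s)), qf_add, qf_affine hX.1 hu,
    ← hfun_smul, qf_smul, ← hfun_mul (fun x => (x - s) * x ^ p), ← hfun_mul (fun x => x - s),
    hfun_sub_const hX.1, qf_conj hB, qf_segm_sub hu hsu, segm_sub_mulVec hsu, qf_smul_vec] at h
  refine h.trans ?_
  gcongr
  have hJ : (τ - σ).IsHermitian := hτ.1.sub hσ.1
  have hC : ((ε / 2) • (σ + τ)).PosSemidef := (hσ.add hτ).smul (by positivity)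
  have hle : (ε / 2) • (σ + τ) ≤ segm ε σ τ := by
    rw [Matrix.le_iff, segm]
    have : (1 - ε) • σ + ε • τ - (ε / 2) • (σ + τ) = (1 - 3 / 2 * ε) • σ + (ε / 2) • τ := by
      module
    rw [this]
    exact (hσ.smul (by linarith)).add (hτ.smul (by positivity))
  have h2 := qf_mono (conj_pw_anti hp0 hp1 hJ hC hX hle (suppLE_sub_add hσ hτ (by positivity))) u
  rw [qf_conj hJ, qf_conj hJ, pw_smul (by positivity) p (hσ.add hτ), qf_smul] at h2
  exact h2

theorem exists_qf_pw_segm_ge (hp0 : p ≠ 0) (hp : -1 ≤ p) (hp1 : p ≤ 1) (hσ : σ.PosSemidef)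
    (hτ : τ.PosSemidef) (hu : ip u u = 1) (hsu : σ *ᵥ u = s • u) (hs : 0 < s) :
    ∃ C, 0 ≤ C ∧ ∀ ε, 0 < ε → ε ≤ 1 / 2 →
      p * s ^ p + p ^ 2 * s ^ (p - 1) * (ε * (qf τ u - s)) - C * (ε * ε ^ (min 1 (1 + p))) ≤
        p * qf (pw p (segm ε σ τ)) u := by
  rcases hp0.lt_or_gt with hp0 | hp0
  · refine ⟨-p * (1 / s ^ 2) * ((1 / 2) ^ p * qf (pw p (σ + τ)) ((τ - σ) *ᵥ u)), ?_,
      fun ε hε0 hε1 => ?_⟩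
    · have := qf_nonneg (pw_posSemidef p (hσ.add hτ)) ((τ - σ) *ᵥ u)
      have : 0 ≤ -p := by linarith
      positivity
    · have h := qf_pw_segm_le_of_neg hp0 hp hσ hτ hu hsu hs hε0 hε1
      rw [min_eq_right (by linarith), Real.rpow_add hε0, Real.rpow_one]
      rw [div_eq_mul_one_div ε 2, Real.mul_rpow hε0.le (by norm_num)] at h
      have := mul_le_mul_of_nonpos_left h hp0.le
      linarith
  · refine ⟨p * (s ^ p / s ^ 2 * ip ((τ - σ) *ᵥ u) ((τ - σ) *ᵥ u)), ?_, fun ε hε0 hε1 => ?_⟩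
    · have := ip_self_nonneg ((τ - σ) *ᵥ u)
      positivity
    · have h := qf_pw_segm_ge_of_pos hp0 hp1 hσ hτ hu hsu hs hε0.le (hε1.trans (by norm_num))
      rw [min_eq_left (by linarith), Real.rpow_one]
      have := mul_le_mul_of_nonneg_left h hp0.le
      linarith

theorem qf_pw_segm_le (hp : -1 ≤ p) (hp1 : p ≤ 1) (hσ : σ.PosSemidef)
    (hτ : τ.PosSemidef) (hu : ip u u = 1) (hsu : σ *ᵥ u = s • u) (hs : 0 < s) (hε0 : 0 ≤ ε)
    (hε1 : ε ≤ 1 / 2) : p * qf (pw p (segm ε σ τ)) u ≤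
      p * s ^ p + p ^ 2 * s ^ (p - 1) * (ε * (qf τ u - s)) := by
  have hX := segm_posSemidef hσ hτ hε0 (hε1.trans (by norm_num))
  have hle : (1 - ε) • σ ≤ segm ε σ τ := smul_le_segm hτ hε0
  have hsupp : SuppLE σ (segm ε σ τ) := by
    rw [← suppLE_smul (show 1 - ε ≠ 0 by linarith)]
    exact suppLE_of_le (hσ.smul (by linarith)) hX.1 hle
  have hker : kerProj (segm ε σ τ) *ᵥ u = 0 := by
    have h := congrArg conjTranspose hsupp
    rw [conjTranspose_mul, (kerProj_isHermitian _).eq, hσ.1.eq, conjTranspose_zero] at h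
    have h2 : kerProj (segm ε σ τ) *ᵥ (σ *ᵥ u) = 0 := by rw [mulVec_mulVec, h, zero_mulVec]
    rw [hsu, mulVec_smul] at h2
    exact (smul_eq_zero.mp h2).resolve_left hs.ne'
  have h := qf_hfun_le_of_kerProj hX hker (f := fun x => p * x ^ p)
    (g := fun x => p * s ^ p + p ^ 2 * s ^ (p - 1) * (x - s))
    fun x hx => mul_rpow_le_tangent hp hp1 hs (Or.inl hx)
  rwa [← hfun_smul, qf_smul, qf_affine hX.1 hu, qf_segm_sub hu hsu] at h

end FirstOrder

section Eigenbasis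

variable {n : Type*} [Fintype n] [DecidableEq n] {U K A σ τ : Matrix n n ℂ} {c k s : n → ℝ}

/-- The columns of the unitary `U` are eigenvectors of `A` with eigenvalues `c`. -/
structure IsEigenbasis (U A : Matrix n n ℂ) (c : n → ℝ) : Prop where
  orth : Uᴴ * U = 1
  eig : A * U = U * diagonal (fun i => (c i : ℂ))

theorem mul_col (A U : Matrix n n ℂ) (i : n) : A *ᵥ U.col i = (A * U).col i := by
  rw [← mulVec_single_one, ← mulVec_single_one, mulVec_mulVec]

theorem ip_col (hU : Uᴴ * U = 1) (i : n) : ip (U.col i) (U.col i) = 1 := by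
  rw [← mulVec_single_one, ip_mulVec, mulVec_mulVec, hU, one_mulVec]
  simp [ip]

theorem rtr_eq_sum_qf (hU : Uᴴ * U = 1) (M : Matrix n n ℂ) : rtr M = ∑ i, qf M (U.col i) := by
  have h1 : rtr M = rtr (Uᴴ * (M * U)) := by
    rw [rtr_mul_comm, Matrix.mul_assoc, mul_eq_one_comm.mp hU, Matrix.mul_one]
  rw [h1, rtr, trace, Complex.re_sum]
  refine Finset.sum_congr rfl fun i _ => ?_
  rw [qf, mul_col, diag_apply, Matrix.mul_apply]
  rfl

theorem IsEigenbasis.mulVec_col (h : IsEigenbasis U A c) (i : n) :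
    A *ᵥ U.col i = c i • U.col i := by
  rw [mul_col, h.eig]
  ext x
  simp [Matrix.mul_diagonal, mul_comm]

theorem IsEigenbasis.qf_col (h : IsEigenbasis U A c) (i : n) : qf A (U.col i) = c i := by
  rw [qf_eq_ip, h.mulVec_col, ip_smul_right, ip_col h.orth, mul_one]

theorem IsEigenbasis.nonneg (h : IsEigenbasis U A c) (hA : A.PosSemidef) (i : n) : 0 ≤ c i :=
  h.qf_col i ▸ qf_nonneg hA _

theorem IsEigenbasis.power (h : IsEigenbasis U A c) (hA : A.IsHermitian) (p : ℝ) :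
    IsEigenbasis U (pw p A) (fun i => c i ^ p) := by
  refine ⟨h.orth, ?_⟩
  have hD : (diagonal (fun i => (c i : ℂ))).IsHermitian := by
    simp [Matrix.IsHermitian, diagonal_conjTranspose, Pi.star_def]
  have := hfun_intertwine (fun x => x ^ p) hA hD h.eig
  rwa [hfun_diagonal] at this

theorem IsEigenbasis.conj (h : IsEigenbasis U A c) (hK : IsEigenbasis U K k) :
    IsEigenbasis U (K * A * K) (fun i => k i ^ 2 * c i) := by
  refine ⟨h.orth, ?_⟩
  rw [Matrix.mul_assoc, hK.eig, Matrix.mul_assoc, ← Matrix.mul_assoc A, h.eig,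
    Matrix.mul_assoc U, ← Matrix.mul_assoc K, hK.eig, Matrix.mul_assoc, diagonal_mul_diagonal,
    diagonal_mul_diagonal]
  congr 2
  funext i
  push_cast
  ring

theorem IsEigenbasis.smul (h : IsEigenbasis U A c) (r : ℝ) :
    IsEigenbasis U (r • A) (fun i => r * c i) := by
  refine ⟨h.orth, ?_⟩
  rw [Matrix.smul_mul, h.eig, ← Matrix.mul_smul]
  congr 1
  ext i j
  by_cases hij : i = j <;> simp [hij]

theorem IsEigenbasis.rtr_eq (h : IsEigenbasis U A c) : rtr A = ∑ i, c i := by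
  rw [rtr_eq_sum_qf h.orth]
  exact Finset.sum_congr rfl fun i _ => h.qf_col i

theorem IsEigenbasis.traceFun_eq (h : IsEigenbasis U A c) (hA : A.IsHermitian)
    (hK : IsEigenbasis U K k) (hKH : K.IsHermitian) (p z : ℝ) :
    traceFun p z K A = ∑ i, (k i ^ 2 * c i ^ p) ^ z :=
  (((h.power hA p).conj hK).power (conj_pw_isHermitian hKH p A) z).rtr_eq

theorem qf_conj_col (hK : IsEigenbasis U K k) (hKH : K.IsHermitian) (i : n) :
    qf (K * A * K) (U.col i) = k i ^ 2 * qf A (U.col i) := by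
  rw [qf_conj hKH, hK.mulVec_col, qf_smul_vec]

end Eigenbasis

section SecondOrder

variable {n : Type*} [Fintype n] [DecidableEq n] {U K σ τ Y : Matrix n n ℂ} {k s : n → ℝ}
  {p z : ℝ}

theorem qf_mul_self_le (hY : Y.PosSemidef) (v : n → ℂ) :
    qf (Y * Y) v ≤ rtr Y ^ 2 * ip v v := by
  have h1 := conj_mono (pw_isHermitian (1 / 2) Y) (le_rtr_smul_one hY)
  have hR : pw (1 / 2) Y * pw (1 / 2) Y = Y := by
    rw [pw_mul_posSemidef (by norm_num) (by norm_num) hY, add_halves, pw_one hY.1]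
  have hRY : pw (1 / 2) Y * Y * pw (1 / 2) Y = Y * Y := by
    have aux : ∀ R : Matrix n n ℂ, R * R = Y → R * Y * R = Y * Y := by
      rintro R rfl
      simp only [Matrix.mul_assoc]
    exact aux _ hR
  rw [hRY, Matrix.mul_smul, Matrix.smul_mul, Matrix.mul_one, hR] at h1
  have h2 := qf_mono h1 v
  have h3 := qf_mono (le_rtr_smul_one hY) v
  rw [qf_smul] at h2
  rw [qf_smul, qf_one] at h3
  have := mul_le_mul_of_nonneg_left h3 (rtr_nonneg hY)
  nlinarith

theorem ip_add_self_le (x y : n → ℂ) : ip (x + y) (x + y) ≤ 2 * ip x x + 2 * ip y y := by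
  have := two_ip_le x y
  rw [ip_add_right, ip_comm, ip_comm (x + y), ip_add_right, ip_add_right, ip_comm y x]
  linarith

theorem eigenvalues_le_rtr (hY : Y.PosSemidef) (i : n) : hY.1.eigenvalues i ≤ rtr Y := by
  have e := rtr_hfun (fun x => x) hY.1
  rw [hfun_id hY.1] at e
  rw [e]
  exact Finset.single_le_sum (fun j _ => hY.eigenvalues_nonneg j) (Finset.mem_univ i)

theorem exists_qf_pw_ge (hz : 0 < z) {a M : ℝ} (ha : 0 < a) (q : ℝ) :
    ∃ C, 0 ≤ C ∧ ∀ (Y : Matrix n n ℂ) (u : n → ℂ), Y.PosSemidef → rtr Y ≤ M → ip u u = 1 →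
      q * a ^ z + z * a ^ (z - 1) * (q * (qf Y u - a)) -
        C * ip ((Y - a • (1 : Matrix n n ℂ)) *ᵥ u) ((Y - a • (1 : Matrix n n ℂ)) *ᵥ u) ≤
      q * qf (pw z Y) u := by
  obtain ⟨C, hC, h⟩ := exists_abs_rpow_sub_tangent_le (M := M) hz ha
  refine ⟨|q| * C, by positivity, fun Y u hY hM hu => ?_⟩
  have key : qf (hfun (fun x => (q * a ^ z + (q * (z * a ^ (z - 1))) * (x - a)) +
      (-(|q| * C)) * (x - a) ^ 2) Y) u ≤ qf (hfun (fun x => q * x ^ z) Y) u := by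
    refine qf_mono (hfun_le_hfun fun hA i => ?_) u
    set x := hA.eigenvalues i
    have h1 := h x (hY.eigenvalues_nonneg i) ((eigenvalues_le_rtr hY i).trans hM)
    have h2 : |q * (x ^ z - a ^ z - z * a ^ (z - 1) * (x - a))| ≤ |q| * (C * (x - a) ^ 2) := by
      rw [abs_mul]
      gcongr
    have := (abs_le.mp h2).1
    linarith
  rw [← hfun_add (fun x => q * a ^ z + (q * (z * a ^ (z - 1))) * (x - a)), qf_add,
    qf_affine hY.1 hu, ← hfun_smul, ← hfun_smul, qf_smul, qf_smul, qf_sub_sq hY.1, ← pw] at key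
  linarith

end SecondOrder

section FirstOrder

variable {n : Type*} [Fintype n] [DecidableEq n] {U K σ τ : Matrix n n ℂ} {k s : n → ℝ}
  {p z ε : ℝ}

theorem IsEigenbasis.qf_pw_conj_segm_le (hU : IsEigenbasis U σ s) (hKU : IsEigenbasis U K k)
    (hKH : K.IsHermitian) (hσ : σ.PosSemidef) (hτ : τ.PosSemidef) (hp : -1 ≤ p) (hp1 : p ≤ 1)
    (hks : ∀ i, k i ≠ 0 → 0 < s i) (hε0 : 0 ≤ ε) (hε1 : ε ≤ 1 / 2) (i : n) :
    p * qf (K * pw p (segm ε σ τ) * K) (U.col i) ≤ p * (k i ^ 2 * s i ^ p) +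
      p ^ 2 * (k i ^ 2 * s i ^ (p - 1)) * (ε * (qf τ (U.col i) - s i)) := by
  rw [qf_conj_col hKU hKH]
  rcases eq_or_ne (k i) 0 with h0 | h0
  · simp [h0]
  · have := mul_le_mul_of_nonneg_left (qf_pw_segm_le hp hp1 hσ hτ (ip_col hU.orth i)
      (hU.mulVec_col i) (hks i h0) hε0 hε1) (sq_nonneg (k i))
    linarith

theorem IsEigenbasis.exists_qf_pw_conj_segm_ge (hU : IsEigenbasis U σ s)
    (hKU : IsEigenbasis U K k) (hKH : K.IsHermitian) (hσ : σ.PosSemidef) (hτ : τ.PosSemidef)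
    (hp0 : p ≠ 0) (hp : -1 ≤ p) (hp1 : p ≤ 1) (hks : ∀ i, k i ≠ 0 → 0 < s i) (i : n) :
    ∃ C, 0 ≤ C ∧ ∀ ε, 0 < ε → ε ≤ 1 / 2 → p * (k i ^ 2 * s i ^ p) +
      p ^ 2 * (k i ^ 2 * s i ^ (p - 1)) * (ε * (qf τ (U.col i) - s i)) -
      C * (ε * ε ^ (min 1 (1 + p))) ≤ p * qf (K * pw p (segm ε σ τ) * K) (U.col i) := by
  rcases eq_or_ne (k i) 0 with h0 | h0
  · refine ⟨0, le_rfl, fun ε _ _ => ?_⟩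
    rw [qf_conj_col hKU hKH]
    simp [h0]
  · obtain ⟨C, hC, h⟩ := exists_qf_pw_segm_ge hp0 hp hp1 hσ hτ (ip_col hU.orth i)
      (hU.mulVec_col i) (hks i h0)
    refine ⟨k i ^ 2 * C, by positivity, fun ε hε0 hε1 => ?_⟩
    rw [qf_conj_col hKU hKH]
    have := mul_le_mul_of_nonneg_left (h ε hε0 hε1) (sq_nonneg (k i))
    linarith

theorem smul_conj_pw_segm_le (hσ : σ.PosSemidef) (hτ : τ.PosSemidef) (hKH : K.IsHermitian)
    (hp0 : p ≠ 0) (hp : -1 ≤ p) (hp1 : p ≤ 1) (hK : 0 < p ∨ SuppLE K σ) (hε0 : 0 ≤ ε)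
    (hε1 : ε ≤ 1 / 2) :
    (p • (K * pw p (segm ε σ τ) * K) - (p * (1 - ε) ^ p) • (K * pw p σ * K)).PosSemidef := by
  have h1 : 0 < 1 - ε := by linarith
  have hX := segm_posSemidef hσ hτ hε0 (hε1.trans (by norm_num))
  have hle : (1 - ε) • σ ≤ segm ε σ τ := smul_le_segm hτ hε0
  have e : (p * (1 - ε) ^ p) • (K * pw p σ * K) = p • (K * pw p ((1 - ε) • σ) * K) := by
    rw [pw_smul h1.le p hσ, Matrix.mul_smul, Matrix.smul_mul, smul_smul]
  rw [e, ← smul_sub]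
  rcases hp0.lt_or_gt with h | h
  · have hK' : SuppLE K ((1 - ε) • σ) := by
      have h2 := hK.resolve_left h.not_gt
      refine h2.trans hσ.1 ((suppLE_smul h1.ne').mp ?_)
      exact suppLE_of_le (hσ.smul h1.le) (hσ.smul h1.le).1 le_rfl
    have := Matrix.le_iff.mp (conj_pw_anti h hp hKH (hσ.smul h1.le) hX hle hK')
    have := this.smul (neg_nonneg.mpr h.le)
    rwa [← neg_sub, smul_neg, neg_smul, neg_neg] at this
  · exact (Matrix.le_iff.mp (conj_pw_mono h hp1 hKH (hσ.smul h1.le) hX hle)).smul h.le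

theorem IsEigenbasis.exists_conj_pw_segm_bounds (hU : IsEigenbasis U σ s)
    (hKU : IsEigenbasis U K k) (hKH : K.IsHermitian) (hσ : σ.PosSemidef) (hτ : τ.PosSemidef)
    (hp0 : p ≠ 0) (hp : -1 ≤ p) (hp1 : p ≤ 1) (hK : 0 < p ∨ SuppLE K σ)
    (hks : ∀ i, k i ≠ 0 → 0 < s i) :
    ∃ M C, 0 ≤ C ∧ ∀ ε, 0 < ε → ε ≤ 1 / 2 → rtr (K * pw p (segm ε σ τ) * K) ≤ M ∧
      ∀ i, ip ((K * pw p (segm ε σ τ) * K - (k i ^ 2 * s i ^ p) • (1 : Matrix n n ℂ)) *ᵥ U.col i)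
        ((K * pw p (segm ε σ τ) * K - (k i ^ 2 * s i ^ p) • (1 : Matrix n n ℂ)) *ᵥ U.col i) ≤
        C * ε ^ 2 := by
  set a : n → ℝ := fun i => k i ^ 2 * s i ^ p with ha
  have ha0 : ∀ i, 0 ≤ a i := fun i => by
    have := hU.nonneg hσ i
    positivity
  set L : n → ℝ := fun i => 2 * |p| * a i +
    p ^ 2 * (k i ^ 2 * s i ^ (p - 1)) * |qf τ (U.col i) - s i| with hL
  have hL0 : ∀ i, 0 ≤ L i := fun i => by
    have := hU.nonneg hσ i
    have := ha0 i
    positivity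
  have hpabs : 0 < |p| := abs_pos.mpr hp0
  have hB : IsEigenbasis U (K * pw p σ * K) a := (hU.power hσ.1 p).conj hKU
  have hA0 : 0 ≤ ∑ i, a i := Finset.sum_nonneg fun i _ => ha0 i
  refine ⟨(∑ i, L i) / |p| + 2 * ∑ i, a i,
    (2 * (∑ i, L i) ^ 2 + 8 * p ^ 2 * (∑ i, a i) ^ 2) / p ^ 2, by positivity,
    fun ε hε0 hε1 => ?_⟩
  set Y := K * pw p (segm ε σ τ) * K with hY
  have hN := smul_conj_pw_segm_le (ε := ε) hσ hτ hKH hp0 hp hp1 hK hε0.le hε1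
  set N := p • Y - (p * (1 - ε) ^ p) • (K * pw p σ * K) with hNdef
  have hdev := abs_le.mp (abs_one_sub_rpow_sub_one_le hp hp1 hε0.le hε1)
  have hqN : ∀ i, qf N (U.col i) ≤ L i * ε := fun i => by
    have h1 := hU.qf_pw_conj_segm_le hKU hKH hσ hτ hp hp1 hks hε0.le hε1 i
    rw [hNdef, qf_sub, qf_smul, qf_smul, hB.qf_col]
    have h2 : p * a i * (1 - (1 - ε) ^ p) ≤ 2 * |p| * a i * ε := by
      have : p * (1 - (1 - ε) ^ p) ≤ |p| * (2 * ε) := by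
        refine (le_abs_self _).trans ?_
        rw [abs_mul]
        gcongr
        rw [abs_sub_comm]
        exact abs_le.mpr hdev
      have := mul_le_mul_of_nonneg_left this (ha0 i)
      linarith
    have h3 : p ^ 2 * (k i ^ 2 * s i ^ (p - 1)) * (ε * (qf τ (U.col i) - s i)) ≤
        p ^ 2 * (k i ^ 2 * s i ^ (p - 1)) * |qf τ (U.col i) - s i| * ε := by
      have hsi := hU.nonneg hσ i
      have h4 : 0 ≤ p ^ 2 * (k i ^ 2 * s i ^ (p - 1)) := by positivity
      have := mul_le_mul_of_nonneg_left (mul_le_mul_of_nonneg_left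
        (le_abs_self (qf τ (U.col i) - s i)) hε0.le) h4
      linarith
    simp only [hL]
    have : a i = k i ^ 2 * s i ^ p := rfl
    rw [← this] at h1
    linarith
  have hrN : rtr N ≤ (∑ i, L i) * ε := by
    rw [rtr_eq_sum_qf hU.orth, Finset.sum_mul]
    exact Finset.sum_le_sum fun i _ => hqN i
  have hrN0 : 0 ≤ rtr N := rtr_nonneg hN
  have hL1 : 0 ≤ ∑ i, L i := Finset.sum_nonneg fun i _ => hL0 i
  refine ⟨?_, fun i => ?_⟩
  · have e : p * rtr Y = rtr N + p * (1 - ε) ^ p * ∑ i, a i := by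
      rw [hNdef, rtr_sub, rtr_smul, rtr_smul, hB.rtr_eq]
      ring
    have h1 : |p| * rtr Y ≤ (∑ i, L i) + |p| * (2 * ∑ i, a i) := by
      rcases abs_cases p with ⟨h, _⟩ | ⟨h, h'⟩
      · rw [h, e]
        have : (1 - ε) ^ p * ∑ i, a i ≤ 2 * ∑ i, a i := by gcongr; linarith
        have hp' : 0 ≤ p := by linarith [abs_nonneg p]
        have := mul_le_mul_of_nonneg_left this hp'
        nlinarith
      · have hYp : |p| * rtr Y = -(rtr N) + |p| * ((1 - ε) ^ p * ∑ i, a i) := by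
          rw [h]
          linarith
        rw [hYp]
        have : (1 - ε) ^ p * ∑ i, a i ≤ 2 * ∑ i, a i := by gcongr; linarith
        have := mul_le_mul_of_nonneg_left this hpabs.le
        linarith
    have : (∑ i, L i) / |p| + 2 * ∑ i, a i = ((∑ i, L i) + |p| * (2 * ∑ i, a i)) / |p| := by
      field_simp
    rw [this, le_div_iff₀ hpabs]
    linarith
  · set u := U.col i
    have hu : ip u u = 1 := ip_col hU.orth i
    have e : p • ((Y - a i • (1 : Matrix n n ℂ)) *ᵥ u) =
        N *ᵥ u + (p * a i * ((1 - ε) ^ p - 1)) • u := by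
      have : p • Y = N + (p * (1 - ε) ^ p) • (K * pw p σ * K) := by rw [hNdef]; abel
      rw [← smul_mulVec, smul_sub, this, sub_mulVec, add_mulVec, smul_mulVec, hB.mulVec_col,
        smul_mulVec, smul_mulVec, one_mulVec, smul_smul, smul_smul, add_sub_assoc, ← sub_smul]
      congr 2
      ring
    have h1 := ip_add_self_le (N *ᵥ u) ((p * a i * ((1 - ε) ^ p - 1)) • u)
    have hNu : ip (N *ᵥ u) (N *ᵥ u) ≤ ((∑ i, L i) * ε) ^ 2 := by
      rw [← qf_mul_self hN.1]
      refine (qf_mul_self_le hN u).trans ?_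
      rw [hu, mul_one]
      gcongr
    rw [← e, ip_smul_right, ip_comm, ip_smul_right, ip_smul_right, ip_comm _ u, ip_smul_right,
      hu] at h1
    have h2 : (p * a i * ((1 - ε) ^ p - 1)) ^ 2 ≤ p ^ 2 * (∑ i, a i) ^ 2 * (4 * ε ^ 2) := by
      rw [mul_pow, mul_pow]
      have h3 : ((1 - ε) ^ p - 1) ^ 2 ≤ 4 * ε ^ 2 := by
        rw [show 4 * ε ^ 2 = (2 * ε) ^ 2 by ring]
        exact sq_le_sq' hdev.1 hdev.2
      have h4 : a i ≤ ∑ i, a i := Finset.single_le_sum (fun j _ => ha0 j) (Finset.mem_univ i)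
      have := ha0 i
      gcongr
    rw [div_mul_eq_mul_div, le_div_iff₀ (by positivity)]
    nlinarith

/-- First-order optimality condition: if `σ` maximizes `p * traceFun p z K` along the segment from
`σ` to `τ`, and `σ` commutes with `K`, then the directional derivative at `σ` is nonpositive. -/
theorem IsEigenbasis.sum_derivative_le (hU : IsEigenbasis U σ s)
    (hKU : IsEigenbasis U K k) (hKH : K.IsHermitian) (hσ : σ.PosSemidef) (hτ : τ.PosSemidef)
    (hp0 : p ≠ 0) (hp : -1 < p) (hp1 : p ≤ 1) (hz : 0 < z) (hK : 0 < p ∨ SuppLE K σ)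
    (hks : ∀ i, k i ≠ 0 → 0 < s i)
    (hopt : ∀ ε, 0 < ε → ε ≤ 1 / 2 →
      p * traceFun p z K (segm ε σ τ) ≤ p * traceFun p z K σ) :
    ∑ i, (k i ^ 2 * s i ^ p) ^ (z - 1) * (k i ^ 2 * s i ^ (p - 1)) *
      (qf τ (U.col i) - s i) ≤ 0 := by
  obtain ⟨M, C₁, hC₁, hb⟩ := hU.exists_conj_pw_segm_bounds hKU hKH hσ hτ hp0 hp.le hp1 hK hks
  set a : n → ℝ := fun i => k i ^ 2 * s i ^ p with ha
  set g : n → ℝ := fun i => a i ^ (z - 1) * (k i ^ 2 * s i ^ (p - 1)) *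
    (qf τ (U.col i) - s i) with hg
  set θ := min 1 (1 + p) with hθ
  have hθ0 : 0 < θ := lt_min one_pos (by linarith)
  have key : ∀ i, ∃ C, 0 ≤ C ∧ ∀ ε, 0 < ε → ε ≤ 1 / 2 →
      p * a i ^ z + z * p ^ 2 * g i * ε - C * (ε * ε ^ θ) ≤
        p * qf (pw z (K * pw p (segm ε σ τ) * K)) (U.col i) := by
    intro i
    rcases eq_or_ne (k i) 0 with h0 | h0
    · refine ⟨0, le_rfl, fun ε hε0 hε1 => ?_⟩
      have hz0 : (K * pw p (segm ε σ τ) * K) * replicateCol Unit (U.col i) = 0 := by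
        rw [Matrix.mul_assoc]
        have : K * replicateCol Unit (U.col i) = 0 := by
          rw [← replicateCol_mulVec, hKU.mulVec_col, h0, zero_smul]
          rfl
        rw [this, Matrix.mul_zero]
      have h1 := pw_mul_eq_zero hz.ne' (conj_pw_isHermitian hKH p (segm ε σ τ)) hz0
      rw [← replicateCol_mulVec] at h1
      have h2 : pw z (K * pw p (segm ε σ τ) * K) *ᵥ U.col i = 0 :=
        replicateCol_injective (ι := Unit) (h1.trans rfl)
      rw [qf_eq_ip, h2]
      simp [hg, ha, h0, ip, Real.zero_rpow hz.ne']
    · obtain ⟨C₂, hC₂, h2⟩ := hU.exists_qf_pw_conj_segm_ge hKU hKH hσ hτ hp0 hp.le hp1 hks i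
      have hai : 0 < a i := by
        have := hks i h0
        positivity
      obtain ⟨C₃, hC₃, h3⟩ := exists_qf_pw_ge (n := n) (M := M) hz hai p
      refine ⟨z * a i ^ (z - 1) * C₂ + C₃ * C₁, by positivity, fun ε hε0 hε1 => ?_⟩
      have hY : (K * pw p (segm ε σ τ) * K).PosSemidef :=
        conj_posSemidef hKH (pw_posSemidef p (segm_posSemidef hσ hτ hε0.le (by linarith)))
      have h4 := h3 _ (U.col i) hY (hb ε hε0 hε1).1 (ip_col hU.orth i)
      have h5 := mul_le_mul_of_nonneg_left ((hb ε hε0 hε1).2 i) hC₃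
      have h6 := h2 ε hε0 hε1
      have h7 : 0 ≤ z * a i ^ (z - 1) := by positivity
      have h8 : ε ^ 2 ≤ ε * ε ^ θ := by
        rw [sq]
        gcongr
        simpa using Real.rpow_le_rpow_of_exponent_ge hε0 (by linarith) (min_le_left 1 (1 + p))
      have h9 := mul_le_mul_of_nonneg_left h8 (mul_nonneg hC₃ hC₁)
      have h10 := mul_le_mul_of_nonneg_left h6 h7
      simp only [hg]
      simp only [ha] at h4 h5 h9 h10 ⊢
      linarith
  choose C hC hkey using key
  have hineq : ∀ ε, 0 < ε → ε ≤ 1 / 2 → z * p ^ 2 * ∑ i, g i ≤ (∑ i, C i) * ε ^ θ := by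
    intro ε hε0 hε1
    have h1 := Finset.sum_le_sum fun i (_ : i ∈ Finset.univ) => hkey i ε hε0 hε1
    have h2 := hopt ε hε0 hε1
    rw [hU.traceFun_eq hσ.1 hKU hKH, traceFun, rtr_eq_sum_qf hU.orth, Finset.mul_sum,
      Finset.mul_sum] at h2
    have h3 := h1.trans h2
    rw [Finset.sum_sub_distrib, Finset.sum_add_distrib, ← Finset.sum_mul, ← Finset.sum_mul,
      ← Finset.mul_sum, ← Finset.mul_sum] at h3
    have h4 : ε * (z * p ^ 2 * ∑ i, g i) ≤ ε * ((∑ i, C i) * ε ^ θ) := by linarith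
    exact le_of_mul_le_mul_left h4 hε0
  have hlim : Tendsto (fun ε : ℝ => (∑ i, C i) * ε ^ θ) (nhdsWithin 0 (Ioi 0)) (nhds 0) := by
    have : Tendsto (fun ε : ℝ => (∑ i, C i) * ε ^ θ) (nhds 0) (nhds ((∑ i, C i) * 0 ^ θ)) :=
      ((Real.continuousAt_rpow_const 0 θ (Or.inr hθ0.le)).tendsto).const_mul _
    rw [Real.zero_rpow hθ0.ne', mul_zero] at this
    exact this.mono_left nhdsWithin_le_nhds
  have h0 : z * p ^ 2 * ∑ i, g i ≤ 0 := by
    refine ge_of_tendsto hlim ?_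
    filter_upwards [Ioc_mem_nhdsGT (show (0 : ℝ) < 1 / 2 by norm_num)] with ε hε
    exact hineq ε hε.1 hε.2
  have : 0 < z * p ^ 2 := by positivity
  exact nonpos_of_mul_nonpos_right h0 this

end FirstOrder

section Optimizer

variable {n : Type*} [Fintype n] [DecidableEq n] {U K ρ σ τ A B : Matrix n n ℂ} {k r s : n → ℝ}
  {a p z α : ℝ}

theorem IsEigenbasis.add {c : n → ℝ} (h : IsEigenbasis U A c) (h' : IsEigenbasis U B k) :
    IsEigenbasis U (A + B) (fun i => c i + k i) := by
  refine ⟨h.orth, ?_⟩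
  rw [Matrix.add_mul, h.eig, h'.eig, ← Matrix.mul_add, diagonal_add]
  simp

theorem traceFun_mono_of_pos (hp0 : 0 < p) (hp1 : p ≤ 1) (hz : 0 < z) (hK : K.IsHermitian)
    (hA : A.PosSemidef) (hB : B.PosSemidef) (hAB : A ≤ B) :
    traceFun p z K A ≤ traceFun p z K B :=
  rtr_pw_mono hz (conj_posSemidef hK (pw_posSemidef p hA)) (conj_pw_mono hp0 hp1 hK hA hB hAB)

theorem mul_rpow_mul_rpow {w x y : ℝ} (hw : 0 ≤ w) (hx : 0 ≤ x) (hy : 0 ≤ y) :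
    (w * (x * y) ^ p) ^ z = x ^ (p * z) * (w * y ^ p) ^ z := by
  rw [Real.mul_rpow hx hy, mul_left_comm, Real.mul_rpow (by positivity) (by positivity),
    ← Real.rpow_mul hx]

/-- For `0 < p` with `p * z < 1`, an optimizer commuting with `K` has full support relative to `K`,
since the derivative in a direction of missing support is infinite. -/
theorem IsEigenbasis.pos_of_optimal (hU : IsEigenbasis U σ s) (hKU : IsEigenbasis U K k)
    (hρU : IsEigenbasis U ρ r) (hKH : K.IsHermitian) (hσ : σ.PosSemidef) (hτ : τ.PosSemidef)
    (hρ : ρ.PosSemidef) (hρτ : SuppLE ρ τ) (hp0 : 0 < p) (hp1 : p ≤ 1) (hz : 0 < z)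
    (hpz : p * z < 1)
    (hopt : ∀ ε, 0 < ε → ε ≤ 1 / 2 → traceFun p z K (segm ε σ τ) ≤ traceFun p z K σ)
    {j : n} (hk : k j ≠ 0) (hr : 0 < r j) : 0 < s j := by
  have hs := hU.nonneg hσ
  refine (hs j).lt_of_ne' fun hsj => ?_
  obtain ⟨t, ht, hle⟩ := hρτ.exists_smul_le hρ hτ
  set c := (k j ^ 2 * (t * r j) ^ p) ^ z with hc
  have hc0 : 0 < c := by positivity
  set Q := traceFun p z K σ with hQ
  have hQ0 : 0 ≤ Q := traceFun_nonneg hKH hσ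
  have hr0 := hρU.nonneg hρ
  have key : ∀ ε, 0 < ε → ε ≤ 1 / 2 → c ≤ Q * ε ^ (1 - p * z) := by
    intro ε hε0 hε1
    have hε2 : 0 < 1 - ε := by linarith
    have hA : ((1 - ε) • σ + (ε * t) • ρ).PosSemidef :=
      (hσ.smul hε2.le).add (hρ.smul (by positivity))
    have h1 : (1 - ε) • σ + (ε * t) • ρ ≤ segm ε σ τ := by
      refine add_le_add_right ?_ _
      rw [mul_smul]
      exact smul_le_smul_of_nonneg_left hle hε0.le
    have h2 := (traceFun_mono_of_pos hp0 hp1 hz hKH hA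
      (segm_posSemidef hσ hτ hε0.le (by linarith)) h1).trans (hopt ε hε0 hε1)
    rw [((hU.smul (1 - ε)).add (hρU.smul (ε * t))).traceFun_eq hA.1 hKU hKH] at h2
    have h3 : ∀ i, (1 - ε) * (k i ^ 2 * s i ^ p) ^ z + (if i = j then ε ^ (p * z) * c else 0) ≤
        (k i ^ 2 * ((1 - ε) * s i + ε * t * r i) ^ p) ^ z := by
      intro i
      split_ifs with hij
      · subst hij
        rw [hsj, Real.zero_rpow hp0.ne', mul_zero, mul_zero, zero_add, Real.zero_rpow hz.ne',
          mul_zero, zero_add, hc, mul_assoc, mul_rpow_mul_rpow (sq_nonneg _) hε0.le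
          (by positivity)]
      · have h4 : ((1 - ε) * s i) ^ p ≤ ((1 - ε) * s i + ε * t * r i) ^ p := by
          have := hs i
          have := hr0 i
          refine Real.rpow_le_rpow (by positivity) ?_ hp0.le
          have : 0 ≤ ε * t * r i := by positivity
          linarith
        have h5 : (1 - ε) ≤ (1 - ε) ^ (p * z) := by
          simpa using Real.rpow_le_rpow_of_exponent_ge hε2 (by linarith) hpz.le
        have hsi := hs i
        calc (1 - ε) * (k i ^ 2 * s i ^ p) ^ z + 0
            ≤ (1 - ε) ^ (p * z) * (k i ^ 2 * s i ^ p) ^ z := by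
              rw [add_zero]
              gcongr
          _ = (k i ^ 2 * ((1 - ε) * s i) ^ p) ^ z := by
              rw [mul_rpow_mul_rpow (sq_nonneg _) hε2.le hsi]
          _ ≤ _ := by gcongr
    have h6 := (Finset.sum_le_sum fun i (_ : i ∈ Finset.univ) => h3 i).trans h2
    rw [Finset.sum_add_distrib, ← Finset.mul_sum, Finset.sum_ite_eq' Finset.univ j,
      if_pos (Finset.mem_univ j), ← hU.traceFun_eq hσ.1 hKU hKH, ← hQ] at h6
    have h7 : ε ^ (p * z) * c ≤ ε ^ (p * z) * (Q * ε ^ (1 - p * z)) := by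
      have : ε ^ (p * z) * ε ^ (1 - p * z) = ε := by
        rw [← Real.rpow_add hε0, add_sub_cancel, Real.rpow_one]
      have e : ε ^ (p * z) * (Q * ε ^ (1 - p * z)) = Q * ε := by
        rw [mul_left_comm, this]
      rw [e]
      linarith
    exact le_of_mul_le_mul_left h7 (by positivity)
  have hθ : 0 < 1 - p * z := by linarith
  have hlim : Tendsto (fun ε : ℝ => Q * ε ^ (1 - p * z)) (nhdsWithin 0 (Ioi 0)) (nhds 0) := by
    have := ((Real.continuousAt_rpow_const 0 (1 - p * z) (Or.inr hθ.le)).tendsto).const_mul Q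
    rw [Real.zero_rpow hθ.ne', mul_zero] at this
    exact this.mono_left nhdsWithin_le_nhds
  have h0 : c ≤ 0 := by
    refine ge_of_tendsto hlim ?_
    filter_upwards [Ioc_mem_nhdsGT (show (0 : ℝ) < 1 / 2 by norm_num)] with ε hε
    exact key ε hε.1 hε.2
  linarith

theorem rpow_conj_value {x y : ℝ} (hx : 0 ≤ x) (hy : 0 ≤ y) (haz : 2 * a * z = α)
    (hpz : p * z = 1 - α) : ((x ^ a) ^ 2 * y ^ p) ^ z = x ^ α * y ^ (1 - α) := by
  rw [Real.mul_rpow (by positivity) (by positivity), ← Real.rpow_mul hy, hpz,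
    ← Real.rpow_natCast, ← Real.rpow_mul hx, ← Real.rpow_mul hx, ← haz]
  congr 2
  push_cast
  ring

theorem rpow_conj_derivative {x y : ℝ} (hx : 0 < x) (hy : 0 < y) (haz : 2 * a * z = α)
    (hpz : p * z = 1 - α) :
    ((x ^ a) ^ 2 * y ^ p) ^ (z - 1) * ((x ^ a) ^ 2 * y ^ (p - 1)) = x ^ α * y ^ (-α) := by
  rw [Real.mul_rpow (by positivity) (by positivity), ← Real.rpow_mul hy.le,
    ← Real.rpow_natCast, ← Real.rpow_mul hx.le, ← Real.rpow_mul hx.le, mul_mul_mul_comm,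
    ← Real.rpow_add hx, ← Real.rpow_add hy]
  congr 2
  · push_cast
    linear_combination haz
  · linear_combination hpz

theorem IsEigenbasis.traceFun_pw (hU : IsEigenbasis U σ s) (hρU : IsEigenbasis U ρ r)
    (hσ : σ.PosSemidef) (hρ : ρ.PosSemidef) (haz : 2 * a * z = α) (hpz : p * z = 1 - α) :
    traceFun p z (pw a ρ) σ = ∑ i, r i ^ α * s i ^ (1 - α) := by
  rw [hU.traceFun_eq hσ.1 (hρU.power hρ.1 a) (pw_isHermitian a ρ)]
  exact Finset.sum_congr rfl fun i _ =>
    rpow_conj_value (hρU.nonneg hρ i) (hU.nonneg hσ i) haz hpz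

theorem IsEigenbasis.pos_of_suppLE (hU : IsEigenbasis U σ s) (hρU : IsEigenbasis U ρ r)
    (hσ : σ.PosSemidef) (h : SuppLE ρ σ) {i : n} (hr : r i ≠ 0) :
    0 < s i := by
  refine (hU.nonneg hσ i).lt_of_ne' fun hs => hr ?_
  have hz0 : σ * replicateCol Unit (U.col i) = 0 := by
    rw [← replicateCol_mulVec, hU.mulVec_col, hs, zero_smul]
    rfl
  have h1 := h.mul_eq_zero hσ.1 hz0
  rw [← replicateCol_mulVec] at h1
  have h2 : ρ *ᵥ U.col i = 0 := replicateCol_injective (ι := Unit) (h1.trans rfl)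
  have h3 := hρU.qf_col i
  rw [qf_eq_ip, h2] at h3
  simpa [ip] using h3.symm

/-- The optimality condition for an optimizer `σ` commuting with `ρ`: the derivative operator
`∑ i, r i ^ α * s i ^ (-α) * uᵢuᵢᴴ` pairs with every `τ` to at most its value at `σ`. -/
theorem IsEigenbasis.sum_qf_le (hU : IsEigenbasis U σ s) (hρU : IsEigenbasis U ρ r)
    (hσ : σ.PosSemidef) (hτ : τ.PosSemidef) (hρ : ρ.PosSemidef) (hp0 : p ≠ 0) (hp : -1 < p)
    (hp1 : p ≤ 1) (hz : 0 < z) (hα : 0 < α) (haz : 2 * a * z = α) (hpz : p * z = 1 - α)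
    (hK : 0 < p ∨ SuppLE ρ σ) (hrs : ∀ i, r i ≠ 0 → 0 < s i)
    (hopt : ∀ ε, 0 < ε → ε ≤ 1 / 2 →
      p * traceFun p z (pw a ρ) (segm ε σ τ) ≤ p * traceFun p z (pw a ρ) σ) :
    ∑ i, r i ^ α * s i ^ (-α) * qf τ (U.col i) ≤ ∑ i, r i ^ α * s i ^ (1 - α) := by
  have ha : a ≠ 0 := by
    rintro rfl
    simp at haz
    exact hα.ne haz
  have h := hU.sum_derivative_le (hρU.power hρ.1 a) (pw_isHermitian a ρ) hσ hτ hp0 hp hp1 hz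
    (hK.imp_right fun h => suppLE_pw ha hρ.1 h) (fun i hi => hrs i fun h0 => hi (by
      simp only [h0, Real.zero_rpow ha])) hopt
  rw [← sub_nonpos, ← Finset.sum_sub_distrib]
  refine (Finset.sum_congr rfl fun i _ => ?_).trans_le h
  rcases eq_or_ne (r i) 0 with h0 | h0
  · simp [h0, Real.zero_rpow ha, Real.zero_rpow hα.ne']
  · have hr : 0 < r i := (hρU.nonneg hρ i).lt_of_ne' h0
    have hs := hrs i h0
    rw [rpow_conj_derivative hr hs haz hpz, show 1 - α = -α + 1 by ring, Real.rpow_add hs,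
      Real.rpow_one]
    ring

theorem rtr_conj_diagonal_mul (U Y : Matrix n n ℂ) (c : n → ℝ) :
    rtr (U * diagonal (fun i => (c i : ℂ)) * Uᴴ * Y) = ∑ i, c i * qf Y (U.col i) := by
  have e : rtr (U * diagonal (fun i => (c i : ℂ)) * Uᴴ * Y) =
      rtr (diagonal (fun i => (c i : ℂ)) * (Uᴴ * (Y * U))) := by
    rw [Matrix.mul_assoc, Matrix.mul_assoc, rtr_mul_comm]
    simp only [Matrix.mul_assoc]
  rw [e, rtr, trace, Complex.re_sum]
  refine Finset.sum_congr rfl fun i _ => ?_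
  rw [diag_apply, Matrix.diagonal_mul, Complex.re_ofReal_mul, qf, mul_col, Matrix.mul_apply]
  rfl

theorem conj_diagonal_posSemidef (U : Matrix n n ℂ) {c : n → ℝ} (hc : ∀ i, 0 ≤ c i) :
    (U * diagonal (fun i => (c i : ℂ)) * Uᴴ).PosSemidef := by
  refine PosSemidef.mul_mul_conjTranspose_same (PosSemidef.diagonal fun i => ?_) U
  exact Complex.zero_le_real.mpr (hc i)

end Optimizer

section Bipolar

variable {n : Type*} [Fintype n] [DecidableEq n]

theorem rtr_conjTranspose (A : Matrix n n ℂ) : rtr Aᴴ = rtr A := by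
  rw [rtr, trace_conjTranspose]
  simp [rtr]

theorem exists_rtr_eq (f : Matrix n n ℂ →ₗ[ℝ] ℝ) :
    ∃ X : Matrix n n ℂ, X.IsHermitian ∧ ∀ M : Matrix n n ℂ, M.IsHermitian →
      f M = rtr (X * M) := by
  set Z : Matrix n n ℂ := Matrix.of fun j i =>
    (f (single i j 1) : ℂ) - Complex.I * f (single i j Complex.I) with hZ
  have hf : ∀ M : Matrix n n ℂ, f M = rtr (Z * M) := by
    intro M
    have h1 : M = ∑ i, ∑ j, ((M i j).re • single i j (1 : ℂ) +
        (M i j).im • single i j Complex.I) := by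
      conv_lhs => rw [matrix_eq_sum_single M]
      refine Finset.sum_congr rfl fun i _ => Finset.sum_congr rfl fun j _ => ?_
      rw [smul_single, smul_single, ← single_add]
      congr 1
      simp [Complex.re_add_im]
    conv_lhs => rw [h1]
    simp only [map_sum, map_add, map_smul, smul_eq_mul]
    rw [rtr, trace, Complex.re_sum, Finset.sum_comm]
    refine Finset.sum_congr rfl fun j _ => ?_
    rw [diag_apply, Matrix.mul_apply, Complex.re_sum]
    refine Finset.sum_congr rfl fun i _ => ?_
    simp [hZ]
    ring
  refine ⟨(1 / 2 : ℝ) • (Z + Zᴴ), ?_, fun M hM => ?_⟩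
  · rw [Matrix.IsHermitian, conjTranspose_smul, conjTranspose_add, conjTranspose_conjTranspose,
      add_comm]
    simp
  · have h2 : rtr (Zᴴ * M) = rtr (Z * M) := by
      rw [← rtr_conjTranspose, conjTranspose_mul, conjTranspose_conjTranspose, hM.eq,
        rtr_mul_comm]
    rw [Matrix.smul_mul, rtr_smul, Matrix.add_mul, rtr_add, h2, hf]
    ring

theorem rtr_mul_vecMulVec (X : Matrix n n ℂ) (v : n → ℂ) :
    rtr (X * vecMulVec v (star v)) = qf X v := by
  rw [rtr, mul_vecMulVec, trace_vecMulVec, qf, dotProduct_comm]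

theorem posSemidef_vecMulVec (v : n → ℂ) : (vecMulVec v (star v)).PosSemidef :=
  posSemidef_vecMulVec_self_star v

/-- A bipolar theorem: a positive semidefinite `Y` pairing to at most `1` with the polar of a
compact convex set `S` is dominated by an element of `S`. -/
theorem exists_le_of_polar {S : Set (Matrix n n ℂ)} (hconv : Convex ℝ S) (hcomp : IsCompact S)
    (hne : S.Nonempty) (hpsd : ∀ X ∈ S, X.PosSemidef) {Y : Matrix n n ℂ} (hY : Y.PosSemidef)
    (hpol : ∀ X ∈ polar S, rtr (X * Y) ≤ 1) : ∃ τ ∈ S, Y ≤ τ := by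
  by_contra! hcon
  have hcl : IsClosed {M : Matrix n n ℂ | Y ≤ M} := 
    isClosed_le_matrix.preimage (f := fun M => (Y, M)) (by fun_prop)
  have hcv : Convex ℝ {M : Matrix n n ℂ | Y ≤ M} := convex_Ici Y
  have : LocallyConvexSpace ℝ (Matrix n n ℂ) :=
    inferInstanceAs (LocallyConvexSpace ℝ (n → n → ℂ))
  obtain ⟨f, u, v, hfu, huv, hfv⟩ := geometric_hahn_banach_compact_closed hconv hcomp hcv hcl
    (Set.disjoint_left.mpr fun M hM hM' => hcon M hM hM')
  obtain ⟨X, hX, hfX⟩ := exists_rtr_eq f.toLinearMap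
  have hXp : X.PosSemidef := by
    refine posSemidef_of_qf hX fun w => ?_
    by_contra! hneg
    have h0 := hfv Y (le_refl Y)
    obtain ⟨t, ht⟩ : ∃ t : ℝ, t = (f Y - v) / -(qf X w) := ⟨_, rfl⟩
    have ht0 : 0 ≤ t := by
      rw [ht]
      exact div_nonneg (by linarith) (by linarith)
    have hP := (posSemidef_vecMulVec w).smul ht0
    have h1 := hfv (Y + t • vecMulVec w (star w)) (le_add_of_nonneg_right hP.nonneg)
    have h2 : f (vecMulVec w (star w)) = qf X w := by
      rw [← rtr_mul_vecMulVec]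
      exact hfX _ (posSemidef_vecMulVec w).1
    rw [map_add, map_smul, h2, smul_eq_mul] at h1
    have h3 : t * qf X w = -(f Y - v) := by
      rw [ht, div_neg, neg_mul, div_mul_cancel₀ _ hneg.ne]
    linarith
  have hfS : ∀ τ ∈ S, rtr (X * τ) < u := fun τ hτ => by
    have := hfu τ hτ
    rwa [show f τ = rtr (X * τ) from hfX τ (hpsd τ hτ).1] at this
  obtain ⟨τ₀, hτ₀⟩ := hne
  have hu : 0 < u := (rtr_mul_nonneg hXp (hpsd τ₀ hτ₀)).trans_lt (hfS τ₀ hτ₀)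
  have hmem : u⁻¹ • X ∈ polar S := by
    refine ⟨hXp.smul (by positivity), fun τ hτ => ?_⟩
    rw [Matrix.smul_mul, rtr_smul, inv_mul_le_iff₀ hu, mul_one]
    exact (hfS τ hτ).le
  have h1 := hpol _ hmem
  rw [Matrix.smul_mul, rtr_smul, inv_mul_le_iff₀ hu, mul_one] at h1
  have h2 := hfv Y (le_refl Y)
  rw [show f Y = rtr (X * Y) from hfX Y hY.1] at h2
  linarith

end Bipolar

section Dominance

variable {d₁ d₂ : ℕ} {U ρ₁ σ₁ : Matrix (Fin d₁) (Fin d₁) ℂ} {ρ₂ τ : Matrix (Fin d₂) (Fin d₂) ℂ}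
  {σ : Matrix (Fin (d₁ * d₂)) (Fin (d₁ * d₂)) ℂ} {r s : Fin d₁ → ℝ} {a p z α : ℝ}

theorem dtens_isHermitian {A : Matrix (Fin d₁) (Fin d₁) ℂ} {B : Matrix (Fin d₂) (Fin d₂) ℂ}
    (hA : A.IsHermitian) (hB : B.IsHermitian) : (dtens A B).IsHermitian := by
  ext x y
  simp only [conjTranspose_apply, dtens, Matrix.of_apply, star_mul']
  rw [hA.apply, hB.apply]

theorem pw_dtens_mul_tensCol (hρU : IsEigenbasis U ρ₁ r) (hρ₁ : ρ₁.PosSemidef)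
    (hρ₂ : ρ₂.PosSemidef) (a : ℝ) (i : Fin d₁) :
    pw a (dtens ρ₁ ρ₂) * tensCol d₂ U i = tensCol d₂ U i * (r i ^ a • pw a ρ₂) := by
  have := hfun_intertwine (fun x => x ^ a) (dtens_isHermitian hρ₁.1 hρ₂.1)
    (hρ₂.smul (hρU.nonneg hρ₁ i)).1 (dtens_mul_tensCol hρU.eig ρ₂ i)
  change pw a _ * _ = _ * pw a _ at this
  rw [this, pw_smul (hρU.nonneg hρ₁ i) a hρ₂]

/-- Multiplicativity on tensor products whose first factors commute. -/
theorem traceFun_dtens (hU : IsEigenbasis U σ₁ s) (hρU : IsEigenbasis U ρ₁ r)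
    (hσ₁ : σ₁.PosSemidef) (hρ₁ : ρ₁.PosSemidef) (hρ₂ : ρ₂.PosSemidef) (hτ : τ.PosSemidef)
    (haz : 2 * a * z = α) (hpz : p * z = 1 - α) :
    traceFun p z (pw a (dtens ρ₁ ρ₂)) (dtens σ₁ τ) =
      (∑ i, r i ^ α * s i ^ (1 - α)) * traceFun p z (pw a ρ₂) τ := by
  have hr := hρU.nonneg hρ₁
  have hs := hU.nonneg hσ₁
  rw [(tensCol_isDecomp hU.orth).traceFun_eq (pw_isHermitian _ _) (dtens_isHermitian hσ₁.1 hτ.1)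
    (fun i => (pw_isHermitian a ρ₂).smul (IsSelfAdjoint.all (r i ^ a)))
    (fun i => (hτ.smul (hs i)).1) (pw_dtens_mul_tensCol hρU hρ₁ hρ₂ a)
    (dtens_mul_tensCol hU.eig τ), Finset.sum_mul]
  refine Finset.sum_congr rfl fun i _ => ?_
  have hri := hr i
  rw [traceFun_smul_left (by positivity) (pw_isHermitian a ρ₂) (hτ.smul (hs i)),
    traceFun_smul (hs i) (pw_isHermitian a ρ₂) hτ, hpz, ← Real.rpow_mul hri,
    show a * (2 * z) = α by linarith, mul_assoc]

theorem tensCol_conj_posDef (hU : Uᴴ * U = 1) (hσ : σ.PosDef) (i : Fin d₁) :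
    ((tensCol d₂ U i)ᴴ * σ * tensCol d₂ U i).PosDef := by
  refine hσ.conjTranspose_mul_mul_same fun x y hxy => ?_
  have h := (tensCol_isDecomp (b := d₂) hU).orth_self i
  have h1 := congrArg ((tensCol d₂ U i)ᴴ *ᵥ ·) hxy
  simpa [mulVec_mulVec, h] using h1

theorem concaveOn_traceFun {n : Type*} [Fintype n] [DecidableEq n] {K : Matrix n n ℂ}
    (h : Admissible p z) (hK : K.IsHermitian) :
    ConcaveOn ℝ {A : Matrix n n ℂ | A.PosDef} fun A => p * traceFun p z K A :=
  ⟨fun _ h₁ _ h₂ _ _ ht₁ ht₂ ht => posDef_mix h₁ h₂ ht₁ ht₂ ht,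
    fun _ h₁ _ h₂ _ _ ht₁ ht₂ ht => h.traceFun_concave hK h₁ h₂ ht₁ ht₂ ht⟩

theorem traceFun_dtens_le_of_posDef (h : Admissible p z) (hU : IsEigenbasis U σ₁ s)
    (hρU : IsEigenbasis U ρ₁ r) (hσ₁ : σ₁.PosSemidef) (hρ₁ : ρ₁.PosSemidef) (hρ₂ : ρ₂.PosSemidef)
    (hα : 0 < α) (haz : 2 * a * z = α) (hpz : p * z = 1 - α) (hrs : ∀ i, r i ≠ 0 → 0 < s i)
    {Q : ℝ} (hQ : Q = ∑ i, r i ^ α * s i ^ (1 - α)) (hQ0 : 0 < Q) (hσ : σ.PosDef)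
    (hle : ∑ i, (r i ^ α * s i ^ (-α) / Q) • ((tensCol d₂ U i)ᴴ * σ * tensCol d₂ U i) ≤ τ) :
    p * traceFun p z (pw a (dtens ρ₁ ρ₂)) σ ≤ p * (Q * traceFun p z (pw a ρ₂) τ) := by
  set V := tensCol d₂ U
  have hr := hρU.nonneg hρ₁
  have hs := hU.nonneg hσ₁
  have hK := pw_isHermitian a ρ₂
  have hpd : ∀ i, ((V i)ᴴ * σ * V i).PosDef := tensCol_conj_posDef hU.orth hσ
  set w : Fin d₁ → ℝ := fun i => r i ^ α * s i ^ (1 - α) / Q with hw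
  set x : Fin d₁ → Matrix (Fin d₂) (Fin d₂) ℂ := fun i =>
    if r i = 0 then 1 else (s i)⁻¹ • ((V i)ᴴ * σ * V i) with hx
  have hxp : ∀ i, (x i).PosDef := fun i => by
    simp only [hx]
    split_ifs with h0
    · exact PosDef.one
    · exact (hpd i).smul (inv_pos.mpr (hrs i h0))
  have hw0 : ∀ i, 0 ≤ w i := fun i => by
    have := hr i
    have := hs i
    positivity
  have hw1 : ∑ i, w i = 1 := by
    rw [← Finset.sum_div, ← hQ, div_self hQ0.ne']
  have hwx : ∑ i, w i • x i = ∑ i, (r i ^ α * s i ^ (-α) / Q) • ((V i)ᴴ * σ * V i) := by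
    refine Finset.sum_congr rfl fun i _ => ?_
    simp only [hw, hx]
    split_ifs with h0
    · simp [h0, Real.zero_rpow hα.ne']
    · have := hrs i h0
      rw [smul_smul, show 1 - α = -α + 1 by ring, Real.rpow_add this, Real.rpow_one]
      congr 1
      field_simp
  have hval : ∀ i, traceFun p z (r i ^ a • pw a ρ₂) ((V i)ᴴ * σ * V i) =
      Q * (w i * traceFun p z (pw a ρ₂) (x i)) := by
    intro i
    have hri := hr i
    rw [traceFun_smul_left (by positivity) hK (hpd i).posSemidef, ← Real.rpow_mul hri,
      show a * (2 * z) = α by linarith]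
    simp only [hw, hx]
    split_ifs with h0
    · simp [h0, Real.zero_rpow hα.ne']
    · have hsi := hrs i h0
      rw [traceFun_smul (inv_nonneg.mpr hsi.le) hK (hpd i).posSemidef, hpz,
        Real.inv_rpow hsi.le]
      have : 0 < s i ^ (1 - α) := by positivity
      field_simp
  have hpin := (tensCol_isDecomp hU.orth).pinching h (pw_isHermitian a (dtens ρ₁ ρ₂))
    (fun i => hK.smul (IsSelfAdjoint.all (r i ^ a))) (pw_dtens_mul_tensCol hρU hρ₁ hρ₂ a) hσ
  have hjen := (concaveOn_traceFun h hK).le_map_sum (t := Finset.univ) (w := w) (p := x)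
    (fun i _ => hw0 i) hw1 fun i _ => hxp i
  have hpd' : (∑ i, w i • x i).PosDef :=
    (concaveOn_traceFun (K := pw a ρ₂) h hK).1.sum_mem (fun i _ => hw0 i) hw1 fun i _ => hxp i
  have hmono := h.traceFun_mono hK hpd' (hwx.trans_le hle)
  refine hpin.trans ?_
  have e : p * ∑ i, traceFun p z (r i ^ a • pw a ρ₂) ((V i)ᴴ * σ * V i) =
      Q * ∑ i, w i • (p * traceFun p z (pw a ρ₂) (x i)) := by
    simp only [hval, ← Finset.mul_sum, smul_eq_mul]
    rw [mul_left_comm, Finset.mul_sum]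
    congr 1
    exact Finset.sum_congr rfl fun i _ => by ring
  calc _ = Q * ∑ i, w i • (p * traceFun p z (pw a ρ₂) (x i)) := e
    _ ≤ Q * (p * traceFun p z (pw a ρ₂) τ) := by
      gcongr
      exact hjen.trans hmono
    _ = _ := by ring

theorem traceFun_dtens_le (h : Admissible p z) (hU : IsEigenbasis U σ₁ s)
    (hρU : IsEigenbasis U ρ₁ r) (hσ₁ : σ₁.PosSemidef) (hρ₁ : ρ₁.PosSemidef) (hρ₂ : ρ₂.PosSemidef)
    (hα : 0 < α) (haz : 2 * a * z = α) (hpz : p * z = 1 - α) (hrs : ∀ i, r i ≠ 0 → 0 < s i)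
    {Q : ℝ} (hQ : Q = ∑ i, r i ^ α * s i ^ (1 - α)) (hQ0 : 0 < Q) (hσ : σ.PosSemidef)
    (hτ : τ.PosSemidef)
    (hle : ∑ i, (r i ^ α * s i ^ (-α) / Q) • ((tensCol d₂ U i)ᴴ * σ * tensCol d₂ U i) ≤ τ)
    (hsσ : 0 < p ∨ SuppLE (dtens ρ₁ ρ₂) σ) (hsτ : 0 < p ∨ SuppLE ρ₂ τ) :
    p * traceFun p z (pw a (dtens ρ₁ ρ₂)) σ ≤ p * (Q * traceFun p z (pw a ρ₂) τ) := by
  have ha : a ≠ 0 := by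
    rintro rfl
    simp at haz
    exact hα.ne haz
  have hp : p ≠ 0 := by
    obtain ⟨-, ⟨hp, -⟩ | ⟨hp, -⟩⟩ := h
    exacts [hp.ne', hp.ne]
  have hr := hρU.nonneg hρ₁
  have hs := hU.nonneg hσ₁
  set c := ∑ i, r i ^ α * s i ^ (-α) / Q with hc
  have hc0 : 0 ≤ c := Finset.sum_nonneg fun i _ => by
    have := hr i
    have := hs i
    positivity
  have ht1 := tendsto_traceFun_shift hp h.1 (pw_isHermitian a (dtens ρ₁ ρ₂)) hσ
    (hsσ.imp_right fun h => suppLE_pw ha (dtens_isHermitian hρ₁.1 hρ₂.1) h)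
  have hscale : Tendsto (fun η : ℝ => η * (c + 1)) (nhdsWithin 0 (Ioi 0))
      (nhdsWithin 0 (Ioi 0)) := by
    refine tendsto_nhdsWithin_iff.mpr ⟨?_, ?_⟩
    · have : Tendsto (fun η : ℝ => η * (c + 1)) (nhds 0) (nhds (0 * (c + 1))) :=
        tendsto_id.mul_const _
      rw [zero_mul] at this
      exact this.mono_left nhdsWithin_le_nhds
    · filter_upwards [self_mem_nhdsWithin] with η hη
      have : (0 : ℝ) < η := hη
      exact mem_Ioi.mpr (by positivity)
  have ht2 := (tendsto_traceFun_shift hp h.1 (pw_isHermitian a ρ₂) hτ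
    (hsτ.imp_right fun h => suppLE_pw ha hρ₂.1 h)).comp hscale
  refine le_of_tendsto_of_tendsto (ht1.const_mul p) ((ht2.const_mul Q).const_mul p) ?_
  filter_upwards [self_mem_nhdsWithin] with η hη
  have hη0 : (0 : ℝ) < η := hη
  refine traceFun_dtens_le_of_posDef h hU hρU hσ₁ hρ₁ hρ₂ hα haz hpz hrs hQ hQ0
    (shift_posDef hη hσ) ?_
  have e : ∀ i, (tensCol d₂ U i)ᴴ * shift η σ * tensCol d₂ U i =
      (tensCol d₂ U i)ᴴ * σ * tensCol d₂ U i + η • (1 : Matrix (Fin d₂) (Fin d₂) ℂ) := by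
    intro i
    rw [shift, Matrix.mul_add, Matrix.add_mul, Matrix.mul_smul, Matrix.mul_one, Matrix.smul_mul,
      (tensCol_isDecomp hU.orth).orth_self]
  simp only [e, smul_add, Finset.sum_add_distrib, ← Finset.sum_smul]
  rw [← hc, shift, smul_smul]
  refine add_le_add hle ?_
  have : (1 : Matrix (Fin d₂) (Fin d₂) ℂ).PosSemidef := PosSemidef.one
  exact smul_le_smul_of_nonneg_right (by nlinarith) this.nonneg

/-- The polar condition on the tensor product yields a dominating element of the second set. -/
theorem exists_sum_conj_le {S₁ : Set (Matrix (Fin d₁) (Fin d₁) ℂ)}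
    {S₂ : Set (Matrix (Fin d₂) (Fin d₂) ℂ)}
    {S₁₂ : Set (Matrix (Fin (d₁ * d₂)) (Fin (d₁ * d₂)) ℂ)}
    (hpol : ∀ A ∈ polar S₁, ∀ B ∈ polar S₂, dtens A B ∈ polar S₁₂)
    (hconv : Convex ℝ S₂) (hcomp : IsCompact S₂) (hne : S₂.Nonempty)
    (hpsd : ∀ X ∈ S₂, X.PosSemidef) {c : Fin d₁ → ℝ} (hc : ∀ i, 0 ≤ c i)
    (hcS : ∀ τ ∈ S₁, ∑ i, c i * qf τ (U.col i) ≤ 1) (hσS : σ ∈ S₁₂) (hσ : σ.PosSemidef) :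
    ∃ τ ∈ S₂, ∑ i, c i • ((tensCol d₂ U i)ᴴ * σ * tensCol d₂ U i) ≤ τ := by
  have hΞ : U * diagonal (fun i => (c i : ℂ)) * Uᴴ ∈ polar S₁ :=
    ⟨conj_diagonal_posSemidef U hc, fun τ hτ => (rtr_conj_diagonal_mul U τ c).trans_le (hcS τ hτ)⟩
  refine exists_le_of_polar hconv hcomp hne hpsd ?_ fun X hX => ?_
  · exact posSemidef_sum _ fun i _ => (hσ.conjTranspose_mul_mul_same _).smul (hc i)
  · refine le_of_eq_of_le ?_ ((hpol _ hΞ X hX).2 σ hσS)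
    rw [← sum_tensCol_mul, Finset.mul_sum, Finset.sum_mul, rtr_sum, rtr_sum]
    refine Finset.sum_congr rfl fun i _ => ?_
    rw [Matrix.mul_smul, rtr_smul, Complex.coe_smul, Matrix.smul_mul, rtr_smul]
    congr 1
    rw [Matrix.mul_assoc _ _ σ, Matrix.mul_assoc _ _ (_ * σ), rtr_mul_comm, ← Matrix.mul_assoc,
      Matrix.mul_assoc, rtr_mul_comm, Matrix.mul_assoc, rtr_mul_comm]

end Dominance

section Divergence

variable {n : Type*} [Fintype n] [DecidableEq n] {ρ σ : Matrix n n ℂ} {α z : ℝ}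

/-- The condition under which the `α`-`z` Rényi relative entropy is finite. -/
def IsFinitePair (α : ℝ) (ρ σ : Matrix n n ℂ) : Prop :=
  (α < 1 ∧ (ρ * σ).trace ≠ 0) ∨ SuppLE ρ σ

theorem IsState.ne_zero (hρ : IsState ρ) : ρ ≠ 0 := by
  rintro rfl
  simpa using hρ.2

theorem IsFinitePair.trace_ne_zero (h : IsFinitePair α ρ σ) (hρ : IsState ρ)
    (hσ : σ.PosSemidef) : (ρ * σ).trace ≠ 0 := by
  rcases h with ⟨-, h⟩ | h
  · exact h
  · intro h0
    have h1 := h.mul_eq_zero hσ.1 ((trace_mul_eq_zero_iff hρ.1 hσ).mp h0)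
    have h2 : ρᴴ * ρ = 0 := by rwa [hρ.1.1.eq]
    exact hρ.ne_zero (conjTranspose_mul_self_eq_zero.mp h2)

theorem IsFinitePair.traceFun_pos (h : IsFinitePair α ρ σ) (hα : 0 < α) (hα1 : α ≠ 1) (hz : 0 < z)
    (hρ : IsState ρ) (hσ : σ.PosSemidef) :
    0 < traceFun ((1 - α) / z) z (pw (α / (2 * z)) ρ) σ :=
  (traceFun_pos_iff (by positivity) (div_ne_zero (sub_ne_zero.mpr hα1.symm) hz.ne') hz.ne'
    hρ.1 hσ).mpr (h.trace_ne_zero hρ hσ)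

theorem IsFinitePair.Daz_eq (h : IsFinitePair α ρ σ) (hα : 0 < α) (hα1 : α ≠ 1) (hz : 0 < z)
    (hρ : ρ.PosSemidef) (hσ : σ.PosSemidef) :
    Daz α z ρ σ =
      (((α - 1)⁻¹ * Real.log (traceFun ((1 - α) / z) z (pw (α / (2 * z)) ρ) σ) : ℝ) : EReal) := by
  rw [Daz, if_pos (h.imp_right (suppLE_iff_msupp hρ.1 hσ.1).mp), Qaz_eq_traceFun hα hα1 hz hρ hσ]

theorem Daz_eq_top (h : ¬ IsFinitePair α ρ σ) (hρ : ρ.PosSemidef) (hσ : σ.PosSemidef) :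
    Daz α z ρ σ = ⊤ :=
  if_neg fun h' => h (h'.imp_right (suppLE_iff_msupp hρ.1 hσ.1).mpr)

theorem inv_mul_log_le_iff (hα1 : α ≠ 1) (hz : 0 < z) {x y : ℝ} (hx : 0 < x) (hy : 0 < y) :
    (α - 1)⁻¹ * Real.log x ≤ (α - 1)⁻¹ * Real.log y ↔
      (1 - α) / z * y ≤ (1 - α) / z * x := by
  rcases hα1.lt_or_gt with h | h
  · rw [mul_le_mul_left_of_neg (inv_neg''.mpr (by linarith)), Real.log_le_log_iff hy hx,
      mul_le_mul_iff_right₀ (div_pos (by linarith) hz)]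
  · rw [mul_le_mul_iff_right₀ (inv_pos.mpr (by linarith)), Real.log_le_log_iff hx hy,
      mul_le_mul_left_of_neg (div_neg_of_neg_of_pos (by linarith) hz)]

theorem add_iInf_eq {ι : Type*} (f : ι → EReal) (s : Set ι) (x : ℝ) :
    (⨅ i ∈ s, ((x : EReal) + f i)) = x + ⨅ i ∈ s, f i := by
  have cancel : ∀ (y : ℝ) (w : EReal), ((-y : ℝ) : EReal) + (y + w) = w := fun y w => by
    rw [← add_assoc, ← EReal.coe_add, neg_add_cancel, EReal.coe_zero, zero_add]
  refine le_antisymm ?_ (le_iInf₂ fun i hi => add_le_add le_rfl (iInf₂_le i hi))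
  have h : ((-x : ℝ) : EReal) + (⨅ i ∈ s, ((x : EReal) + f i)) ≤ ⨅ i ∈ s, f i :=
    le_iInf₂ fun i hi => (add_le_add le_rfl (iInf₂_le i hi)).trans_eq (cancel x (f i))
  have h2 := add_le_add (le_refl (x : EReal)) h
  have h3 := cancel (-x) (⨅ i ∈ s, ((x : EReal) + f i))
  rw [neg_neg] at h3
  rwa [h3] at h2

theorem Dregion.pos (h : (α, z) ∈ Dregion) : 0 < α ∧ 0 < z := by
  rcases h with ⟨h1, -, h2⟩ | ⟨h1, h2, -⟩ | ⟨h1, h2⟩ <;> simp only at h1 h2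
  · exact ⟨h1, h1.trans_le ((le_max_left _ _).trans h2)⟩
  · exact ⟨by linarith, by linarith [(le_max_left _ _).trans h2]⟩
  · exact ⟨by linarith, h2⟩

theorem Dregion.admissible (h : (α, z) ∈ Dregion) (hα1 : α ≠ 1) (hz : |1 - α| / z ≠ 1) :
    Admissible ((1 - α) / z) z ∧ -1 < (1 - α) / z ∧ (1 - α) / z ≤ 1 := by
  obtain ⟨hα, hz0⟩ := Dregion.pos h
  have e : (1 - α) / z * z = 1 - α := div_mul_cancel₀ _ hz0.ne'
  rw [Admissible, e]
  rcases h with ⟨-, h1, h2⟩ | ⟨h1, h2, -⟩ | ⟨h1, -⟩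
  · simp only at h1 h2
    have h3 : 0 < (1 - α) / z := div_pos (by linarith) hz0
    have h4 : (1 - α) / z ≤ 1 := (div_le_one hz0).mpr ((le_max_right _ _).trans h2)
    exact ⟨⟨hz0, Or.inl ⟨h3, h4, by linarith⟩⟩, by linarith, h4⟩
  · simp only at h1 h2
    have h3 : (1 - α) / z < 0 := div_neg_of_neg_of_pos (by linarith) hz0
    have h4 : -1 < (1 - α) / z := by
      rw [abs_of_neg (by linarith)] at hz
      have h5 : -(1 - α) / z ≤ 1 :=
        (div_le_one hz0).mpr (by linarith [(le_max_right _ _).trans h2])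
      have h6 := lt_of_le_of_ne h5 hz
      rw [neg_div] at h6
      linarith
    exact ⟨⟨hz0, Or.inr ⟨h3, h4.le, by linarith [(le_max_left _ _).trans h2]⟩⟩, h4,
      by linarith⟩
  · exact absurd h1 hα1

end Divergence

section Additivity

variable {d₁ d₂ : ℕ} {α z : ℝ} {ρ₁ σ₁ U : Matrix (Fin d₁) (Fin d₁) ℂ}
  {ρ₂ τ : Matrix (Fin d₂) (Fin d₂) ℂ} {σ : Matrix (Fin (d₁ * d₂)) (Fin (d₁ * d₂)) ℂ}
  {r c : Fin d₁ → ℝ}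

theorem suppLE_of_sum_conj_le (hρU : IsEigenbasis U ρ₁ r) (hρ₁ : ρ₁.PosSemidef)
    (hρ₂ : ρ₂.PosSemidef) (hσ : σ.PosSemidef) (hτ : τ.PosSemidef)
    (h : SuppLE (dtens ρ₁ ρ₂) σ) (hc : ∀ i, 0 ≤ c i) {j : Fin d₁} (hcj : 0 < c j) (hrj : 0 < r j)
    (hle : ∑ i, c i • ((tensCol d₂ U i)ᴴ * σ * tensCol d₂ U i) ≤ τ) : SuppLE ρ₂ τ := by
  obtain ⟨t, ht, hts⟩ := h.exists_smul_le (dtens_posSemidef hρ₁ hρ₂) hσ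
  have hV := (tensCol_isDecomp (b := d₂) hρU.orth).orth_self j
  have h1 : (t * r j) • ρ₂ ≤ (tensCol d₂ U j)ᴴ * σ * tensCol d₂ U j := by
    rw [Matrix.le_iff]
    have := (Matrix.le_iff.mp hts).conjTranspose_mul_mul_same (tensCol d₂ U j)
    rwa [Matrix.mul_sub, Matrix.sub_mul, Matrix.mul_smul, Matrix.smul_mul, Matrix.mul_assoc _
      (dtens ρ₁ ρ₂), dtens_mul_tensCol hρU.eig, ← Matrix.mul_assoc, hV, Matrix.one_mul,
      smul_smul] at this
  have h2 : c j • ((tensCol d₂ U j)ᴴ * σ * tensCol d₂ U j) ≤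
      ∑ i, c i • ((tensCol d₂ U i)ᴴ * σ * tensCol d₂ U i) :=
    Finset.single_le_sum (f := fun i => c i • ((tensCol d₂ U i)ᴴ * σ * tensCol d₂ U i))
      (fun i _ => ((hσ.conjTranspose_mul_mul_same _).smul (hc i)).nonneg)
      (Finset.mem_univ j)
  have h3 : (c j * (t * r j)) • ρ₂ ≤ τ := by
    rw [mul_smul]
    exact (smul_le_smul_of_nonneg_left h1 hcj.le).trans (h2.trans hle)
  have hpos : 0 < c j * (t * r j) := by positivity
  exact (suppLE_smul hpos.ne').mp (suppLE_of_le (hρ₂.smul hpos.le) hτ.1 h3)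

theorem az_additivity_of_ne_one (hd₁ : 1 ≤ d₁) (hd₂ : 1 ≤ d₂) (hαz : (α, z) ∈ Dregion)
    (hα1 : α ≠ 1) (hz : |1 - α| / z ≠ 1) (hρ₁ : IsState ρ₁) (hρ₂ : IsState ρ₂)
    {S : (d : ℕ) → Set (Matrix (Fin d) (Fin d) ℂ)} (hS : Assumption1' S)
    (hsupp₁ : ∃ τ ∈ S d₁, IsState τ ∧ msupp ρ₁ ≤ msupp τ) (hne₂ : (S d₂).Nonempty)
    (hσ₁ : σ₁ ∈ S d₁) (hmin₁ : ∀ σ ∈ S d₁, Daz α z ρ₁ σ₁ ≤ Daz α z ρ₁ σ)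
    (hcomm : σ₁ * ρ₁ = ρ₁ * σ₁) :
    (⨅ σ ∈ S (d₁ * d₂), Daz α z (dtens ρ₁ ρ₂) σ) =
      (⨅ σ ∈ S d₁, Daz α z ρ₁ σ) + ⨅ σ ∈ S d₂, Daz α z ρ₂ σ := by
  obtain ⟨hα, hz0⟩ := Dregion.pos hαz
  obtain ⟨hadm, hp, hp1⟩ := Dregion.admissible hαz hα1 hz
  have hlog : ∀ {x y : ℝ}, 0 < x → 0 < y → _ := fun hx hy => inv_mul_log_le_iff hα1 hz0 hx hy
  set p := (1 - α) / z with hpdef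
  set a := α / (2 * z) with hadef
  have haz : 2 * a * z = α := by rw [hadef]; field_simp
  have hpz : p * z = 1 - α := div_mul_cancel₀ _ hz0.ne'
  have hp0 : p ≠ 0 := div_ne_zero (sub_ne_zero.mpr hα1.symm) hz0.ne'
  have ha0 : a ≠ 0 := by positivity
  have hpα : 0 < p ↔ α < 1 := by rw [hpdef, div_pos_iff_of_pos_right hz0, sub_pos]
  have hd : 1 ≤ d₁ * d₂ := Nat.mul_pos hd₁ hd₂
  have hρ := dtens_isState hρ₁ hρ₂
  have hσ₁p := hS.psd d₁ hd₁ σ₁ hσ₁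
  obtain ⟨τ₀, hτ₀, hτ₀s, hτ₀m⟩ := hsupp₁
  have hτ₀le : SuppLE ρ₁ τ₀ := (suppLE_iff_msupp hρ₁.1.1 hτ₀s.1.1).mpr hτ₀m
  have hfin₁ : IsFinitePair α ρ₁ σ₁ := by
    by_contra hcon
    have h1 := hmin₁ τ₀ hτ₀
    rw [Daz_eq_top hcon hρ₁.1 hσ₁p, IsFinitePair.Daz_eq (Or.inr hτ₀le) hα hα1 hz0 hρ₁.1 hτ₀s.1,
      top_le_iff] at h1
    exact EReal.coe_ne_top _ h1
  have hside : ∀ {n : Type} [Fintype n] [DecidableEq n] {ρ σ : Matrix n n ℂ},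
      IsFinitePair α ρ σ → 0 < p ∨ SuppLE ρ σ := fun h =>
    h.imp_left fun h => hpα.mpr h.1
  obtain ⟨U, s, r, hUU, hUσ, hUρ⟩ := exists_common_eigenbasis hσ₁p.1 hρ₁.1.1 hcomm
  have hU : IsEigenbasis U σ₁ s := ⟨hUU, hUσ⟩
  have hρU : IsEigenbasis U ρ₁ r := ⟨hUU, hUρ⟩
  have hr := hρU.nonneg hρ₁.1
  have hs := hU.nonneg hσ₁p
  have hopt : ∀ τ ∈ S d₁, ∀ ε, 0 < ε → ε ≤ 1 / 2 →
      p * traceFun p z (pw a ρ₁) (segm ε σ₁ τ) ≤ p * traceFun p z (pw a ρ₁) σ₁ := by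
    intro τ hτ ε hε0 hε1
    have hτp := hS.psd d₁ hd₁ τ hτ
    have hmem : segm ε σ₁ τ ∈ S d₁ :=
      hS.convex d₁ hd₁ hσ₁ hτ (by linarith) hε0.le (by ring)
    have hseg := segm_posSemidef hσ₁p hτp hε0.le (by linarith)
    by_cases hf : IsFinitePair α ρ₁ (segm ε σ₁ τ)
    · have h1 := hmin₁ _ hmem
      rw [hfin₁.Daz_eq hα hα1 hz0 hρ₁.1 hσ₁p, hf.Daz_eq hα hα1 hz0 hρ₁.1 hseg,
        EReal.coe_le_coe_iff] at h1
      exact (hlog (hfin₁.traceFun_pos hα hα1 hz0 hρ₁ hσ₁p)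
        (hf.traceFun_pos hα hα1 hz0 hρ₁ hseg)).mp h1
    · rcases hside hfin₁ with hpos | hsup
      · have htr : (ρ₁ * segm ε σ₁ τ).trace = 0 := by
          by_contra htr
          exact hf (Or.inl ⟨hpα.mp hpos, htr⟩)
        have h0 : traceFun p z (pw a ρ₁) (segm ε σ₁ τ) ≤ 0 := not_lt.mp fun h =>
          (traceFun_pos_iff ha0 hp0 hz0.ne' hρ₁.1 hseg).mp h htr
        have h1 : 0 ≤ traceFun p z (pw a ρ₁) σ₁ := traceFun_nonneg (pw_isHermitian a ρ₁) hσ₁p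
        exact mul_le_mul_of_nonneg_left (h0.trans h1) hpos.le
      · refine absurd (Or.inr (hsup.trans hσ₁p.1 ((suppLE_smul (t := 1 - ε) (by linarith)).mp ?_)))
          hf
        exact suppLE_of_le (hσ₁p.smul (by linarith)) hseg.1 (smul_le_segm hτp hε0.le)
  have hrs : ∀ i, r i ≠ 0 → 0 < s i := by
    intro i hri
    have hri0 : 0 < r i := (hr i).lt_of_ne' hri
    rcases hside hfin₁ with hpos | hsup
    · exact hU.pos_of_optimal (hρU.power hρ₁.1.1 a) hρU (pw_isHermitian a ρ₁) hσ₁p hτ₀s.1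
        hρ₁.1 hτ₀le hpos hp1 hz0 (by linarith)
        (fun ε h1 h2 => le_of_mul_le_mul_left (hopt τ₀ hτ₀ ε h1 h2) hpos)
        (by positivity) hri0
    · exact hU.pos_of_suppLE hρU hσ₁p hsup hri
  obtain ⟨Q, hQ⟩ : ∃ Q, Q = ∑ i, r i ^ α * s i ^ (1 - α) := ⟨_, rfl⟩
  have hQF : traceFun p z (pw a ρ₁) σ₁ = Q := by
    rw [hU.traceFun_pw hρU hσ₁p hρ₁.1 haz hpz, hQ]
  have hQ0 : 0 < Q := hQF ▸ hfin₁.traceFun_pos hα hα1 hz0 hρ₁ hσ₁p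
  have hx : Daz α z ρ₁ σ₁ = (((α - 1)⁻¹ * Real.log Q : ℝ) : EReal) := by
    rw [hfin₁.Daz_eq hα hα1 hz0 hρ₁.1 hσ₁p, ← hQF]
  have hsum : ∀ {f : ℝ}, 0 < f → (((α - 1)⁻¹ * Real.log (Q * f) : ℝ) : EReal) =
      (((α - 1)⁻¹ * Real.log Q : ℝ) : EReal) + (((α - 1)⁻¹ * Real.log f : ℝ) : EReal) :=
    fun hf => by
      rw [Real.log_mul hQ0.ne' hf.ne', mul_add, EReal.coe_add]
  have hinf₁ : (⨅ σ ∈ S d₁, Daz α z ρ₁ σ) = (((α - 1)⁻¹ * Real.log Q : ℝ) : EReal) :=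
    hx ▸ le_antisymm (iInf₂_le σ₁ hσ₁) (le_iInf₂ hmin₁)
  rw [hinf₁, ← add_iInf_eq]
  apply le_antisymm
  · refine le_iInf₂ fun τ hτ => ?_
    have hτp := hS.psd d₂ hd₂ τ hτ
    by_cases hf : IsFinitePair α ρ₂ τ
    · have hf₁₂ : IsFinitePair α (dtens ρ₁ ρ₂) (dtens σ₁ τ) := by
        by_cases hα' : α < 1
        · refine Or.inl ⟨hα', ?_⟩
          rw [← dtens_mul, dtens_trace]
          exact mul_ne_zero (hfin₁.trace_ne_zero hρ₁ hσ₁p) (hf.trace_ne_zero hρ₂ hτp)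
        · have h1 := hfin₁.resolve_left fun h => hα' h.1
          have h2 := hf.resolve_left fun h => hα' h.1
          rw [suppLE_iff_msupp hρ₁.1.1 hσ₁p.1] at h1
          rw [suppLE_iff_msupp hρ₂.1.1 hτp.1] at h2
          exact Or.inr ((suppLE_iff_msupp hρ.1.1 (dtens_posSemidef hσ₁p hτp).1).mpr
            (msupp_dtens_le h1 h2))
      refine (iInf₂_le _ (hS.tens d₁ d₂ hd₁ hd₂ σ₁ hσ₁ τ hτ)).trans_eq ?_
      rw [hf₁₂.Daz_eq hα hα1 hz0 hρ.1 (dtens_posSemidef hσ₁p hτp),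
        traceFun_dtens hU hρU hσ₁p hρ₁.1 hρ₂.1 hτp haz hpz, ← hQ,
        hsum (hf.traceFun_pos hα hα1 hz0 hρ₂ hτp), hf.Daz_eq hα hα1 hz0 hρ₂.1 hτp]
    · rw [Daz_eq_top hf hρ₂.1 hτp, EReal.coe_add_top]
      exact le_top
  · refine le_iInf₂ fun σ hσ => ?_
    have hσp := hS.psd _ hd σ hσ
    by_cases hf : IsFinitePair α (dtens ρ₁ ρ₂) σ
    · have hc : ∀ i, 0 ≤ r i ^ α * s i ^ (-α) / Q := fun i => by
        have := hr i
        have := hs i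
        positivity
      obtain ⟨τ, hτ, hle⟩ := exists_sum_conj_le (U := U) (hS.polarTens d₁ d₂ hd₁ hd₂)
        (hS.convex d₂ hd₂) (hS.compact d₂ hd₂) hne₂ (hS.psd d₂ hd₂) hc (fun τ hτ => by
          have := hU.sum_qf_le hρU hσ₁p (hS.psd d₁ hd₁ τ hτ) hρ₁.1 hp0 hp hp1 hz0 hα haz hpz
            (hside hfin₁) hrs (hopt τ hτ)
          rw [← hQ] at this
          simp only [div_mul_eq_mul_div]
          rwa [← Finset.sum_div, div_le_one hQ0]) hσ hσp
      have hτp := hS.psd d₂ hd₂ τ hτ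
      have hsτ : 0 < p ∨ SuppLE ρ₂ τ := by
        refine (hside hf).imp_right fun hsup => ?_
        obtain ⟨j, hj⟩ : ∃ j, r j ≠ 0 := by
          by_contra! hr0
          have h1 := hρU.rtr_eq
          simp [rtr, hρ₁.2, hr0] at h1
        have hrj : 0 < r j := (hr j).lt_of_ne' hj
        have hsj := hrs j hj
        exact suppLE_of_sum_conj_le hρU hρ₁.1 hρ₂.1 hσp hτp hsup hc (by positivity) hrj hle
      have hF := traceFun_dtens_le hadm hU hρU hσ₁p hρ₁.1 hρ₂.1 hα haz hpz hrs hQ hQ0 hσp hτp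
        hle (hside hf) hsτ
      have hF₁₂ := hf.traceFun_pos hα hα1 hz0 hρ hσp
      have hfτ : IsFinitePair α ρ₂ τ := by
        rcases hsτ with hpos | hsup
        · refine Or.inl ⟨hpα.mp hpos, (traceFun_pos_iff ha0 hp0 hz0.ne' hρ₂.1 hτp).mp ?_⟩
          exact pos_of_mul_pos_right (hF₁₂.trans_le (le_of_mul_le_mul_left hF hpos)) hQ0.le
        · exact Or.inr hsup
      have hF₂ := hfτ.traceFun_pos hα hα1 hz0 hρ₂ hτp
      refine (iInf₂_le τ hτ).trans ?_
      rw [hfτ.Daz_eq hα hα1 hz0 hρ₂.1 hτp, ← hsum hF₂, hf.Daz_eq hα hα1 hz0 hρ.1 hσp,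
        EReal.coe_le_coe_iff]
      exact (hlog (mul_pos hQ0 hF₂) hF₁₂).mpr hF
    · rw [Daz_eq_top hf hρ.1 hσp]
      exact le_top

theorem Daz_one {n : Type*} [Fintype n] [DecidableEq n] (z : ℝ) (ρ σ : Matrix n n ℂ) :
    Daz 1 z ρ σ = if msupp ρ ≤ msupp σ then 0 else ⊤ := by
  simp [Daz]

theorem iInf_Daz_one {n : Type*} [Fintype n] [DecidableEq n] {ρ τ : Matrix n n ℂ}
    {S : Set (Matrix n n ℂ)} (hτ : τ ∈ S) (h : msupp ρ ≤ msupp τ) (z : ℝ) :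
    (⨅ σ ∈ S, Daz 1 z ρ σ) = 0 := by
  refine le_antisymm ((iInf₂_le τ hτ).trans_eq (by rw [Daz_one, if_pos h]))
    (le_iInf₂ fun σ _ => ?_)
  rw [Daz_one]
  split_ifs
  exacts [le_rfl, le_top]

end Additivity

end Auxiliary

end QHT

namespace QHT

/-- Lemma 17 of the paper: additivity of the minimized `α`-`z` Rényi
relative entropy when one of the states commutes with its single-copy optimizer. -/
theorem az_additivity_of_commuting_optimizer {d₁ d₂ : ℕ} (hd₁ : 1 ≤ d₁) (hd₂ : 1 ≤ d₂)
    (α z : ℝ) (hαz : (α, z) ∈ Dregion) (hz : |1 - α| / z ≠ 1)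
    (ρ₁ : Matrix (Fin d₁) (Fin d₁) ℂ) (ρ₂ : Matrix (Fin d₂) (Fin d₂) ℂ)
    (hρ₁ : IsState ρ₁) (hρ₂ : IsState ρ₂)
    (S : (d : ℕ) → Set (Matrix (Fin d) (Fin d) ℂ)) (hS : Assumption1' S)
    (hsupp₁ : ∃ τ ∈ S d₁, IsState τ ∧ msupp ρ₁ ≤ msupp τ)
    (hsupp₂ : ∃ τ ∈ S d₂, IsState τ ∧ msupp ρ₂ ≤ msupp τ)
    (σ₁ : Matrix (Fin d₁) (Fin d₁) ℂ) (hσ₁ : σ₁ ∈ S d₁)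
    (hmin₁ : ∀ σ ∈ S d₁, Daz α z ρ₁ σ₁ ≤ Daz α z ρ₁ σ)
    (hcomm : σ₁ * ρ₁ = ρ₁ * σ₁) :
    (⨅ σ ∈ S (d₁ * d₂), Daz α z (dtens ρ₁ ρ₂) σ) =
      (⨅ σ ∈ S d₁, Daz α z ρ₁ σ) + ⨅ σ ∈ S d₂, Daz α z ρ₂ σ := by
  by_cases hα1 : α = 1
  · subst hα1
    obtain ⟨τ₁, hτ₁, -, h₁⟩ := hsupp₁
    obtain ⟨τ₂, hτ₂, -, h₂⟩ := hsupp₂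
    rw [iInf_Daz_one (hS.tens d₁ d₂ hd₁ hd₂ τ₁ hτ₁ τ₂ hτ₂) (msupp_dtens_le h₁ h₂),
      iInf_Daz_one hτ₁ h₁, iInf_Daz_one hτ₂ h₂, add_zero]
  · obtain ⟨τ₂, hτ₂, -⟩ := hsupp₂
    exact az_additivity_of_ne_one hd₁ hd₂ hαz hα1 hz hρ₁ hρ₂ hS hsupp₁ ⟨τ₂, hτ₂⟩ hσ₁ hmin₁ hcomm

end QHT
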